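/- Let n ≥ 8 and let E be a rank two vector bundle on P^n with H^i_*(E) = 0 for all i = 3, ..., n-3. Then E splits as a direct sum of two line bundles. -/

import Mathlib

/-!
Background setup (the paper works on projective space `ℙⁿ` over a field `K`):
we encode a coherent sheaf on `ℙⁿ_K` by a module `M` over the homogeneous coordinate
ring `S = K[X₀,…,Xₙ]` (namely `M = Γ_*` of the sheaf), and the intermediate cohomology
module `H^i_*(F) = ⊕_ν H^i(ℙⁿ, F(ν))` (for `i ≥ 1`) by the local cohomology module
`H^{i+1}_𝔪(M)` at the irrelevant maximal ideal `𝔪 = (X₀,…,Xₙ)`, to which it is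
canonically isomorphic.
-/

open CategoryTheory TensorProduct

noncomputable section

/-- The homogeneous coordinate ring `S = K[X₀,…,Xₙ]` of `ℙⁿ`. -/
abbrev PolyS (K : Type) [Field K] (n : ℕ) : Type := MvPolynomial (Fin (n+1)) K

variable (K : Type) [Field K] (n : ℕ)

/-- The irrelevant maximal ideal `𝔪 = (X₀,…,Xₙ)` of `S`. -/
def irrel : Ideal (PolyS K n) := Ideal.span (Set.range MvPolynomial.X)

/-- `H^i_*` of the sheaf on `ℙⁿ` associated to the `S`-module `M`, encoded (for `i ≥ 1`)
as the local cohomology module `H^{i+1}_𝔪(M)`. -/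
def Hstar (i : ℕ) (M : Type) [AddCommGroup M] [Module (PolyS K n) M] :
    ModuleCat (PolyS K n) :=
  (localCohomology (irrel K n) (i+1)).obj (ModuleCat.of (PolyS K n) M)

/-- `M` is (the module of sections `Γ_*` of) an algebraic vector bundle on `ℙⁿ`:
finitely generated, depth `≥ 2` at `𝔪` (i.e. `H⁰_𝔪(M) = H¹_𝔪(M) = 0`, so `M = Γ_*(M̃)`),
and locally free at every prime other than the irrelevant ideal. -/
structure IsBundleModule (M : Type) [AddCommGroup M] [Module (PolyS K n) M] : Prop where
  finite : Module.Finite (PolyS K n) M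
  h0 : Subsingleton ((localCohomology (irrel K n) 0).obj (ModuleCat.of (PolyS K n) M))
  h1 : Subsingleton ((localCohomology (irrel K n) 1).obj (ModuleCat.of (PolyS K n) M))
  locFree : ∀ p : PrimeSpectrum (PolyS K n), p.asIdeal ≠ irrel K n →
    Module.Free (Localization.AtPrime p.asIdeal) (LocalizedModule p.asIdeal.primeCompl M)

/-- `M` represents a vector bundle of rank two on `ℙⁿ`. -/
structure IsRankTwoBundleModule (M : Type) [AddCommGroup M] [Module (PolyS K n) M]
    extends IsBundleModule K n M : Prop where
  rank2 : ∀ p : PrimeSpectrum (PolyS K n), p.asIdeal ≠ irrel K n →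
    Module.rank (Localization.AtPrime p.asIdeal) (LocalizedModule p.asIdeal.primeCompl M) = 2

/-- A finite length module which is moreover supported at the irrelevant ideal: the
(ungraded avatar of the) notion of a *graded* `S`-module of finite length. -/
def IsGradedFiniteLength (N : Type) [AddCommGroup N] [Module (PolyS K n) N] : Prop :=
  IsFiniteLength (PolyS K n) N ∧
    ∃ c : ℕ, (irrel K n) ^ c ≤ Module.annihilator (PolyS K n) N

section PartP1

/-! ## Vanishing of local cohomology, expressed by Yoneda Ext groups -/

section LV

/-- transition map `R/I^k → R/I^t`. -/
def qmap {R : Type} [CommRing R] (I : Ideal R) {t k : ℕ} (h : t ≤ k) :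
    ModuleCat.of R (R ⧸ I ^ k) ⟶ ModuleCat.of R (R ⧸ I ^ t) :=
  ModuleCat.ofHom (Submodule.mapQ _ _ LinearMap.id (Ideal.pow_le_pow_right h))

lemma qmap_comp {R : Type} [CommRing R] (I : Ideal R) {t k l : ℕ} (h : t ≤ k) (h' : k ≤ l) :
    qmap I h' ≫ qmap I h = qmap I (h.trans h') := by
  ext
  rfl

/-- `H^i_I(M) = 0`, elementwise: each class in `Ext^i(R/I^t, M)` dies in some
`Ext^i(R/I^k, M)`. -/
def LV {R : Type} [CommRing R] (I : Ideal R) (i : ℕ) (M : Type) [AddCommGroup M] [Module R M] :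
    Prop :=
  ∀ (t : ℕ) (e : Abelian.Ext (ModuleCat.of R (R ⧸ I ^ t)) (ModuleCat.of R M) i),
    ∃ (k : ℕ) (h : t ≤ k), (Abelian.Ext.mk₀ (qmap I h)).comp e (zero_add i) = 0

variable {R : Type} [CommRing R] {I : Ideal R}
  {M M' M'' : Type} [AddCommGroup M] [Module R M] [AddCommGroup M'] [Module R M']
  [AddCommGroup M''] [Module R M'']

/-- short complex of modules -/
abbrev scOf (f : M' →ₗ[R] M) (g : M →ₗ[R] M'') (h : Function.Exact f g) :
    ShortComplex (ModuleCat R) :=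
  ShortComplex.mk (ModuleCat.ofHom f) (ModuleCat.ofHom g) (by
    ext x; exact (h _).2 ⟨x, rfl⟩)

lemma scOf_shortExact (f : M' →ₗ[R] M) (g : M →ₗ[R] M'') (h : Function.Exact f g)
    (hf : Function.Injective f) (hg : Function.Surjective g) : (scOf f g h).ShortExact :=
  { exact := (ShortComplex.ShortExact.moduleCat_exact_iff_function_exact _).2 h
    mono_f := (ModuleCat.mono_iff_injective _).2 hf
    epi_g := (ModuleCat.epi_iff_surjective _).2 hg }

lemma LV.mid {i : ℕ} (f : M' →ₗ[R] M) (g : M →ₗ[R] M'') (h : Function.Exact f g)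
    (hf : Function.Injective f) (hg : Function.Surjective g)
    (h1 : LV I i M') (h2 : LV I i M'') : LV I i M := by
  have hS := scOf_shortExact f g h hf hg
  intro t e
  obtain ⟨k, hk, hk'⟩ := h2 t (e.comp (Abelian.Ext.mk₀ (ModuleCat.ofHom g)) (add_zero i))
  rw [← Abelian.Ext.comp_assoc _ _ _ (zero_add i) (add_zero i) (by omega)] at hk'
  obtain ⟨e', he'⟩ := Abelian.Ext.covariant_sequence_exact₂ _ hS _ hk'
  obtain ⟨l, hl, hl'⟩ := h1 k e'
  refine ⟨l, hk.trans hl, ?_⟩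
  rw [← qmap_comp I hk hl, ← Abelian.Ext.mk₀_comp_mk₀,
    Abelian.Ext.comp_assoc _ _ _ (zero_add 0) (zero_add i) (by omega)]
  rw [← he', ← Abelian.Ext.comp_assoc _ _ _ (zero_add i) (add_zero i) (by omega), hl',
    Abelian.Ext.zero_comp]

lemma LV.left {i : ℕ} (f : M' →ₗ[R] M) (g : M →ₗ[R] M'') (h : Function.Exact f g)
    (hf : Function.Injective f) (hg : Function.Surjective g)
    (h1 : LV I (i+1) M) (h2 : LV I i M'') : LV I (i+1) M' := by
  have hS := scOf_shortExact f g h hf hg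
  intro t e
  obtain ⟨k, hk, hk'⟩ := h1 t (e.comp (Abelian.Ext.mk₀ (ModuleCat.ofHom f)) (add_zero (i+1)))
  rw [← Abelian.Ext.comp_assoc _ _ _ (zero_add (i+1)) (add_zero (i+1)) (by omega)] at hk'
  obtain ⟨e', he'⟩ := Abelian.Ext.covariant_sequence_exact₁ _ hS _ hk' (n₀ := i) rfl
  obtain ⟨l, hl, hl'⟩ := h2 k e'
  refine ⟨l, hk.trans hl, ?_⟩
  rw [← qmap_comp I hk hl, ← Abelian.Ext.mk₀_comp_mk₀,
    Abelian.Ext.comp_assoc _ _ _ (zero_add 0) (zero_add (i+1)) (by omega)]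
  rw [← he', ← Abelian.Ext.comp_assoc _ _ _ (zero_add i) rfl (by omega), hl',
    Abelian.Ext.zero_comp]

lemma LV.right {i : ℕ} (f : M' →ₗ[R] M) (g : M →ₗ[R] M'') (h : Function.Exact f g)
    (hf : Function.Injective f) (hg : Function.Surjective g)
    (h1 : LV I i M) (h2 : LV I (i+1) M') : LV I i M'' := by
  have hS := scOf_shortExact f g h hf hg
  intro t e
  obtain ⟨k, hk, hk'⟩ := h2 t (e.comp hS.extClass rfl)
  rw [← Abelian.Ext.comp_assoc _ _ _ (zero_add i) rfl (by omega)] at hk'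
  obtain ⟨e', he'⟩ := Abelian.Ext.covariant_sequence_exact₃ _ hS _ rfl hk'
  obtain ⟨l, hl, hl'⟩ := h1 k e'
  refine ⟨l, hk.trans hl, ?_⟩
  rw [← qmap_comp I hk hl, ← Abelian.Ext.mk₀_comp_mk₀,
    Abelian.Ext.comp_assoc _ _ _ (zero_add 0) (zero_add i) (by omega)]
  rw [← he', ← Abelian.Ext.comp_assoc _ _ _ (zero_add i) (add_zero i) (by omega), hl',
    Abelian.Ext.zero_comp]

lemma LV.zero_of_injective (f : M' →ₗ[R] M) (hf : Function.Injective f)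
    (h1 : LV I 0 M) : LV I 0 M' := by
  intro t e
  obtain ⟨k, hk, hk'⟩ := h1 t (e.comp (Abelian.Ext.mk₀ (ModuleCat.ofHom f)) (add_zero 0))
  refine ⟨k, hk, ?_⟩
  rw [← Abelian.Ext.comp_assoc _ _ _ (zero_add 0) (add_zero 0) (by omega)] at hk'
  have : Mono (ModuleCat.ofHom f) := (ModuleCat.mono_iff_injective _).2 hf
  apply Abelian.Ext.postcomp_mk₀_injective_of_mono _ (ModuleCat.ofHom f)
  simp [hk']

lemma LV.of_equiv {i : ℕ} (f : M ≃ₗ[R] M') (h1 : LV I i M) : LV I i M' := by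
  intro t e
  obtain ⟨k, hk, hk'⟩ := h1 t (e.comp (Abelian.Ext.mk₀ (ModuleCat.ofHom f.symm.toLinearMap))
    (add_zero i))
  refine ⟨k, hk, ?_⟩
  rw [← Abelian.Ext.comp_assoc _ _ _ (zero_add i) (add_zero i) (by omega)] at hk'
  have := congrArg (fun z => z.comp (Abelian.Ext.mk₀ (ModuleCat.ofHom f.toLinearMap))
    (add_zero i)) hk'
  rw [Abelian.Ext.comp_assoc _ _ _ (add_zero i) (add_zero 0) (by omega),
    Abelian.Ext.mk₀_comp_mk₀] at this
  rw [show ModuleCat.ofHom f.symm.toLinearMap ≫ ModuleCat.ofHom f.toLinearMap = 𝟙 _ by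
    ext x; simp] at this
  simpa using this

lemma LV.of_subsingleton {i : ℕ} [Subsingleton M] : LV I i M := by
  intro t e
  refine ⟨t, le_rfl, ?_⟩
  have : e = e.comp (Abelian.Ext.mk₀ (𝟙 _)) (add_zero i) := by simp
  rw [this, show 𝟙 (ModuleCat.of R M) = 0 by ext x; exact Subsingleton.elim _ _]
  simp

/-- killed by powers of `I`, uniformly or not -/
def Tors (I : Ideal R) (M : Type) [AddCommGroup M] [Module R M] : Prop :=
  ∃ c : ℕ, ∀ r ∈ I ^ c, ∀ x : M, r • x = 0

lemma LV.eq_zero_of_zero (h : LV I 0 M) (x : M) (t : ℕ) (hx : ∀ r ∈ I ^ t, r • x = 0) :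
    x = 0 := by
  let φ : (R ⧸ I ^ t) →ₗ[R] M := Submodule.liftQ _ (LinearMap.toSpanSingleton R M x)
    (fun r hr => by simpa using hx r hr)
  obtain ⟨k, hk, hk'⟩ := h t (Abelian.Ext.mk₀ (ModuleCat.ofHom φ))
  rw [Abelian.Ext.mk₀_comp_mk₀, Abelian.Ext.mk₀_eq_zero_iff] at hk'
  have := congrArg (fun f => f.hom (Submodule.Quotient.mk 1)) hk'
  have h3 : φ (Submodule.Quotient.mk 1) = 0 := this
  have h4 : φ (Submodule.Quotient.mk 1) = (1 : R) • x := rfl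
  rw [← one_smul R x, ← h4, h3]

lemma Tors.subsingleton (h : LV I 0 M) (hM : Tors I M) : Subsingleton M := by
  obtain ⟨c, hc⟩ := hM
  exact subsingleton_of_forall_eq 0 (fun x => h.eq_zero_of_zero x c (fun r hr => hc r hr x))


/-- Artin-Rees: for `N` finite and `M` killed by a power of `I`, each class in `Ext^i(N,M)` dies
on `I^k N` for large `k`. -/
lemma ext_dies [IsNoetherianRing R] (hM : Tors I M) (i : ℕ) :
    ∀ (N : Type) [AddCommGroup N] [Module R N] [Module.Finite R N]
      (e : Abelian.Ext (ModuleCat.of R N) (ModuleCat.of R M) i),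
    ∃ k : ℕ, (Abelian.Ext.mk₀ (ModuleCat.ofHom (I ^ k • (⊤ : Submodule R N)).subtype)).comp e
      (zero_add i) = 0 := by
  induction i with
  | zero =>
    intro N _ _ _ e
    obtain ⟨c, hc⟩ := hM
    obtain ⟨f, rfl⟩ := Abelian.Ext.homEquiv₀.symm.surjective e
    refine ⟨c, ?_⟩
    change (Abelian.Ext.mk₀ _).comp (Abelian.Ext.mk₀ f) _ = 0
    rw [Abelian.Ext.mk₀_comp_mk₀, Abelian.Ext.mk₀_eq_zero_iff]
    ext ⟨x, hx⟩
    change f.hom x = 0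
    refine Submodule.smul_induction_on hx ?_ ?_
    · intro r hr y _
      rw [map_smul]; exact hc r hr _
    · intro x y hx hy
      rw [map_add, hx, hy, add_zero]
  | succ i ih =>
    intro N _ _ _ e
    obtain ⟨g, π, hπ⟩ := Module.Finite.exists_fin' R N
    have hex : Function.Exact (LinearMap.ker π).subtype π := fun x => by simp
    have hS := scOf_shortExact (LinearMap.ker π).subtype π hex (Submodule.subtype_injective _) hπ
    have hproj : Projective (ModuleCat.of R (Fin g → R)) := inferInstance
    obtain ⟨e', he'⟩ := Abelian.Ext.contravariant_sequence_exact₃ hS _ e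
      (Abelian.Ext.eq_zero_of_projective _) (n₀ := i) (by omega)
    obtain ⟨k', hk'⟩ := ih (LinearMap.ker π) e'
    obtain ⟨a, ha⟩ := Ideal.exists_pow_inf_eq_pow_smul I (LinearMap.ker π)
    -- the level `k = k' + a`
    let F' : Submodule R (Fin g → R) := I ^ (k' + a) • ⊤
    let N' : Submodule R N := I ^ (k' + a) • ⊤
    have hF'N' : ∀ x ∈ F', π x ∈ N' := by
      intro x hx
      have : Submodule.map π F' = N' := by
        simp only [F', N', Submodule.map_smul'', Submodule.map_top, LinearMap.range_eq_top.2 hπ]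
      rw [← this]; exact Submodule.mem_map_of_mem hx
    let π' : F' →ₗ[R] N' := π.restrict hF'N'
    have hπ' : Function.Surjective π' := by
      rintro ⟨y, hy⟩
      have : Submodule.map π F' = N' := by
        simp only [F', N', Submodule.map_smul'', Submodule.map_top, LinearMap.range_eq_top.2 hπ]
      rw [← this] at hy
      obtain ⟨x, hx, rfl⟩ := hy
      exact ⟨⟨x, hx⟩, rfl⟩
    have hex' : Function.Exact (LinearMap.ker π').subtype π' := fun x => by simp
    have hS' : (scOf (M' := LinearMap.ker π') (LinearMap.ker π').subtype π' hex').ShortExact :=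
      scOf_shortExact (M' := LinearMap.ker π') (LinearMap.ker π').subtype π' hex'
        (fun _ _ h => Subtype.ext h) hπ'
    have hker : ∀ x : LinearMap.ker π', (x.1.1) ∈ LinearMap.ker π := by
      rintro ⟨x, hx⟩
      have := congrArg Subtype.val (LinearMap.mem_ker.1 hx)
      exact this
    let κ : LinearMap.ker π' →ₗ[R] LinearMap.ker π :=
      LinearMap.codRestrict _ (F'.subtype ∘ₗ (LinearMap.ker π').subtype) hker
    have hκ : ∀ x, κ x ∈ I ^ k' • (⊤ : Submodule R (LinearMap.ker π)) := by
      intro x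
      have h1 : (x.1.1) ∈ I ^ (k' + a) • ⊤ ⊓ LinearMap.ker π := ⟨x.1.2, hker x⟩
      rw [ha (k' + a) (by omega), show k' + a - a = k' by omega] at h1
      have h2 : (x.1.1) ∈ I ^ k' • LinearMap.ker π :=
        (Submodule.smul_mono le_rfl inf_le_right) h1
      have h3 : I ^ k' • LinearMap.ker π
          = Submodule.map (LinearMap.ker π).subtype (I ^ k' • ⊤) := by
        rw [Submodule.map_smul'']; simp
      rw [h3] at h2
      obtain ⟨y, hy, hyx⟩ := h2
      have : κ x = y := Subtype.ext hyx.symm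
      rw [this]; exact hy
    let κ' : LinearMap.ker π' →ₗ[R] (I ^ k' • (⊤ : Submodule R (LinearMap.ker π)) : Submodule R _) :=
      LinearMap.codRestrict _ κ hκ
    let Φ : scOf (M' := LinearMap.ker π') (LinearMap.ker π').subtype π' hex' ⟶ scOf (LinearMap.ker π).subtype π hex :=
      { τ₁ := ModuleCat.ofHom κ
        τ₂ := ModuleCat.ofHom F'.subtype
        τ₃ := ModuleCat.ofHom N'.subtype
        comm₁₂ := by ext; rfl
        comm₂₃ := by ext; rfl }
    refine ⟨k' + a, ?_⟩
    have hnat := ShortComplex.ShortExact.extClass_naturality hS' hS Φ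
    rw [← he']
    change (Abelian.Ext.mk₀ Φ.τ₃).comp (hS.extClass.comp e' _) (zero_add _) = 0
    rw [← Abelian.Ext.comp_assoc _ _ _ (zero_add 1) (by omega) (by omega), ← hnat,
      Abelian.Ext.comp_assoc _ _ _ (add_zero 1) (zero_add i) (by omega)]
    let P : Submodule R (LinearMap.ker π) := I ^ k' • ⊤
    have : Φ.τ₁ = ModuleCat.ofHom κ' ≫ ModuleCat.ofHom (X := P) P.subtype := by
      ext; rfl
    rw [this, ← Abelian.Ext.mk₀_comp_mk₀,
      Abelian.Ext.comp_assoc _ _ _ (zero_add 0) (zero_add i) (by omega)]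
    have hk'' : (Abelian.Ext.mk₀ (ModuleCat.ofHom (X := P) P.subtype)).comp e' (zero_add i) = 0 := hk'
    rw [hk'']
    simp

/-- the inclusion-quotient sequence of an ideal -/
lemma ideal_exact (J : Ideal R) : Function.Exact J.subtype (Submodule.mkQ J) :=
  fun x => by simp [Ideal.Quotient.eq_zero_iff_mem]

lemma Tors.lv [IsNoetherianRing R] (hM : Tors I M) (i : ℕ) : LV I (i+1) M := by
  intro t e
  have hS : ∀ t, (scOf (I ^ t).subtype (Submodule.mkQ (I ^ t)) (ideal_exact _)).ShortExact :=
    fun t => scOf_shortExact _ _ _ (Submodule.subtype_injective _) (Submodule.mkQ_surjective _)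
  obtain ⟨e', he'⟩ := Abelian.Ext.contravariant_sequence_exact₃ (hS t) _ e
      (Abelian.Ext.eq_zero_of_projective _) (n₀ := i) (by omega)
  obtain ⟨k, hk⟩ := ext_dies hM i (I ^ t : Ideal R) e'
  have hle : I ^ (t + k) ≤ I ^ t := Ideal.pow_le_pow_right (by omega)
  have hmem : ∀ x : (I ^ (t + k) : Ideal R),
      Submodule.inclusion hle x ∈ (I ^ k • (⊤ : Submodule R (I ^ t : Ideal R))) := by
    rintro ⟨x, hx⟩
    have h3 : I ^ (t + k) = Submodule.map (I ^ t).subtype (I ^ k • ⊤) := by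
      rw [Submodule.map_smul'']
      simp [pow_add, mul_comm]
    have hx' := hx
    rw [h3] at hx'
    obtain ⟨y, hy, hyx⟩ := hx'
    have : Submodule.inclusion hle ⟨x, hx⟩ = y := Subtype.ext hyx.symm
    rw [this]; exact hy
  let κ' := LinearMap.codRestrict (I ^ k • (⊤ : Submodule R (I ^ t : Ideal R)))
    (Submodule.inclusion hle) hmem
  let Φ : scOf (I ^ (t + k)).subtype (Submodule.mkQ (I ^ (t + k))) (ideal_exact _) ⟶
      scOf (I ^ t).subtype (Submodule.mkQ (I ^ t)) (ideal_exact _) :=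
    { τ₁ := ModuleCat.ofHom (Submodule.inclusion hle)
      τ₂ := 𝟙 _
      τ₃ := qmap I (by omega)
      comm₁₂ := by ext; rfl
      comm₂₃ := by ext; rfl }
  refine ⟨t + k, by omega, ?_⟩
  have hnat := ShortComplex.ShortExact.extClass_naturality (hS _) (hS _) Φ
  rw [← he']
  change (Abelian.Ext.mk₀ Φ.τ₃).comp ((hS t).extClass.comp e' _) (zero_add _) = 0
  rw [← Abelian.Ext.comp_assoc _ _ _ (zero_add 1) (by omega) (by omega), ← hnat,
    Abelian.Ext.comp_assoc _ _ _ (add_zero 1) (zero_add i) (by omega)]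
  have : Φ.τ₁ = ModuleCat.ofHom κ' ≫
      ModuleCat.ofHom (I ^ k • (⊤ : Submodule R (I ^ t : Ideal R))).subtype := by
    ext; rfl
  rw [this, ← Abelian.Ext.mk₀_comp_mk₀,
    Abelian.Ext.comp_assoc _ _ _ (zero_add 0) (zero_add i) (by omega)]
  have hk'' : (Abelian.Ext.mk₀ (ModuleCat.ofHom
      (I ^ k • (⊤ : Submodule R (I ^ t : Ideal R))).subtype)).comp e' (zero_add i) = 0 := hk
  rw [hk'']
  simp

/-- a nonzerodivisor `x ∈ I` on `M` -/
lemma LV.of_regular {x : R} (hx : x ∈ I) (hreg : Function.Injective (fun y : M => x • y))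
    {i : ℕ} (f : M →ₗ[R] M'') (hf : Function.Surjective f)
    (hex : ∀ y, f y = 0 ↔ ∃ z, x • z = y) (h : LV I i M'') : LV I (i+1) M := by
  let μ : M →ₗ[R] M := LinearMap.lsmul R M x
  have hexact : Function.Exact μ f := fun y => by
    rw [hex]; rfl
  have hS := scOf_shortExact μ f hexact hreg hf
  have key : ∀ (j t : ℕ) (e : Abelian.Ext (ModuleCat.of R (R ⧸ I ^ t)) (ModuleCat.of R M) (i+1)),
      x ^ j • e = 0 → ∃ (k : ℕ) (h : t ≤ k),
        (Abelian.Ext.mk₀ (qmap I h)).comp e (zero_add (i+1)) = 0 := by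
    intro j
    induction j with
    | zero =>
      intro t e he
      refine ⟨t, le_rfl, ?_⟩
      rw [pow_zero, one_smul] at he
      rw [he]; simp
    | succ j ihj =>
      intro t e he
      have h1 : (x ^ j • e).comp (Abelian.Ext.mk₀ (ModuleCat.ofHom μ)) (add_zero (i+1)) = 0 := by
        have h2 : ModuleCat.ofHom μ = x • 𝟙 (ModuleCat.of R M) := by ext; rfl
        rw [h2, ← Abelian.Ext.smul_eq_comp_mk₀, smul_smul, ← pow_succ', he]
      obtain ⟨e'', he''⟩ := Abelian.Ext.covariant_sequence_exact₁ _ hS _ h1 (n₀ := i) rfl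
      obtain ⟨k, hk, hk'⟩ := h t e''
      have h3 : x ^ j • ((Abelian.Ext.mk₀ (qmap I hk)).comp e (zero_add (i+1))) = 0 := by
        rw [← Abelian.Ext.comp_smul, ← he'',
          ← Abelian.Ext.comp_assoc _ _ _ (zero_add i) rfl (by omega), hk',
          Abelian.Ext.zero_comp]
      obtain ⟨l, hl, hl'⟩ := ihj k _ h3
      refine ⟨l, hk.trans hl, ?_⟩
      rw [← qmap_comp I hk hl, ← Abelian.Ext.mk₀_comp_mk₀,
        Abelian.Ext.comp_assoc _ _ _ (zero_add 0) (zero_add (i+1)) (by omega), hl']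
  intro t e
  apply key t t e
  have h4 : (x ^ t • 𝟙 (ModuleCat.of R (R ⧸ I ^ t))) = 0 := by
    ext
    change x ^ t • (Submodule.Quotient.mk 1 : R ⧸ I ^ t) = 0
    rw [← Submodule.Quotient.mk_smul, Submodule.Quotient.mk_eq_zero]
    simpa using Ideal.pow_mem_pow hx t
  have h5 : e = (Abelian.Ext.mk₀ (𝟙 _)).comp e (zero_add (i+1)) := by simp
  rw [h5, ← Abelian.Ext.smul_comp, ← Abelian.Ext.mk₀_smul, h4]
  simp

lemma LV.zero_of_regular {x : R} (hx : x ∈ I)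
    (hreg : Function.Injective (fun y : M => x • y)) : LV I 0 M := by
  intro t e
  refine ⟨t, le_rfl, ?_⟩
  obtain ⟨f, rfl⟩ := Abelian.Ext.homEquiv₀.symm.surjective e
  have : f = 0 := by
    ext
    have h1 : x ^ t • (Submodule.Quotient.mk 1 : R ⧸ I ^ t) = 0 := by
      rw [← Submodule.Quotient.mk_smul, Submodule.Quotient.mk_eq_zero]
      simpa using Ideal.pow_mem_pow hx t
    have h2 : x ^ t • (f.hom (Submodule.Quotient.mk 1 : R ⧸ I ^ t)) = 0 := by
      rw [← map_smul, h1, map_zero]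
    have h3 : ∀ (j : ℕ) (y : M), x ^ j • y = 0 → y = 0 := by
      intro j
      induction j with
      | zero => intro y hy; simpa using hy
      | succ j ih =>
        intro y hy
        apply ih
        apply hreg
        simp only [smul_zero]
        rw [smul_smul, ← pow_succ', hy]
    exact h3 t _ h2
  rw [this]
  change (Abelian.Ext.mk₀ _).comp (Abelian.Ext.mk₀ _) _ = 0
  simp

end LV

end PartP1

section PartP1b

/-! ## From Mathlib's local cohomology to `LV` -/

section Link
open Limits

lemma exists_of_homology_comp_eq_zero {D : Type*} [Category D] [Abelian D]
    (C : ChainComplex D ℕ) (n : ℕ) {J : D} [Injective J] (z : C.X n ⟶ J)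
    (hz : C.d (n+1) n ≫ z = 0)
    (h : C.homologyι n ≫ C.descOpcycles z (n+1) (by simp) hz = 0) :
    ∃ g : C.X ((ComplexShape.down ℕ).next n) ⟶ J, C.d n _ ≫ g = z := by
  let S : ShortComplex D := ShortComplex.mk (C.homologyι n)
    (C.fromOpcycles n ((ComplexShape.down ℕ).next n)) (by simp)
  have hS : S.Exact := ShortComplex.exact_of_f_is_kernel S (C.homologyIsKernel n _ rfl)
  refine ⟨hS.descToInjective _ h, ?_⟩
  have h1 := hS.comp_descToInjective _ h
  have h2 : C.d n ((ComplexShape.down ℕ).next n) = C.pOpcycles n ≫ S.g := by simp [S]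
  rw [h2, Category.assoc, h1]
  simp

lemma lv_of_localCohomology {R : Type} [CommRing R] {I : Ideal R}
    {M : Type} [AddCommGroup M] [Module R M] (i : ℕ)
    (h : Subsingleton ((localCohomology I i).obj (ModuleCat.of R M))) : LV I i M := by
  intro t e
  let Y := ModuleCat.of R M
  let P : ∀ t : ℕ, ProjectiveResolution (ModuleCat.of R (R ⧸ I ^ t)) :=
    fun t => ProjectiveResolution.of _
  obtain ⟨f, hf, rfl⟩ := (P t).extMk_surjective e (i+1) rfl
  let F : ModuleCat R ⥤ (ModuleCat R)ᵒᵖ := ((linearYoneda R (ModuleCat R)).obj Y).rightOp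
  let Cx : ∀ t : ℕ, ChainComplex (ModuleCat R)ᵒᵖ ℕ :=
    fun t => (F.mapHomologicalComplex (ComplexShape.down ℕ)).obj (P t).complex
  let z : (Cx t).X i ⟶ Opposite.op (ModuleCat.of R R) :=
    Quiver.Hom.op (ModuleCat.ofHom (LinearMap.toSpanSingleton R ((P t).complex.X i ⟶ Y) f))
  have hz : (Cx t).d (i+1) i ≫ z = 0 := by
    apply Quiver.Hom.unop_inj
    apply ModuleCat.hom_ext
    apply LinearMap.ext
    intro r
    change (P t).complex.d (i+1) i ≫ (r • f) = 0
    rw [Linear.comp_smul, hf, smul_zero]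
  let w := (Cx t).descOpcycles z (i+1) (by simp) hz
  let u : (F.leftDerived i).obj (ModuleCat.of R (R ⧸ I ^ t)) ⟶ Opposite.op (ModuleCat.of R R) :=
    ((P t).isoLeftDerivedObj F i).hom ≫ (Cx t).homologyι i ≫ w
  let Dg := localCohomology.diagram (localCohomology.idealPowersDiagram I) i
  let G := Dg ⋙ (evaluation _ _).obj Y
  let x : G.obj (Opposite.op (Opposite.op t)) := u.unop.hom (1 : R)
  have hG : Subsingleton (colimit G : ModuleCat R) := by
    have hi := (colimitObjIsoColimitCompEvaluation Dg Y).toLinearEquiv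
    have h' : Subsingleton ((colimit Dg).obj Y) := h
    exact hi.symm.toEquiv.subsingleton
  have hx0 : (ConcreteCategory.hom (colimit.ι G (Opposite.op (Opposite.op t)))) x = 0 :=
    Subsingleton.elim _ _
  obtain ⟨s, a, ha⟩ := Concrete.colimit_rep_eq_zero R G _ _ hx0
  have hts : t ≤ s.unop.unop := a.unop.unop.down.down
  refine ⟨s.unop.unop, hts, ?_⟩
  have hmap : (F.leftDerived i).map (qmap I hts) ≫ u = 0 := by
    apply Quiver.Hom.unop_inj
    apply ModuleCat.hom_ext
    apply LinearMap.ext_ring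
    exact ha
  let Φ : ProjectiveResolution.Hom (P s.unop.unop) (P t) (qmap I hts) :=
    { hom := ProjectiveResolution.lift (qmap I hts) _ _
      hom_f_zero_comp_π_f_zero := ProjectiveResolution.lift_commutes_zero _ _ _ }
  rw [ProjectiveResolution.mk₀_comp_extMk _ _ _ _ Φ]
  have hnat := ProjectiveResolution.isoLeftDerivedObj_hom_naturality (qmap I hts)
    (P s.unop.unop) (P t) Φ.hom (ProjectiveResolution.lift_commutes_zero _ _ _) F i
  let Ψ : Cx s.unop.unop ⟶ Cx t := (F.mapHomologicalComplex (ComplexShape.down ℕ)).map Φ.hom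
  have hz' : (Cx s.unop.unop).d (i+1) i ≫ (Ψ.f i ≫ z) = 0 := by
    rw [← Category.assoc, ← Ψ.comm, Category.assoc, hz, comp_zero]
  have h1 : (Cx s.unop.unop).homologyι i ≫
      (Cx s.unop.unop).descOpcycles (Ψ.f i ≫ z) (i+1) (by simp) hz' = 0 := by
    have h2 : (Cx s.unop.unop).descOpcycles (Ψ.f i ≫ z) (i+1) (by simp) hz' =
        HomologicalComplex.opcyclesMap Ψ i ≫ w := by
      rw [← cancel_epi ((Cx s.unop.unop).pOpcycles i)]
      simp [w]
    rw [h2, ← Category.assoc, ← HomologicalComplex.homologyι_naturality, Category.assoc]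
    have h6 : ((P s.unop.unop).isoLeftDerivedObj F i).hom ≫
        (HomologicalComplex.homologyMap Ψ i ≫ (Cx t).homologyι i ≫ w) = 0 := by
      have h7 := hmap
      change _ ≫ _ ≫ _ = 0 at h7
      rw [← Category.assoc, hnat, Category.assoc] at h7
      exact h7
    exact (cancel_epi ((P s.unop.unop).isoLeftDerivedObj F i).hom).1 (h6.trans comp_zero.symm)
  obtain ⟨g, hg⟩ := exists_of_homology_comp_eq_zero _ i _ hz' h1
  obtain ⟨g', hg1⟩ : ∃ g' : (P s.unop.unop).complex.X ((ComplexShape.down ℕ).next i) ⟶ Y,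
      (P s.unop.unop).complex.d i _ ≫ g' = Φ.hom.f i ≫ f := by
    refine ⟨g.unop.hom (1 : R), ?_⟩
    have := congrArg (fun q => q.unop.hom (1 : R)) hg
    have h3 : (P s.unop.unop).complex.d i _ ≫
      (g.unop.hom (1 : R) : (P s.unop.unop).complex.X _ ⟶ Y) = Φ.hom.f i ≫ ((1 : R) • f) := this
    rw [h3, one_smul]
  rcases Nat.eq_zero_or_pos i with hi | hi
  · have : (P s.unop.unop).complex.d i ((ComplexShape.down ℕ).next i) = 0 := by
      apply HomologicalComplex.shape
      subst hi
      simp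
    rw [this, zero_comp] at hg1
    have h5 : ∀ (q : (P s.unop.unop).complex.X i ⟶ Y) (hq), 0 = q →
      (P s.unop.unop).extMk q (i+1) rfl hq = 0 := by
      rintro q hq rfl
      exact ProjectiveResolution.extMk_zero _ _ _
    exact h5 _ _ hg1
  · obtain ⟨p, rfl⟩ : ∃ p, i = p + 1 := ⟨i - 1, by omega⟩
    rw [ProjectiveResolution.extMk_eq_zero_iff _ _ _ _ _ p rfl]
    have hn : (ComplexShape.down ℕ).next (p+1) = p := by simp
    revert hg1
    revert g'
    rw [hn]
    intro g' hg'
    exact ⟨g', hg'⟩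

end Link

section Equivalence
variable {R : Type} [CommRing R] [IsNoetherianRing R] {I : Ideal R}
  {M N : Type} [AddCommGroup M] [Module R M] [AddCommGroup N] [Module R N]

lemma LV.of_map (f : M →ₗ[R] N) (h1 : Tors I (LinearMap.ker f))
    (h2 : Tors I (N ⧸ LinearMap.range f)) {i : ℕ} (h : LV I (i+1) M) : LV I (i+1) N := by
  have h3 : LV I (i+1) (LinearMap.range f) :=
    LV.right (LinearMap.ker f).subtype f.rangeRestrict (fun x => by simp [Subtype.ext_iff])
      (Submodule.subtype_injective _) f.surjective_rangeRestrict h (h1.lv _)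
  exact LV.mid (LinearMap.range f).subtype (LinearMap.range f).mkQ (fun x => by simp)
    (Submodule.subtype_injective _) (Submodule.mkQ_surjective _) h3 (h2.lv _)

lemma LV.of_map' (f : M →ₗ[R] N) (h1 : Tors I (LinearMap.ker f))
    (h2 : Tors I (N ⧸ LinearMap.range f)) {i : ℕ} (h : LV I (i+2) N) : LV I (i+2) M := by
  have h3 : LV I (i+2) (LinearMap.range f) :=
    LV.left (LinearMap.range f).subtype (LinearMap.range f).mkQ (fun x => by simp)
      (Submodule.subtype_injective _) (Submodule.mkQ_surjective _) h (h2.lv _)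
  exact LV.mid (LinearMap.ker f).subtype f.rangeRestrict (fun x => by simp [Subtype.ext_iff])
      (Submodule.subtype_injective _) f.surjective_rangeRestrict (h1.lv _) h3

end Equivalence

end PartP1b

section PartP2

/-! ## Finite free resolutions -/
section FFRsec

/-- `M` has a finite free resolution of length at most `k`. -/
def FFR (R : Type) [CommRing R] : ℕ → ∀ (M : Type) [AddCommGroup M] [Module R M], Prop
  | 0, M, _, _ => ∃ g : ℕ, Nonempty ((Fin g → R) ≃ₗ[R] M)
  | k+1, M, _, _ => ∃ (g : ℕ) (f : (Fin g → R) →ₗ[R] M), Function.Surjective f ∧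
      FFR R k (LinearMap.ker f)

lemma FFR.of_ringEquiv {A B : Type} [CommRing A] [CommRing B] (e : A ≃+* B) {k : ℕ} :
    ∀ {M M' : Type} [AddCommGroup M] [Module A M] [AddCommGroup M'] [Module B M']
      (φ : M ≃+ M') (_ : ∀ a m, φ (a • m) = e a • φ m), FFR A k M → FFR B k M' := by
  induction k with
  | zero =>
    intro M M' _ _ _ _ φ hφ ⟨g, ⟨u⟩⟩
    refine ⟨g, ⟨⟨⟨⟨fun v => φ (u (fun i => e.symm (v i))), ?_⟩, ?_⟩,
      fun m i => e (u.symm (φ.symm m) i), ?_, ?_⟩⟩⟩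
    · intro x y
      rw [← map_add, ← map_add]; congr 2; ext; simp
    · intro b x
      have : (fun i => e.symm ((b • x) i)) = e.symm b • fun i => e.symm (x i) := by ext; simp
      simp only [this, map_smul, hφ, RingEquiv.apply_symm_apply, RingHom.id_apply]
    · intro v; ext i; simp
    · intro m; simp
  | succ k ih =>
    intro M M' _ _ _ _ φ hφ ⟨g, f, hf, hk⟩
    let f' : (Fin g → B) →ₗ[B] M' :=
      { toFun := fun v => φ (f (fun i => e.symm (v i)))
        map_add' := fun x y => by
          rw [← map_add, ← map_add]; congr 2; ext; simp
        map_smul' := fun b x => by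
          have : (fun i => e.symm ((b • x) i)) = e.symm b • fun i => e.symm (x i) := by ext; simp
          simp only [this, map_smul, hφ, RingEquiv.apply_symm_apply, RingHom.id_apply] }
    refine ⟨g, f', ?_, ?_⟩
    · intro m
      obtain ⟨v, hv⟩ := hf (φ.symm m)
      exact ⟨fun i => e (v i), by simp [f', hv]⟩
    · refine ih (M := LinearMap.ker f) ?_ ?_ hk
      · exact
        { toFun := fun v => ⟨fun i => e (v.1 i), by
            have := v.2
            rw [LinearMap.mem_ker] at this
            simp [f', this]⟩
          invFun := fun v => ⟨fun i => e.symm (v.1 i), by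
            have h0 : φ (f (fun i => e.symm (v.1 i))) = 0 := v.2
            rw [LinearMap.mem_ker]
            exact (map_eq_zero_iff φ φ.injective).1 h0⟩
          left_inv := fun v => by ext; simp
          right_inv := fun v => by ext; simp
          map_add' := fun x y => by ext; simp }
      · intro a m
        ext i
        simp

variable {R : Type} [CommRing R] {A B C : Type} [AddCommGroup A] [Module R A]
  [AddCommGroup B] [Module R B] [AddCommGroup C] [Module R C]

lemma FFR.equiv {k : ℕ} (φ : A ≃ₗ[R] B) (h : FFR R k A) : FFR R k B :=
  FFR.of_ringEquiv (RingEquiv.refl R) φ.toAddEquiv (fun a m => φ.map_smul a m) h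

lemma FFR.zero_iff : FFR R 0 A ↔ Module.Finite R A ∧ Module.Free R A := by
  constructor
  · rintro ⟨g, ⟨u⟩⟩
    exact ⟨Module.Finite.equiv u, Module.Free.of_equiv u⟩
  · rintro ⟨h1, h2⟩
    let b := Module.Free.chooseBasis R A
    refine ⟨_, ⟨(b.reindex (Fintype.equivFin _)).equivFun.symm⟩⟩

lemma FFR.of_subsingleton [Subsingleton A] : FFR R 0 A :=
  FFR.zero_iff.2 ⟨inferInstance, inferInstance⟩

lemma FFR.finite {k : ℕ} (h : FFR R k A) : Module.Finite R A := by
  cases k with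
  | zero => exact (FFR.zero_iff.1 h).1
  | succ k =>
    obtain ⟨g, f, hf, -⟩ := h
    exact Module.Finite.of_surjective f hf

lemma FFR.mono {k : ℕ} : ∀ {A : Type} [AddCommGroup A] [Module R A], FFR R k A → FFR R (k+1) A := by
  induction k with
  | zero =>
    rintro A _ _ ⟨g, ⟨u⟩⟩
    refine ⟨g, u.toLinearMap, u.surjective, ?_⟩
    have : Subsingleton (LinearMap.ker u.toLinearMap) := by
      rw [LinearEquiv.ker]; infer_instance
    exact FFR.of_subsingleton
  | succ k ih =>
    rintro A _ _ ⟨g, f, hf, h⟩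
    exact ⟨g, f, hf, ih h⟩

/-- any finite free cover will do -/
lemma FFR.succ_of {k : ℕ} {F : Type} [AddCommGroup F] [Module R F] (hF : FFR R 0 F)
    (f : F →ₗ[R] A) (hf : Function.Surjective f) (h : FFR R k (LinearMap.ker f)) :
    FFR R (k+1) A := by
  obtain ⟨g, ⟨u⟩⟩ := hF
  refine ⟨g, f ∘ₗ u.toLinearMap, hf.comp u.surjective, ?_⟩
  rw [LinearMap.ker_comp]
  refine FFR.equiv ?_ h
  exact (LinearEquiv.submoduleMap u.symm (LinearMap.ker f)).trans
    (LinearEquiv.ofEq _ _ (by ext x; simp [Submodule.mem_map_equiv]))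

lemma FFR.prod_zero (h1 : FFR R 0 A) (h2 : FFR R 0 B) : FFR R 0 (A × B) := by
  rw [FFR.zero_iff] at *
  obtain ⟨_, _⟩ := h1
  obtain ⟨_, _⟩ := h2
  exact ⟨inferInstance, inferInstance⟩

lemma FFR.ext {k : ℕ} : ∀ {A B C : Type} [AddCommGroup A] [Module R A]
  [AddCommGroup B] [Module R B] [AddCommGroup C] [Module R C]
    (u : A →ₗ[R] B) (v : B →ₗ[R] C) (_ : Function.Injective u) (_ : Function.Exact u v)
    (_ : Function.Surjective v), FFR R k A → FFR R k C → FFR R k B := by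
  induction k with
  | zero =>
    intro A B C _ _ _ _ _ _ u v hu huv hv hA hC
    have := (FFR.zero_iff.1 hC).2
    obtain ⟨s, hs⟩ := Module.projective_lifting_property v LinearMap.id hv
    refine FFR.equiv ?_ (FFR.prod_zero hA hC)
    refine LinearEquiv.ofBijective (u.coprod s) ⟨?_, ?_⟩
    · rw [injective_iff_map_eq_zero]
      rintro ⟨a, c⟩ h
      have hc : c = 0 := by
        have := congrArg v h
        simpa [(huv _).2 ⟨a, rfl⟩, ← LinearMap.comp_apply, hs] using this
      subst hc
      have : a = 0 := hu (by simpa using h)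
      simp [this]
    · intro b
      obtain ⟨a, ha⟩ := (huv (b - s (v b))).1 (by
        simp [show ∀ c, v (s c) = c from fun c => LinearMap.congr_fun hs c])
      exact ⟨(a, v b), by simp [ha]⟩
  | succ k ih =>
    intro A B C _ _ _ _ _ _ u v hu huv hv ⟨gA, fA, hfA, hA⟩ ⟨gC, fC, hfC, hC⟩
    obtain ⟨s, hs⟩ := Module.projective_lifting_property v fC hv
    have hs' : ∀ x, v (s x) = fC x := fun x => LinearMap.congr_fun hs x
    have huv' : ∀ x, v (u x) = 0 := fun x => (huv _).2 ⟨x, rfl⟩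
    let φ : ((Fin gA → R) × (Fin gC → R)) →ₗ[R] B := (u ∘ₗ fA).coprod s
    have hφ : Function.Surjective φ := by
      intro b
      obtain ⟨c, hc⟩ := hfC (v b)
      obtain ⟨a, ha⟩ := (huv (b - s c)).1 (by simp [hs', hc])
      obtain ⟨a', rfl⟩ := hfA a
      exact ⟨(a', c), by simp [φ, ha]⟩
    refine FFR.succ_of (FFR.prod_zero (FFR.zero_iff.2 ⟨inferInstance, inferInstance⟩)
      (FFR.zero_iff.2 ⟨inferInstance, inferInstance⟩)) φ hφ ?_
    let u' : LinearMap.ker fA →ₗ[R] LinearMap.ker φ :=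
      LinearMap.restrict (LinearMap.inl R _ _) (fun x hx => by
        rw [LinearMap.mem_ker] at *; simp [φ, hx])
    let v' : LinearMap.ker φ →ₗ[R] LinearMap.ker fC :=
      LinearMap.restrict (LinearMap.snd R _ _) (fun x hx => by
        rw [LinearMap.mem_ker] at *
        have := congrArg v hx
        simpa [φ, hs', huv'] using this)
    refine ih u' v' ?_ ?_ ?_ hA hC
    · intro x y hxy
      have := congrArg (fun z => z.1.1) hxy
      exact Subtype.ext this
    · rintro ⟨⟨x, y⟩, hxy⟩
      constructor
      · intro h
        have hy : y = 0 := congrArg Subtype.val h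
        subst hy
        refine ⟨⟨x, ?_⟩, rfl⟩
        rw [LinearMap.mem_ker] at *
        exact hu (by simpa [φ] using hxy)
      · rintro ⟨a, ha⟩
        have := congrArg (fun z => z.1.2) ha
        exact Subtype.ext this.symm
    · rintro ⟨c, hc⟩
      rw [LinearMap.mem_ker] at hc
      obtain ⟨a, ha⟩ := (huv (- s c)).1 (by simp [hs', hc])
      obtain ⟨a', rfl⟩ := hfA a
      exact ⟨⟨(a', c), by simp [φ, ha]⟩, rfl⟩

lemma FFR.cone {k : ℕ} (u : A →ₗ[R] B) (v : B →ₗ[R] C) (hu : Function.Injective u)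
    (huv : Function.Exact u v)
    (hv : Function.Surjective v) (hA : FFR R k A) (hB : FFR R k B) : FFR R (k+1) C := by
  cases k with
  | zero =>
    refine FFR.succ_of hB v hv (FFR.equiv ?_ hA)
    exact (LinearEquiv.ofInjective u hu).trans (LinearEquiv.ofEq _ _ (by
      rw [LinearMap.exact_iff.1 huv]))
  | succ k =>
    obtain ⟨g, f, hf, hk⟩ := hB
    refine ⟨g, v ∘ₗ f, hv.comp hf, ?_⟩
    let e := LinearEquiv.ofInjective u hu
    let w : LinearMap.ker (v ∘ₗ f) →ₗ[R] LinearMap.range u :=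
      LinearMap.restrict f (fun x hx => (huv _).1 hx)
    refine FFR.ext (A := LinearMap.ker f) (C := LinearMap.range u)
      (Submodule.inclusion (fun x hx => by
        rw [LinearMap.mem_ker] at *; simp [hx])) w (Submodule.inclusion_injective _) ?_ ?_
        hk.mono (FFR.equiv e hA)
    · rintro ⟨x, hx⟩
      constructor
      · intro h
        exact ⟨⟨x, congrArg Subtype.val h⟩, rfl⟩
      · rintro ⟨⟨y, hy⟩, h⟩
        have : y = x := congrArg Subtype.val h
        subst this
        exact Subtype.ext hy
    · rintro ⟨_, ⟨a, rfl⟩⟩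
      obtain ⟨x, hx⟩ := hf (u a)
      exact ⟨⟨x, by simp [hx, (huv _).2 ⟨a, rfl⟩]⟩, Subtype.ext hx⟩

lemma FFR.stablyFree {k : ℕ} : ∀ {A : Type} [AddCommGroup A] [Module R A] [Module.Projective R A],
    FFR R k A → ∃ a b : ℕ, Nonempty ((A × (Fin a → R)) ≃ₗ[R] (Fin b → R)) := by
  induction k with
  | zero =>
    rintro A _ _ _ ⟨g, ⟨u⟩⟩
    let e0 : (A × (Fin 0 → R)) ≃ₗ[R] A := LinearEquiv.prodUnique
    exact ⟨0, g, ⟨e0.trans u.symm⟩⟩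
  | succ k ih =>
    rintro A _ _ _ ⟨g, f, hf, h⟩
    obtain ⟨s, hs⟩ := Module.projective_lifting_property f LinearMap.id hf
    have hs' : ∀ x, f (s x) = x := fun x => LinearMap.congr_fun hs x
    let e : (LinearMap.ker f × A) ≃ₗ[R] (Fin g → R) :=
      LinearEquiv.ofBijective ((LinearMap.ker f).subtype.coprod s) (by
        constructor
        · rw [injective_iff_map_eq_zero]
          rintro ⟨⟨a, ha⟩, c⟩ h
          have ha' : f a = 0 := ha
          have hc : c = 0 := by
            have := congrArg f h
            simpa [ha', hs'] using this
          subst hc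
          simpa using h
        · intro b
          exact ⟨(⟨b - s (f b), by simp [hs']⟩, f b), by simp⟩)
    have : Module.Projective R (LinearMap.ker f) :=
      Module.Projective.of_split (e.toLinearMap ∘ₗ LinearMap.inl R _ _)
        (LinearMap.fst R _ _ ∘ₗ e.symm.toLinearMap) (by ext; simp)
    obtain ⟨a, b, ⟨w⟩⟩ := ih h
    -- A × (R^b) = A × (ker × R^a) = R^g × R^a
    let e1 : (A × (Fin b → R)) ≃ₗ[R] (A × (LinearMap.ker f × (Fin a → R))) :=
      (LinearEquiv.refl R A).prodCongr w.symm
    let e2 : (A × (LinearMap.ker f × (Fin a → R))) ≃ₗ[R] ((A × LinearMap.ker f) × (Fin a → R)) :=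
      (LinearEquiv.prodAssoc R A _ _).symm
    let e3 : ((A × LinearMap.ker f) × (Fin a → R)) ≃ₗ[R] ((Fin g → R) × (Fin a → R)) :=
      ((LinearEquiv.prodComm R A _).trans e).prodCongr (LinearEquiv.refl R _)
    let e4 : ((Fin g → R) × (Fin a → R)) ≃ₗ[R] (Fin g ⊕ Fin a → R) :=
      (LinearEquiv.sumArrowLequivProdArrow _ _ R R).symm
    exact ⟨b, g + a, ⟨((e1.trans e2).trans (e3.trans e4)).trans
      (LinearEquiv.funCongrLeft R R finSumFinEquiv.symm)⟩⟩

end FFRsec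

end PartP2

section PartP2b

section Hilbert

lemma FFR.baseChange {R : Type} [CommRing R] (S : Type) [CommRing S] [Algebra R S]
    [Module.Flat R S] {k : ℕ} : ∀ {A : Type} [AddCommGroup A] [Module R A],
    FFR R k A → FFR S k (S ⊗[R] A) := by
  induction k with
  | zero =>
    rintro A _ _ h
    rw [FFR.zero_iff] at *
    obtain ⟨_, _⟩ := h
    exact ⟨inferInstance, inferInstance⟩
  | succ k ih =>
    rintro A _ _ ⟨g, f, hf, h⟩
    refine FFR.succ_of (F := S ⊗[R] (Fin g → R)) (FFR.zero_iff.2 ⟨inferInstance, inferInstance⟩)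
      (TensorProduct.AlgebraTensorModule.lTensor S S f) ?_ ?_
    · exact LinearMap.lTensor_surjective S hf
    · exact FFR.equiv (LinearMap.tensorKerEquiv S S f) (ih h)

/-- all submodules of finite free modules have finite free resolutions of length `≤ k`. -/
def SubFFR (A : Type) [CommRing A] (k : ℕ) : Prop :=
  ∀ (g : ℕ) (N : Type) [AddCommGroup N] [Module A N] (f : N →ₗ[A] (Fin g → A)),
    Function.Injective f → FFR A k N

lemma SubFFR.of_ringEquiv {A B : Type} [CommRing A] [CommRing B] (e : A ≃+* B) {k : ℕ}
    (h : SubFFR A k) : SubFFR B k := by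
  intro g N _ _ f hf
  let _ : Module A N := Module.compHom N e.toRingHom
  refine FFR.of_ringEquiv e (M := N) (AddEquiv.refl N) (fun a m => rfl) (h g N ?_ ?_)
  · exact
    { toFun := fun x i => e.symm (f x i)
      map_add' := fun x y => by ext; simp
      map_smul' := fun a x => by
        have : a • x = e a • x := rfl
        ext; simp [this] }
  · intro x y hxy
    apply hf
    ext i
    exact e.symm.injective (congrFun hxy i)

lemma SubFFR.of_pid {A : Type} [CommRing A] [IsDomain A] [IsPrincipalIdealRing A] :
    SubFFR A 0 := by
  intro g N _ _ f hf
  refine FFR.equiv (LinearEquiv.ofInjective f hf).symm ?_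
  exact FFR.zero_iff.2 ⟨inferInstance, inferInstance⟩

section step
open Polynomial
variable {A : Type} [CommRing A]

/-- coefficient map on `A[X] ⊗ N` -/
def tcoeff (N : Type) [AddCommGroup N] [Module A N] (i : ℕ) : A[X] ⊗[A] N →ₗ[A] N :=
  TensorProduct.lift ((LinearMap.lsmul A N).comp (Polynomial.lcoeff A i))

lemma tcoeff_tmul {N : Type} [AddCommGroup N] [Module A N] (i : ℕ) (p : A[X]) (x : N) :
    tcoeff N i (p ⊗ₜ x) = p.coeff i • x := by simp [tcoeff]

lemma tensor_rep {N : Type} [AddCommGroup N] [Module A N] (z : A[X] ⊗[A] N) :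
    ∃ (t : ℕ) (v : ℕ → N), z = ∑ i ∈ Finset.range t, (X ^ i : A[X]) ⊗ₜ[A] v i := by
  have hmono : ∀ (t t' : ℕ) (v : ℕ → N), ∃ v' : ℕ → N,
      ∑ i ∈ Finset.range t, (X ^ i : A[X]) ⊗ₜ[A] v i =
      ∑ i ∈ Finset.range (max t t'), (X ^ i : A[X]) ⊗ₜ[A] v' i := by
    intro t t' v
    refine ⟨fun i => if i < t then v i else 0, ?_⟩
    rw [← Finset.sum_subset (Finset.range_mono (le_max_left t t'))]
    · refine Finset.sum_congr rfl fun i hi => ?_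
      simp only [if_pos (Finset.mem_range.1 hi)]
    · intro i _ hi
      simp only [if_neg (show ¬ i < t by simpa using hi)]; simp
  induction z with
  | zero => exact ⟨0, fun _ => 0, by simp⟩
  | tmul p x =>
    refine ⟨p.natDegree + 1, fun i => p.coeff i • x, ?_⟩
    conv_lhs => rw [p.as_sum_range_C_mul_X_pow]
    rw [TensorProduct.sum_tmul]
    refine Finset.sum_congr rfl fun i _ => ?_
    rw [← smul_eq_C_mul, TensorProduct.smul_tmul]
  | add z w hz hw =>
    obtain ⟨t, v, rfl⟩ := hz
    obtain ⟨t', v', rfl⟩ := hw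
    obtain ⟨u, hu⟩ := hmono t t' v
    obtain ⟨u', hu'⟩ := hmono t' t v'
    refine ⟨max t t', fun i => u i + u' i, ?_⟩
    rw [hu, hu', max_comm t' t, ← Finset.sum_add_distrib]
    simp [TensorProduct.tmul_add]

variable {g : ℕ} (N : Submodule A[X] (Fin g → A[X]))

/-- the elements of degree `< j` -/
def degPart (j : ℕ) : Submodule A (Fin g → A[X]) :=
  N.restrictScalars A ⊓ Submodule.pi Set.univ (fun _ => degreeLT A j)

lemma mem_degPart {j : ℕ} {v : Fin g → A[X]} :
    v ∈ degPart N j ↔ v ∈ N ∧ ∀ l, ∀ i, j ≤ i → (v l).coeff i = 0 := by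
  simp only [degPart, Submodule.mem_inf, Submodule.restrictScalars_mem, Submodule.mem_pi,
    Set.mem_univ, true_imp_iff, mem_degreeLT]
  refine and_congr_right fun _ => forall_congr' fun l => ?_
  rw [Polynomial.degree_lt_iff_coeff_zero]

lemma degPart_ffr {k : ℕ} (h : SubFFR A k) (j : ℕ) : FFR A k (degPart N j) := by
  let φ : degPart N j →ₗ[A] (Fin g × Fin j → A) :=
    { toFun := fun v p => (v.1 p.1).coeff p.2
      map_add' := fun x y => by ext; simp
      map_smul' := fun x y => by ext; simp }
  refine h _ _ ((LinearEquiv.funCongrLeft A A finProdFinEquiv.symm).toLinearMap ∘ₗ φ) ?_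
  rw [LinearMap.coe_comp]
  refine Function.Injective.comp
    (LinearEquiv.funCongrLeft A A (finProdFinEquiv (m := g) (n := j)).symm).injective ?_
  intro v w hvw
  ext l i
  by_cases hi : i < j
  · exact congrFun hvw (l, ⟨i, hi⟩)
  · rw [((mem_degPart N).1 v.2).2 l i (by omega), ((mem_degPart N).1 w.2).2 l i (by omega)]

/-- multiplication by `X` -/
def degMulX (j : ℕ) : degPart N j →ₗ[A] degPart N (j+1) :=
  LinearMap.restrict (LinearMap.restrictScalars A (LinearMap.lsmul A[X] (Fin g → A[X]) X))
    (fun v hv => by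
      rw [mem_degPart] at *
      refine ⟨N.smul_mem _ hv.1, fun l i hi => ?_⟩
      cases i with
      | zero => simp
      | succ i =>
        have := hv.2 l i (by omega)
        simpa using this)

/-- inclusion -/
def degIncl (j : ℕ) : degPart N j →ₗ[A] degPart N (j+1) :=
  Submodule.inclusion (fun v hv => by
      rw [mem_degPart] at *
      exact ⟨hv.1, fun l i hi => hv.2 l i (by omega)⟩)

/-- evaluation -/
def degEval (j : ℕ) : A[X] ⊗[A] degPart N j →ₗ[A[X]] N :=
  TensorProduct.AlgebraTensorModule.lift
    ((LinearMap.toSpanSingleton A[X] _ ({ toFun := fun v => ⟨v.1, ((mem_degPart N).1 v.2).1⟩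
                                          map_add' := fun _ _ => rfl
                                          map_smul' := fun _ _ => rfl } : degPart N j →ₗ[A] N)))

lemma degEval_tmul (j : ℕ) (p : A[X]) (v : degPart N j) :
    (degEval N j (p ⊗ₜ v)).1 = p • v.1 := by
  simp [degEval]

/-- the syzygy map -/
def degSyz (j : ℕ) : A[X] ⊗[A] degPart N j →ₗ[A[X]] A[X] ⊗[A] degPart N (j+1) :=
  (X : A[X]) • TensorProduct.AlgebraTensorModule.lTensor A[X] A[X] (degIncl N j) -
    TensorProduct.AlgebraTensorModule.lTensor A[X] A[X] (degMulX N j)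

lemma degSyz_tmul (j : ℕ) (p : A[X]) (v : degPart N j) :
    degSyz N j (p ⊗ₜ v) = (X * p) ⊗ₜ degIncl N j v - p ⊗ₜ degMulX N j v := by
  simp [degSyz, TensorProduct.smul_tmul']

lemma degSyz_inj (j : ℕ) : Function.Injective (degSyz N j) := by
  rw [injective_iff_map_eq_zero]
  intro z hz
  obtain ⟨t, v, rfl⟩ := tensor_rep z
  induction t with
  | zero => simp
  | succ t ih =>
    have h1 : v t = 0 := by
      have := congrArg (tcoeff _ (t+1)) hz
      rw [map_sum, map_sum, map_zero, Finset.sum_range_succ, Finset.sum_eq_zero] at this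
      · rw [zero_add, degSyz_tmul, map_sub, tcoeff_tmul, tcoeff_tmul] at this
        simp [← pow_succ', coeff_X_pow] at this
        have h2 := congrArg Subtype.val this
        exact Subtype.ext h2
      · intro i hi
        have hi' := Finset.mem_range.1 hi
        rw [degSyz_tmul, map_sub, tcoeff_tmul, tcoeff_tmul]
        simp [← pow_succ', coeff_X_pow, show ¬ (t + 1 = i) by omega, show ¬ (t = i) by omega]
    rw [Finset.sum_range_succ, h1, TensorProduct.tmul_zero, add_zero] at hz ⊢
    exact ih hz

lemma degSyz_exact (j : ℕ) : Function.Exact (degSyz N j) (degEval N (j+1)) := by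
  intro z
  constructor
  · intro hz
    obtain ⟨t, v, rfl⟩ := tensor_rep z
    have hz' := congrArg Subtype.val hz
    clear hz
    induction t generalizing v with
    | zero => exact ⟨0, by simp⟩
    | succ t ih =>
      rw [Finset.sum_range_succ] at hz' ⊢
      cases t with
      | zero =>
        simp [degEval_tmul] at hz'
        exact ⟨0, by simp [hz']⟩
      | succ t =>
        have key : (v (t+1)).1 ∈ degPart N j := by
          rw [mem_degPart]
          refine ⟨((mem_degPart N).1 (v (t+1)).2).1, fun l i hi => ?_⟩
          rcases Nat.eq_or_lt_of_le hi with rfl | hi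
          · have := congrArg (fun w => (w l).coeff (t + 1 + j)) hz'
            simp only [map_add, map_sum, Submodule.coe_add, Submodule.coe_sum, degEval_tmul,
              Pi.add_apply, Finset.sum_apply, coeff_add, finsetSum_coeff, Pi.smul_apply,
              smul_eq_mul, Submodule.coe_zero, Pi.zero_apply, coeff_zero] at this
            rw [Finset.sum_eq_zero, zero_add, add_comm (t+1) j, coeff_X_pow_mul] at this
            · exact this
            · intro i hi
              have hi' := Finset.mem_range.1 hi
              rw [show t + 1 + j = (t + 1 + j - i) + i by omega, coeff_X_pow_mul]
              exact ((mem_degPart N).1 (v i).2).2 l _ (by omega)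
          · exact ((mem_degPart N).1 (v (t+1)).2).2 l _ hi
        let w : degPart N j := ⟨_, key⟩
        have hw : v (t+1) = degIncl N j w := rfl
        have e1 : (X ^ (t+1) : A[X]) ⊗ₜ[A] v (t+1) =
            degSyz N j ((X ^ t : A[X]) ⊗ₜ[A] w) + (X ^ t : A[X]) ⊗ₜ[A] degMulX N j w := by
          rw [degSyz_tmul, ← pow_succ', hw]; abel
        let v' : ℕ → degPart N (j+1) := fun i => if i = t then v t + degMulX N j w else v i
        have e2 : ∑ i ∈ Finset.range (t+1), (X ^ i : A[X]) ⊗ₜ[A] v' i =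
           ∑ i ∈ Finset.range (t+1), (X ^ i : A[X]) ⊗ₜ[A] v i + (X ^ t : A[X]) ⊗ₜ[A] degMulX N j w := by
          rw [Finset.sum_range_succ, Finset.sum_range_succ]
          simp only [v', if_true, TensorProduct.tmul_add, add_assoc]
          congr 1
          refine Finset.sum_congr rfl fun i hi => ?_
          rw [if_neg (by have := Finset.mem_range.1 hi; omega)]
        have e3 : degEval N (j+1) (degSyz N j ((X ^ t : A[X]) ⊗ₜ[A] w)) = 0 := by
          apply Subtype.ext
          rw [degSyz_tmul, map_sub, Submodule.coe_sub, degEval_tmul, degEval_tmul]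
          have : (degMulX N j w).1 = (X : A[X]) • w.1 := rfl
          rw [this, smul_smul, mul_comm]
          have : (degIncl N j w).1 = w.1 := rfl
          rw [this, sub_self]; rfl
        have e4 : ∑ i ∈ Finset.range (t+1), (X ^ i : A[X]) ⊗ₜ[A] v i + (X ^ (t+1) : A[X]) ⊗ₜ[A] v (t+1) =
            degSyz N j ((X ^ t : A[X]) ⊗ₜ[A] w) + ∑ i ∈ Finset.range (t+1), (X ^ i : A[X]) ⊗ₜ[A] v' i := by
          rw [e1, e2]; abel
        rw [e4] at hz' ⊢
        obtain ⟨y, hy⟩ := ih v' (by simpa [e3] using hz')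
        exact ⟨(X ^ t : A[X]) ⊗ₜ[A] w + y, by rw [map_add, hy]⟩
  · rintro ⟨y, rfl⟩
    induction y with
    | zero => simp
    | add x y hx hy => rw [map_add, map_add, hx, hy, add_zero]
    | tmul p w =>
      apply Subtype.ext
      rw [degSyz_tmul, map_sub, Submodule.coe_sub, degEval_tmul, degEval_tmul]
      have : (degMulX N j w).1 = (X : A[X]) • w.1 := rfl
      rw [this, smul_smul, mul_comm]
      have : (degIncl N j w).1 = w.1 := rfl
      rw [this, sub_self]; rfl

lemma degEval_surj (hN : N.FG) : ∃ j, Function.Surjective (degEval N (j+1)) := by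
  obtain ⟨s, hs⟩ := hN
  let j : ℕ := s.sup (fun v => Finset.univ.sup (fun l => (v l).natDegree))
  refine ⟨j, fun y => ?_⟩
  rw [← LinearMap.mem_range]
  have : N ≤ (LinearMap.range (degEval N (j+1))).map N.subtype := by
    conv_lhs => rw [← hs]
    rw [Submodule.span_le]
    intro v hv
    have hvN : v ∈ N := hs ▸ Submodule.subset_span hv
    have hv' : v ∈ degPart N (j+1) := by
      rw [mem_degPart]
      refine ⟨hvN, fun l i hi => coeff_eq_zero_of_natDegree_lt (lt_of_le_of_lt ?_ hi)⟩
      exact (Finset.le_sup (f := fun l => (v l).natDegree) (Finset.mem_univ l)).trans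
        (Finset.le_sup (f := fun v : Fin g → A[X] => Finset.univ.sup (fun l => (v l).natDegree)) hv)
    refine ⟨⟨v, hvN⟩, ⟨1 ⊗ₜ ⟨v, hv'⟩, ?_⟩, rfl⟩
    apply Subtype.ext
    rw [degEval_tmul, one_smul]
  obtain ⟨y', hy', hy''⟩ := this y.2
  have : y' = y := Subtype.ext hy''
  rwa [← this]

lemma SubFFR.polynomial [IsNoetherianRing A] {k : ℕ} (h : SubFFR A k) : SubFFR A[X] (k+1) := by
  intro g N _ _ f hf
  refine FFR.equiv (LinearEquiv.ofInjective f hf).symm ?_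
  obtain ⟨j, hj⟩ := degEval_surj (LinearMap.range f) (IsNoetherian.noetherian _)
  exact FFR.cone _ _ (degSyz_inj _ j) (degSyz_exact _ j) hj
    (FFR.baseChange A[X] (degPart_ffr _ h _)) (FFR.baseChange A[X] (degPart_ffr _ h _))

end step

lemma SubFFR.mv (K : Type) [Field K] (d : ℕ) : SubFFR (MvPolynomial (Fin (d+1)) K) d := by
  induction d with
  | zero =>
    have h : SubFFR (Polynomial K) 0 := SubFFR.of_pid
    refine SubFFR.of_ringEquiv ?_ h
    exact (MvPolynomial.uniqueAlgEquiv K (Fin 1)).symm.toRingEquiv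
  | succ d ih =>
    exact SubFFR.of_ringEquiv (MvPolynomial.finSuccEquiv K (d+1)).symm.toRingEquiv ih.polynomial

/-- Hilbert's syzygy theorem. -/
lemma ffr_poly (K : Type) [Field K] (n : ℕ) (M : Type) [AddCommGroup M] [Module (PolyS K n) M]
    [Module.Finite (PolyS K n) M] : FFR (PolyS K n) (n+1) M := by
  obtain ⟨g, f, hf⟩ := Module.Finite.exists_fin' (PolyS K n) M
  exact ⟨g, f, hf, SubFFR.mv K n g _ (LinearMap.ker f).subtype (Submodule.subtype_injective _)⟩

end Hilbert

end PartP2b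

section PartP3

section QS
open Matrix

/-- equivalence of vectors under the general linear group -/
def VEq {A : Type} [CommRing A] {ι : Type} [Fintype ι] [DecidableEq ι] (f g : ι → A) : Prop :=
  ∃ M : GL ι A, M.1 *ᵥ f = g

section basic
variable {A : Type} [CommRing A] {ι : Type} [Fintype ι] [DecidableEq ι] {f g h : ι → A}

lemma VEq.trans (h1 : VEq f g) (h2 : VEq g h) : VEq f h := by
  obtain ⟨M, rfl⟩ := h1
  obtain ⟨N, rfl⟩ := h2
  exact ⟨N * M, by simp [Matrix.mulVec_mulVec]⟩

lemma VEq.symm (h1 : VEq f g) : VEq g f := by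
  obtain ⟨M, rfl⟩ := h1
  refine ⟨M⁻¹, ?_⟩
  rw [Matrix.mulVec_mulVec, ← Units.val_mul, inv_mul_cancel, Units.val_one, Matrix.one_mulVec]

lemma VEq.refl : VEq f f := ⟨1, by simp⟩

lemma VEq.of_linearEquiv (φ : (ι → A) ≃ₗ[A] (ι → A)) : VEq f (φ f) := by
  refine ⟨⟨LinearMap.toMatrix' φ.toLinearMap, LinearMap.toMatrix' φ.symm.toLinearMap, ?_, ?_⟩, ?_⟩
  · rw [← LinearMap.toMatrix'_comp]; simp
  · rw [← LinearMap.toMatrix'_comp]; simp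
  · simp [LinearMap.toMatrix'_mulVec]

lemma VEq.linearEquiv (h : VEq f g) : ∃ φ : (ι → A) ≃ₗ[A] (ι → A), φ f = g := by
  obtain ⟨M, rfl⟩ := h
  refine ⟨LinearEquiv.ofLinearMap (Matrix.mulVecLin M.1) (Matrix.mulVecLin (M⁻¹).1) ?_ ?_, ?_⟩
  · rw [← Matrix.mulVecLin_mul, ← Units.val_mul]; simp
  · rw [← Matrix.mulVecLin_mul, ← Units.val_mul]; simp
  · simp

lemma VEq.map {B : Type} [CommRing B] (θ : A →+* B) (h : VEq f g) : VEq (θ ∘ f) (θ ∘ g) := by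
  obtain ⟨M, rfl⟩ := h
  refine ⟨Matrix.GeneralLinearGroup.map θ M, ?_⟩
  ext i
  exact (RingHom.map_mulVec θ M.1 f i).symm

lemma VEq.transvec (φ : Module.Dual A (ι → A)) (v : ι → A) (h : φ v = 0) : VEq f (f + φ f • v) :=
  VEq.of_linearEquiv (LinearEquiv.transvection h)

lemma VEq.of_eq_one {i : ι} (h : f i = 1) : VEq f (Pi.single i 1) := by
  have := VEq.transvec (f := f) (LinearMap.proj i) (-(f - Pi.single i 1)) (by simp [h])
  simpa [h] using this

lemma VEq.of_pair {i j : ι} (hij : i ≠ j) (p q : A) (h : q * f i + p * f j = 1) :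
    VEq f (Pi.single i 1) := by
  let L (a b c d : A) : (ι → A) →ₗ[A] (ι → A) := LinearMap.id +
    (LinearMap.single A (fun _ => A) i) ∘ₗ (a • LinearMap.proj i + b • LinearMap.proj j) +
    (LinearMap.single A (fun _ => A) j) ∘ₗ (c • LinearMap.proj i + d • LinearMap.proj j)
  have hL : ∀ a b c d v l, L a b c d v l = v l + (if l = i then a * v i + b * v j else 0) +
      (if l = j then c * v i + d * v j else 0) := by
    intro a b c d v l
    simp [L, Pi.single_apply]
  let φ : (ι → A) ≃ₗ[A] (ι → A) := LinearEquiv.ofLinearMap (L (q-1) p (- f j) (f i - 1))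
    (L (f i - 1) (-p) (f j) (q - 1)) (by
      refine LinearMap.ext fun v => funext fun l => ?_
      simp only [LinearMap.comp_apply, hL, LinearMap.id_apply, if_true, if_neg hij, if_neg hij.symm]
      split_ifs with h1 h2 h2
      · exact absurd (h1.symm.trans h2) hij
      · subst h1; linear_combination (v l) * h
      · subst h2; linear_combination (v l) * h
      · simp) (by
      refine LinearMap.ext fun v => funext fun l => ?_
      simp only [LinearMap.comp_apply, hL, LinearMap.id_apply, if_true, if_neg hij, if_neg hij.symm]
      split_ifs with h1 h2 h2
      · exact absurd (h1.symm.trans h2) hij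
      · subst h1; linear_combination (v l) * h
      · subst h2; linear_combination (v l) * h
      · simp)
  refine (VEq.of_linearEquiv φ).trans (VEq.of_eq_one ?_)
  show L (q-1) p (- f j) (f i - 1) f i = 1
  rw [hL]
  simp only [if_true, if_neg hij]
  linear_combination h

end basic

/-- semilocal rings have stable range one -/
lemma exists_isUnit_add {C : Type} [CommRing C] [Finite (MaximalSpectrum C)] {ι : Type} [Fintype ι]
    (a : C) (b : ι → C) (h : ∀ M : MaximalSpectrum C, a ∈ M.asIdeal → ∃ j, b j ∉ M.asIdeal) :
    ∃ t : ι → C, IsUnit (a + ∑ j, t j * b j) := by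
  classical
  have hcop : Pairwise (Function.onFun IsCoprime (fun M : MaximalSpectrum C => M.asIdeal)) := by
    intro M N hMN
    exact Ideal.isCoprime_of_isMaximal (fun h => hMN (MaximalSpectrum.ext h))
  rcases isEmpty_or_nonempty ι with hι | hι
  · refine ⟨fun _ => 0, ?_⟩
    by_contra hu
    obtain ⟨M, hM, hmem⟩ := exists_max_ideal_of_mem_nonunits hu
    obtain ⟨j, -⟩ := h ⟨M, hM⟩ (by simpa using hmem)
    exact hι.false j
  choose! jj hjj using h
  have := fun j : ι => Ideal.exists_forall_sub_mem_ideal hcop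
    (fun M => if a ∈ M.asIdeal ∧ jj M = j then (1 : C) else 0)
  choose t ht using this
  refine ⟨t, ?_⟩
  by_contra hu
  obtain ⟨M, hM, hmem⟩ := exists_max_ideal_of_mem_nonunits hu
  let M' : MaximalSpectrum C := ⟨M, hM⟩
  have e : ∀ j, t j * b j - (if a ∈ M ∧ jj M' = j then (1 : C) else 0) * b j ∈ M := fun j => by
    rw [← sub_mul]; exact M.mul_mem_right _ (ht j M')
  have e2 : ∑ j, t j * b j - ∑ j, (if a ∈ M ∧ jj M' = j then (1 : C) else 0) * b j ∈ M := by
    rw [← Finset.sum_sub_distrib]; exact M.sum_mem fun j _ => e j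
  have e3 : a + ∑ j, (if a ∈ M ∧ jj M' = j then (1 : C) else 0) * b j ∈ M := by
    have := M.sub_mem hmem e2
    convert this using 1
    ring
  by_cases ha : a ∈ M
  · have e4 := M.sub_mem e3 ha
    simp [ha] at e4
    exact hjj M' ha e4
  · simp [ha] at e3

section horrocks
open Polynomial

lemma finite_maxSpec {o B : Type} [CommRing o] [IsLocalRing o] [CommRing B] [Algebra o B]
    [Module.Finite o B] : Finite (MaximalSpectrum B) := by
  have := Algebra.QuasiFinite.finite_primesOver (S := B) (IsLocalRing.maximalIdeal o)
  have := this.to_subtype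
  refine Finite.of_injective (β := (IsLocalRing.maximalIdeal o).primesOver B)
    (fun M => ⟨M.asIdeal, M.isMaximal.isPrime, ⟨?_⟩⟩) ?_
  · have := M.isMaximal
    have h := Ideal.isMaximal_comap_of_isIntegral_of_isMaximal (R := o) M.asIdeal
    exact (IsLocalRing.eq_maximalIdeal h).symm
  · intro M N h
    exact MaximalSpectrum.ext (congrArg Subtype.val h)

lemma horrocks {o : Type} [CommRing o] [IsLocalRing o] {ι : Type} [Fintype ι] [DecidableEq ι]
    (f u : ι → o[X]) (hu : ∑ i, u i * f i = 1) (i : ι) (hi : (f i).Monic) :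
    ∃ j, VEq f (Pi.single j 1) := by
  by_cases hι : ∃ j, j ≠ i
  · obtain ⟨j0, hj0⟩ := hι
    have := hi.finite_adjoinRoot
    have : Finite (MaximalSpectrum (AdjoinRoot (f i))) := finite_maxSpec (o := o)
    have hmk : AdjoinRoot.mk (f i) (f i) = 0 := AdjoinRoot.mk_self
    obtain ⟨t, ht⟩ := exists_isUnit_add (AdjoinRoot.mk (f i) (f j0))
      (fun j : ι => if j = j0 then 0 else AdjoinRoot.mk (f i) (f j)) (by
        intro M hM
        by_contra! hcon
        have hall : ∀ j, AdjoinRoot.mk (f i) (f j) ∈ M.asIdeal := fun j => by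
          by_cases hj : j = j0
          · rw [hj]; exact hM
          · have := hcon j; rwa [if_neg hj] at this
        have h1 := congrArg (AdjoinRoot.mk (f i)) hu
        rw [map_sum, map_one] at h1
        apply M.isMaximal.ne_top
        rw [Ideal.eq_top_iff_one, ← h1]
        exact Ideal.sum_mem _ fun j _ => by
          rw [map_mul]; exact Ideal.mul_mem_left _ _ (hall j))
    choose s hs using fun j => AdjoinRoot.mk_surjective (t j)
    let c : ι → o[X] := fun j => if j = j0 then 0 else s j
    let φ : Module.Dual o[X] (ι → o[X]) := ∑ j, c j • LinearMap.proj j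
    have hφ : ∀ v, φ v = ∑ j, c j * v j := fun v => by simp [φ, LinearMap.sum_apply]
    have step := VEq.transvec (f := f) φ (Pi.single j0 1) (by
      rw [hφ, Finset.sum_eq_single j0] <;> simp +contextual [c])
    set f' := f + φ f • Pi.single j0 1 with hf'
    have e1 : f' i = f i := by simp [hf', hj0.symm]
    have e2 : f' j0 = f j0 + ∑ j, c j * f j := by simp [hf', hφ]
    have e3 : IsUnit (AdjoinRoot.mk (f i) (f' j0)) := by
      convert ht using 1
      rw [e2, map_add, map_sum]
      congr 1
      refine Finset.sum_congr rfl fun j _ => ?_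
      rw [map_mul]
      by_cases hj : j = j0 <;> simp [c, hj, hs]
    obtain ⟨w, hw⟩ := e3.exists_left_inv
    obtain ⟨p, rfl⟩ := AdjoinRoot.mk_surjective w
    rw [← map_mul, ← map_one (AdjoinRoot.mk (f i)), AdjoinRoot.mk_eq_mk] at hw
    obtain ⟨q, hq⟩ := hw
    exact ⟨i, step.trans (VEq.of_pair hj0.symm p (-q) (by rw [e1]; linear_combination hq))⟩
  · push Not at hι
    refine ⟨i, VEq.of_eq_one ?_⟩
    apply hi.eq_one_of_isUnit
    rw [Finset.sum_eq_single i (fun j _ hj => absurd (hι j) hj) (by simp)] at hu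
    exact IsUnit.of_mul_eq_one_right _ hu

end horrocks
end QS

end PartP3

section PartP3b

section QSpatch
open Matrix Polynomial

section homs
variable (R : Type) [CommRing R]

/-- `X ↦ X + c Y` -/
def thS (c : R) : R[X] →+* R[X][X] :=
  eval₂RingHom ((C : R[X] →+* R[X][X]).comp C) (C X + C (C c) * X)

/-- `Y ↦ a Y` -/
def psS (a : R) : R[X][X] →+* R[X][X] := eval₂RingHom C (C (C a) * X)

lemma psS_thS (a c : R) : (psS R a).comp (thS R c) = thS R (a * c) := by
  refine Polynomial.ringHom_ext (fun r => by simp [psS, thS]) ?_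
  simp [psS, thS]; ring

lemma psS_C (a : R) : (psS R a).comp C = C := by
  ext <;> simp [psS]

/-- `X ↦ X + c Y`, `Y ↦ Y` -/
def chS (c : R) : R[X][X] →+* R[X][X] := eval₂RingHom (thS R c) X

lemma chS_thS (a c : R) : (chS R a).comp (thS R c) = thS R (a + c) := by
  refine Polynomial.ringHom_ext (fun r => by simp [chS, thS]) ?_
  simp [chS, thS]; ring

lemma chS_C (c : R) : (chS R c).comp C = thS R c := by
  ext <;> simp [chS]

/-- `X ↦ 0`, `Y ↦ X` -/
def evS : R[X][X] →+* R[X] := eval₂RingHom ((C : R →+* R[X]).comp (evalRingHom 0)) X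

lemma evS_thS : (evS R).comp (thS R 1) = RingHom.id _ := by
  ext <;> simp [evS, thS]

lemma evS_C : (evS R).comp C = (C : R →+* R[X]).comp (evalRingHom 0) := by
  ext <;> simp [evS]

lemma thS_zero : thS R 0 = C := by
  ext <;> simp [thS]

end homs

section maps
variable {R L : Type} [CommRing R] [CommRing L] (j : R →+* L)

/-- base change of bivariate polynomials -/
def mapS : R[X][X] →+* L[X][X] := mapRingHom (mapRingHom j)

lemma mapS_thS (c : R) : (mapS j).comp (thS R c) = (thS L (j c)).comp (mapRingHom j) := by
  ext <;> simp [mapS, thS]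

lemma mapS_psS (c : R) : (mapS j).comp (psS R c) = (psS L (j c)).comp (mapS j) := by
  ext <;> simp [mapS, psS]

lemma mapS_C : (mapS j).comp (C : R[X] →+* R[X][X]) = C.comp (mapRingHom j) := by
  ext <;> simp [mapS]

lemma mapS_inj (hj : Function.Injective j) : Function.Injective (mapS j) :=
  map_injective _ (map_injective _ hj)

end maps

lemma clear_denoms {R : Type} [CommRing R] (p : Ideal R) [p.IsPrime]
    (Q : (Localization.AtPrime p)[X][X]) :
    ∃ c : R, c ∉ p ∧ C (C (algebraMap R (Localization.AtPrime p) c)) * Q ∈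
      (mapS (algebraMap R (Localization.AtPrime p))).range := by
  induction Q using Polynomial.induction_on' with
  | add P Q hP hQ =>
    obtain ⟨c, hc, P', hP'⟩ := hP
    obtain ⟨d, hd, Q', hQ'⟩ := hQ
    refine ⟨c * d, fun h => (Ideal.IsPrime.mem_or_mem ‹_› h).elim hc hd,
      C (C d) * P' + C (C c) * Q', ?_⟩
    rw [map_add, map_mul, map_mul, hP', hQ']
    simp [mapS]
    ring
  | monomial i a =>
    suffices h : ∃ c : R, c ∉ p ∧ C (algebraMap R (Localization.AtPrime p) c) * a ∈
        (mapRingHom (algebraMap R (Localization.AtPrime p))).range by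
      obtain ⟨c, hc, a', ha'⟩ := h
      refine ⟨c, hc, monomial i a', ?_⟩
      rw [C_mul_monomial, ← ha']
      simp [mapS]
    induction a using Polynomial.induction_on' with
    | add P Q hP hQ =>
      obtain ⟨c, hc, P', hP'⟩ := hP
      obtain ⟨d, hd, Q', hQ'⟩ := hQ
      refine ⟨c * d, fun h => (Ideal.IsPrime.mem_or_mem ‹_› h).elim hc hd,
        C d * P' + C c * Q', ?_⟩
      rw [map_add, map_mul, map_mul, hP', hQ']
      simp
      ring
    | monomial i a =>
      obtain ⟨⟨r, s⟩, hs⟩ := IsLocalization.surj p.primeCompl a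
      refine ⟨s, s.2, monomial i r, ?_⟩
      rw [C_mul_monomial, mul_comm, hs]
      simp

lemma clear_denoms' {R : Type} [CommRing R] (p : Ideal R) [p.IsPrime]
    (P : (Localization.AtPrime p)[X][X]) 
    (hP : P.coeff 0 ∈ (mapRingHom (algebraMap R (Localization.AtPrime p))).range) :
    ∃ c : R, c ∉ p ∧ ∀ a : R, psS _ (algebraMap R (Localization.AtPrime p) (a * c)) P ∈
      (mapS (algebraMap R (Localization.AtPrime p))).range := by
  obtain ⟨c, hc, Q', hQ'⟩ := clear_denoms p P.divX
  obtain ⟨P0, hP0⟩ := hP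
  refine ⟨c, hc, fun a => ⟨C P0 + psS R (a * c) Q' * C (C a) * X, ?_⟩⟩
  have h1 := RingHom.congr_fun (mapS_psS (algebraMap R (Localization.AtPrime p)) (a * c)) Q'
  simp only [RingHom.comp_apply] at h1
  rw [map_add, map_mul, map_mul, h1, hQ']
  conv_rhs => rw [← P.divX_mul_X_add]
  simp only [map_add, map_mul, ← hP0]
  simp [psS, mapS]
  ring

variable {ι : Type} [Fintype ι] [DecidableEq ι]

lemma patch_local_aux {R L : Type} [CommRing R] [CommRing L] (p : Ideal R) [p.IsPrime]
    (j : R →+* L) (hj : Function.Injective j)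
    (hcd : ∀ P : L[X][X], P.coeff 0 ∈ (mapRingHom j).range →
      ∃ c : R, c ∉ p ∧ ∀ a : R, psS _ (j (a * c)) P ∈ (mapS j).range) (f : ι → R[X])
    (v : ι → ℤ)
    (h : VEq (mapRingHom j ∘ f) (fun i => (v i : L[X]))) :
    ∃ c : R, c ∉ p ∧ VEq (thS R c ∘ f) (C ∘ f) := by
  obtain ⟨M, hM⟩ := h
  let G : GL ι L[X][X] := (Matrix.GeneralLinearGroup.map C M)⁻¹ *
    Matrix.GeneralLinearGroup.map (thS L 1) M
  have hM' : ∀ θ : L[X] →+* L[X][X], (Matrix.GeneralLinearGroup.map θ M).1 *ᵥ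
      (θ ∘ (mapRingHom j ∘ f)) = fun i => (v i : L[X][X]) := by
    intro θ
    ext1 i
    have := congrArg θ (congrFun hM i)
    rw [RingHom.map_mulVec] at this
    rw [map_intCast] at this
    exact this
  have hG : G.1 *ᵥ (thS L 1 ∘ (mapRingHom j ∘ f)) = C ∘ (mapRingHom j ∘ f) := by
    rw [Units.val_mul, ← Matrix.mulVec_mulVec, hM' (thS L 1), ← hM' C, Matrix.mulVec_mulVec,
      ← Units.val_mul, inv_mul_cancel, Units.val_one, Matrix.one_mulVec]
  have hG0 : Matrix.GeneralLinearGroup.map (constantCoeff : L[X][X] →+* L[X]) G = 1 := by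
    have e1 : (constantCoeff : L[X][X] →+* L[X]).comp C = RingHom.id _ := by ext <;> simp
    have e2 : (constantCoeff : L[X][X] →+* L[X]).comp (thS L 1) = RingHom.id _ := by
      ext <;> simp [thS]
    have e3 : Matrix.GeneralLinearGroup.map (constantCoeff : L[X][X] →+* L[X])
        (Matrix.GeneralLinearGroup.map C M) = M := by
      ext a b : 2
      exact RingHom.congr_fun e1 (M.1 a b)
    have e4 : Matrix.GeneralLinearGroup.map (constantCoeff : L[X][X] →+* L[X])
        (Matrix.GeneralLinearGroup.map (thS L 1) M) = M := by
      ext a b : 2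
      exact RingHom.congr_fun e2 (M.1 a b)
    rw [map_mul, map_inv, e3, e4, inv_mul_cancel]
  have hone : ∀ a b, (1 : Matrix ι ι L[X]) a b ∈ (mapRingHom j).range := by
    intro a b
    rw [Matrix.one_apply]
    split_ifs
    · exact one_mem _
    · exact zero_mem _
  have hG0a : ∀ a b, (G.1 a b).coeff 0 ∈ (mapRingHom j).range := by
    intro a b
    have : (G.1 a b).coeff 0 = (1 : Matrix ι ι L[X]) a b := by
      rw [← Units.val_one, ← hG0]; rfl
    rw [this]; exact hone a b
  have hG0b : ∀ a b, ((G⁻¹).1 a b).coeff 0 ∈ (mapRingHom j).range := by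
    intro a b
    have : ((G⁻¹).1 a b).coeff 0 = (1 : Matrix ι ι L[X]) a b := by
      rw [← Units.val_one, ← inv_one, ← hG0, ← map_inv]; rfl
    rw [this]; exact hone a b
  choose c1 hc1 hc1' using fun ab : ι × ι => hcd _ (hG0a ab.1 ab.2)
  choose c2 hc2 hc2' using fun ab : ι × ι => hcd _ (hG0b ab.1 ab.2)
  let c : R := (∏ ab, c1 ab) * ∏ ab, c2 ab
  have hc : c ∉ p := by
    intro h
    rcases Ideal.IsPrime.mem_or_mem ‹_› h with h | h
    · obtain ⟨ab, -, h'⟩ := (Ideal.IsPrime.prod_mem_iff (p := p)).1 h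
      exact hc1 ab h'
    · obtain ⟨ab, -, h'⟩ := (Ideal.IsPrime.prod_mem_iff (p := p)).1 h
      exact hc2 ab h'
  have hd1 : ∀ a b, psS L (j c) (G.1 a b) ∈ (mapS j).range := by
    intro a b
    obtain ⟨w, hw⟩ : c1 (a, b) ∣ c :=
      (Finset.dvd_prod_of_mem c1 (Finset.mem_univ (a, b))).mul_right _
    rw [hw, mul_comm]; exact hc1' (a, b) w
  have hd2 : ∀ a b, psS L (j c) ((G⁻¹).1 a b) ∈ (mapS j).range := by
    intro a b
    obtain ⟨w, hw⟩ : c2 (a, b) ∣ c :=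
      (Finset.dvd_prod_of_mem c2 (Finset.mem_univ (a, b))).mul_left _
    rw [hw, mul_comm]; exact hc2' (a, b) w
  choose G1 hG1 using hd1
  choose G2 hG2 using hd2
  have hinj := mapS_inj j hj
  have hinjM : Function.Injective (RingHom.mapMatrix (m := ι) (mapS j)) :=
    Matrix.map_injective hinj
  have m1 : (mapS j).mapMatrix (Matrix.of G1) = (psS L (j c)).mapMatrix G.1 := by
    refine Matrix.ext fun a b => hG1 a b
  have m2 : (mapS j).mapMatrix (Matrix.of G2) = (psS L (j c)).mapMatrix (G⁻¹).1 := by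
    refine Matrix.ext fun a b => hG2 a b
  let H : GL ι R[X][X] := ⟨Matrix.of G1, Matrix.of G2, by
    apply hinjM
    rw [map_mul, m1, m2, ← map_mul, ← Units.val_mul]; simp, by
    apply hinjM
    rw [map_mul, m1, m2, ← map_mul, ← Units.val_mul]; simp⟩
  refine ⟨c, hc, H, ?_⟩
  ext1 i
  apply hinj
  rw [RingHom.map_mulVec]
  have e1 : (mapS j) ∘ (thS R c ∘ f) = psS L (j c) ∘ (thS L 1 ∘ (mapRingHom j ∘ f)) := by
    ext1 i
    have h1 := RingHom.congr_fun (mapS_thS j c) (f i)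
    have h2 := RingHom.congr_fun (psS_thS L (j c) 1) (mapRingHom j (f i))
    simp only [RingHom.comp_apply, mul_one] at h1 h2
    simp only [Function.comp_apply]
    rw [h1, h2]
  have e2 : (mapS j).mapMatrix H.1 = (psS L (j c)).mapMatrix G.1 := m1
  have e3 : (H.1).map (mapS j) = (G.1).map (psS L (j c)) := e2
  rw [e1, e3, ← RingHom.map_mulVec, hG]
  have h1 := RingHom.congr_fun (psS_C L (j c)) (mapRingHom j (f i))
  have h2 := RingHom.congr_fun (mapS_C j) (f i)
  simp only [RingHom.comp_apply] at h1 h2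
  simp only [Function.comp_apply]
  rw [h1, h2]

lemma patch_local {R : Type} [CommRing R] [IsDomain R] (p : Ideal R) [p.IsPrime] (f : ι → R[X])
    (v : ι → ℤ)
    (h : VEq (mapRingHom (algebraMap R (Localization.AtPrime p)) ∘ f) (fun i => (v i : _))) :
    ∃ c : R, c ∉ p ∧ VEq (thS R c ∘ f) (C ∘ f) :=
  patch_local_aux p (algebraMap R (Localization.AtPrime p))
    (IsLocalization.injective _ p.primeCompl_le_nonZeroDivisors) (clear_denoms' p) f v h

lemma patch {R : Type} [CommRing R] [IsDomain R] (f u : ι → R[X]) (hu : ∑ i, u i * f i = 1)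
    (i : ι) (hi : (f i).Monic) : VEq f (C ∘ evalRingHom 0 ∘ f) := by
  let J : Ideal R :=
    { carrier := {c | VEq (thS R c ∘ f) (C ∘ f)}
      zero_mem' := by
        show VEq (thS R 0 ∘ f) (C ∘ f)
        rw [thS_zero]; exact VEq.refl
      add_mem' := by
        intro a b ha hb
        have := VEq.map (chS R a) hb
        rw [← Function.comp_assoc, ← Function.comp_assoc, ← RingHom.coe_comp, ← RingHom.coe_comp,
          chS_thS, chS_C] at this
        exact this.trans ha
      smul_mem' := by
        intro a b hb
        have := VEq.map (psS R a) hb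
        rw [← Function.comp_assoc, ← Function.comp_assoc, ← RingHom.coe_comp, ← RingHom.coe_comp,
          psS_thS, psS_C] at this
        exact this }
  have hJ : J = ⊤ := by
    by_contra hJ
    obtain ⟨p, hp, hJp⟩ := Ideal.exists_le_maximal J hJ
    have hpp := hp.isPrime
    obtain ⟨k, hk⟩ := horrocks (mapRingHom (algebraMap R (Localization.AtPrime p)) ∘ f)
      (mapRingHom (algebraMap R (Localization.AtPrime p)) ∘ u) (by
        have := congrArg (mapRingHom (algebraMap R (Localization.AtPrime p))) hu
        rw [map_sum, map_one] at this
        rw [← this]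
        exact Finset.sum_congr rfl fun i _ => (map_mul _ _ _).symm) i (hi.map _)
    obtain ⟨c, hc, hc'⟩ := patch_local p f (Pi.single k 1) (by
      convert hk using 1
      ext1 l
      by_cases hl : l = k
      · subst hl; simp
      · simp [hl])
    exact hc (hJp hc')
  have h1 : VEq (thS R 1 ∘ f) (C ∘ f) := by
    have : (1 : R) ∈ J := by rw [hJ]; trivial
    exact this
  have := VEq.map (evS R) h1
  rw [← Function.comp_assoc, ← Function.comp_assoc, ← RingHom.coe_comp, ← RingHom.coe_comp,
          evS_thS, evS_C] at this
  exact this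

end QSpatch

end PartP3b

section PartP3c

namespace QS
section nagata
open Polynomial MvPolynomial Ideal Nat RingHom List

variable {k : Type} [Field k] {n : ℕ} (f : MvPolynomial (Fin (n + 1)) k)
variable (v w : Fin (n + 1) →₀ ℕ)

variable {f v} in
lemma lt_up (vlt : ∀ i, v i < 2 + f.totalDegree) : ∀ l ∈ ofFn v, l < 2 + f.totalDegree := by
  grind


/-- We construct an algebra map `T1 f c` which maps `X_i` into `X_i + c • X_0 ^ r_i` when `i ≠ 0`
and `X_0` to `X_0`. -/
abbrev T1 (c : k) :
    MvPolynomial (Fin (n + 1)) k →ₐ[k] MvPolynomial (Fin (n + 1)) k :=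
  aeval fun i ↦ if i = 0 then X 0 else X i + c • X 0 ^ ((2 + f.totalDegree) ^ i.1)

lemma t1_comp_t1_neg (c : k) : (T1 f c).comp (T1 f (-c)) = AlgHom.id _ _ := by
  rw [comp_aeval, ← MvPolynomial.aeval_X_left]
  ext i v
  cases i using Fin.cases <;> simp

/-- `T1 f 1` leads to an algebra equiv `T f`. -/
abbrev T := AlgEquiv.ofAlgHom (T1 f 1) (T1 f (-1))
  (t1_comp_t1_neg f 1) (by simpa using t1_comp_t1_neg f (-1))

lemma sum_r_mul_ne (vlt : ∀ i, v i < 2 + f.totalDegree) (wlt : ∀ i, w i < 2 + f.totalDegree) (ne : v ≠ w) :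
    ∑ x : Fin (n + 1), (2 + f.totalDegree) ^ x.1 * v x ≠ ∑ x : Fin (n + 1), (2 + f.totalDegree) ^ x.1 * w x := by
  intro h
  refine ne <| Finsupp.ext <| congrFun <| ofFn_inj.mp ?_
  apply ofDigits_inj_of_len_eq (Nat.lt_add_right f.totalDegree one_lt_two)
    (by simp) (lt_up vlt) (lt_up wlt)
  simpa only [ofDigits_eq_sum_mapIdx, mapIdx_eq_ofFn, get_ofFn, length_ofFn,
    Fin.val_cast, mul_comm, sum_ofFn] using! h

lemma degreeOf_zero_t {a : k} (ha : a ≠ 0) : ((T f) (monomial v a)).degreeOf 0 =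
    ∑ i : Fin (n + 1), ((2 + f.totalDegree) ^ i.1) * v i := by
  rw [← natDegree_finSuccEquiv, monomial_eq, Finsupp.prod_pow v fun a ↦ X a]
  simp only [Fin.prod_univ_succ, Fin.sum_univ_succ, map_mul, map_prod, map_pow,
    AlgEquiv.ofAlgHom_apply, MvPolynomial.aeval_C, MvPolynomial.aeval_X, if_pos, Fin.succ_ne_zero,
    ite_false, one_smul, map_add, finSuccEquiv_X_zero, finSuccEquiv_X_succ, algebraMap_eq]
  have h (i : Fin n) :
      (Polynomial.C (X (R := k) i) + Polynomial.X ^ ((2 + f.totalDegree) ^ i.succ.1)) ^ v i.succ ≠ 0 :=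
    pow_ne_zero (v i.succ) (leadingCoeff_ne_zero.mp <| by simp [add_comm, leadingCoeff_X_pow_add_C])
  rw [natDegree_mul (by simp [ha]) (mul_ne_zero (by simp) (Finset.prod_ne_zero_iff.mpr
    (fun i _ ↦ h i))), natDegree_mul (by simp) (Finset.prod_ne_zero_iff.mpr (fun i _ ↦ h i)),
    natDegree_prod _ _ (fun i _ ↦ h i), natDegree_finSuccEquiv, degreeOf_C]
  simpa only [natDegree_pow, zero_add, natDegree_X, mul_one, Fin.val_zero, pow_zero, one_mul,
    add_right_inj] using Finset.sum_congr rfl (fun i _ ↦ by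
    rw [add_comm (Polynomial.C _), natDegree_X_pow_add_C, mul_comm])

/-- `T` maps different monomials of `f` to polynomials with different degrees in `X_0`. -/
lemma degreeOf_t_ne_of_ne (hv : v ∈ f.support) (hw : w ∈ f.support) (ne : v ≠ w) :
    (T f <| monomial v <| coeff v f).degreeOf 0 ≠
    (T f <| monomial w <| coeff w f).degreeOf 0 := by
  rw [degreeOf_zero_t _ _ <| mem_support_iff.mp hv, degreeOf_zero_t _ _ <| mem_support_iff.mp hw]
  refine sum_r_mul_ne f v w (fun i ↦ ?_) (fun i ↦ ?_) ne <;>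
  exact lt_of_le_of_lt ((monomial_le_degreeOf i ‹_›).trans (degreeOf_le_totalDegree f i))
    (by lia)

lemma leadingCoeff_finSuccEquiv_t :
    (finSuccEquiv k n ((T f) ((monomial v) (coeff v f)))).leadingCoeff =
    algebraMap k _ (coeff v f) := by
  rw [monomial_eq, Finsupp.prod_fintype]
  · simp only [map_mul, map_prod, leadingCoeff_mul, leadingCoeff_prod]
    rw [AlgEquiv.ofAlgHom_apply, algHom_C, algebraMap_eq, finSuccEquiv_apply,
      eval₂Hom_C, coe_comp]
    simp only [AlgEquiv.ofAlgHom_apply, Function.comp_apply, leadingCoeff_C, map_pow,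
      leadingCoeff_pow, algebraMap_eq]
    have : ∀ j, ((finSuccEquiv k n) ((T1 f) 1 (X j))).leadingCoeff = 1 := fun j ↦ by
      by_cases h : j = 0
      · simp [h, finSuccEquiv_apply]
      · simp only [aeval_eq_bind₁, bind₁_X_right, if_neg h, one_smul, map_add, map_pow]
        obtain ⟨i, rfl⟩ := Fin.exists_succ_eq.mpr h
        simp [finSuccEquiv_X_succ, finSuccEquiv_X_zero, add_comm]
    simp only [this, one_pow, Finset.prod_const_one, mul_one]
  exact fun i ↦ pow_zero _

/-- `T` maps `f` into some polynomial in `X_0` such that the leading coefficient is invertible. -/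
lemma T_leadingcoeff_isUnit (fne : f ≠ 0) :
    IsUnit (finSuccEquiv k n (T f f)).leadingCoeff := by
  obtain ⟨v, vin, vs⟩ := Finset.exists_max_image f.support
    (fun v ↦ (T f ((monomial v) (coeff v f))).degreeOf 0) (support_nonempty.mpr fne)
  set h := fun w ↦ (MvPolynomial.monomial w) (coeff w f)
  simp only [← natDegree_finSuccEquiv] at vs
  replace vs : ∀ x ∈ f.support \ {v}, (finSuccEquiv k n ((T f) (h x))).degree <
      (finSuccEquiv k n ((T f) (h v))).degree := by
    intro x hx
    obtain ⟨h1, h2⟩ := Finset.mem_sdiff.mp hx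
    apply degree_lt_degree <| lt_of_le_of_ne (vs x h1) ?_
    simpa only [natDegree_finSuccEquiv]
      using degreeOf_t_ne_of_ne f _ _ h1 vin <| ne_of_not_mem_cons h2
  have coeff : (finSuccEquiv k n ((T f) (h v + ∑ x ∈ f.support \ {v}, h x))).leadingCoeff =
      (finSuccEquiv k n ((T f) (h v))).leadingCoeff := by
    simp only [map_add, map_sum]
    rw [add_comm]
    apply leadingCoeff_add_of_degree_lt <| (lt_of_le_of_lt <| degree_sum_le _ _) ?_
    have h2 : h v ≠ 0 := by simpa [h] using mem_support_iff.mp vin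
    replace h2 : (finSuccEquiv k n ((T f) (h v))) ≠ 0 := fun eq ↦ h2 <|
      by simpa only [map_eq_zero_iff _ (AlgEquiv.injective _)] using eq
    exact (Finset.sup_lt_iff <| Ne.bot_lt (fun x ↦ h2 <| degree_eq_bot.mp x)).mpr vs
  nth_rw 2 [← f.support_sum_monomial_coeff]
  rw [Finset.sum_eq_add_sum_sdiff_singleton_of_mem vin h]
  rw [leadingCoeff_finSuccEquiv_t] at coeff
  simpa only [coeff, algebraMap_eq] using (mem_support_iff.mp vin).isUnit.map MvPolynomial.C

end nagata

section uc

/-- every unimodular vector is equivalent to a basis vector -/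
def UC (A : Type) [CommRing A] : Prop := ∀ (m : ℕ) (f u : Fin m → A), ∑ i, u i * f i = 1 →
  ∃ j, VEq f (Pi.single j 1)

lemma uc_field (A : Type) [CommRing A] [Nontrivial A] (h : ∀ a : A, a ≠ 0 → IsUnit a) : UC A := by
  intro m f u hu
  by_cases h0 : ∀ i, f i = 0
  · simp [h0] at hu
  · push Not at h0
    obtain ⟨i, hi⟩ := h0
    refine ⟨i, ?_⟩
    obtain ⟨w, hw⟩ := h _ hi
    refine (VEq.of_linearEquiv (LinearEquiv.smulOfUnit w⁻¹)).trans (VEq.of_eq_one ?_)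
    show (w⁻¹ • f) i = 1
    rw [Pi.smul_apply, ← hw, Units.smul_def, smul_eq_mul, Units.inv_mul]

lemma UC.of_equiv {A B : Type} [CommRing A] [CommRing B] (e : A ≃+* B) (h : UC B) : UC A := by
  intro m f u hu
  obtain ⟨j, hj⟩ := h m (e ∘ f) (e ∘ u) (by
    have := congrArg e hu
    rw [map_sum, map_one] at this
    rw [← this]
    exact Finset.sum_congr rfl fun i _ => (map_mul _ _ _).symm)
  refine ⟨j, ?_⟩
  have := VEq.map e.symm.toRingHom hj
  convert this using 1
  · ext i; simp
  · ext i
    by_cases hi : i = j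
    · subst hi; simp
    · simp [hi]

lemma uc_poly (K : Type) [Field K] (d : ℕ) : UC (MvPolynomial (Fin d) K) := by
  induction d with
  | zero => 
    refine UC.of_equiv (MvPolynomial.isEmptyAlgEquiv K (Fin 0)).toRingEquiv (uc_field K ?_)
    intro a ha
    exact ha.isUnit
  | succ d ih =>
    intro m f u hu
    have : ∃ i, f i ≠ 0 := by
      by_contra! h0
      simp [h0] at hu
    obtain ⟨i, hi⟩ := this
    suffices h : ∃ j, VEq (fun l => MvPolynomial.finSuccEquiv K d (T (f i) (f l))) (Pi.single j 1) by
      obtain ⟨j, hj⟩ := h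
      refine ⟨j, ?_⟩
      have := VEq.map (((T (f i)).trans (MvPolynomial.finSuccEquiv K d)).symm.toRingEquiv.toRingHom) hj
      convert this using 1
      · ext1 l
        exact (((T (f i)).trans (MvPolynomial.finSuccEquiv K d)).symm_apply_apply (f l)).symm
      · ext1 l
        by_cases hl : l = j
        · subst hl; simp
        · simp [hl]
    set e := ((T (f i)).trans (MvPolynomial.finSuccEquiv K d)).toRingEquiv with he
    have hu' : ∑ l, e (u l) * e (f l) = 1 := by
      have := congrArg e hu
      rw [map_sum, map_one] at this
      rw [← this]
      exact Finset.sum_congr rfl fun i _ => (map_mul _ _ _).symm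
    have hlc : IsUnit (e (f i)).leadingCoeff := T_leadingcoeff_isUnit (f i) hi
    show ∃ j, VEq (e ∘ f) (Pi.single j 1)
    obtain ⟨w, hw⟩ := hlc
    let w' : (Polynomial (MvPolynomial (Fin d) K))ˣ := Units.map Polynomial.C.toMonoidHom w
    have h1 : VEq (e ∘ f) (w'⁻¹ • (e ∘ f)) := VEq.of_linearEquiv (LinearEquiv.smulOfUnit w'⁻¹)
    have hs : ∑ l, (w'.1 * e (u l)) * (w'⁻¹ • (e ∘ f)) l = 1 := by
      rw [← hu']
      refine Finset.sum_congr rfl fun l _ => ?_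
      rw [Pi.smul_apply, Units.smul_def, smul_eq_mul, Function.comp_apply]
      rw [show ∀ a b c d : Polynomial (MvPolynomial (Fin d) K),
        a * b * (c * d) = a * c * (b * d) by intros; ring, Units.mul_inv, one_mul]
    have hm : ((w'⁻¹ • (e ∘ f)) i).Monic := by
      rw [Pi.smul_apply, Units.smul_def, smul_eq_mul, Function.comp_apply]
      show (Polynomial.C ((w⁻¹).1) * e (f i)).Monic
      rw [Polynomial.Monic, Polynomial.leadingCoeff_mul, Polynomial.leadingCoeff_C, ← hw,
        Units.inv_mul]
    have h2 := patch _ _ hs i hm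
    set g := w'⁻¹ • (e ∘ f)
    obtain ⟨j, hj⟩ := ih m (Polynomial.evalRingHom 0 ∘ g)
      (fun l => Polynomial.evalRingHom 0 (w'.1 * e (u l))) (by
        have := congrArg (Polynomial.evalRingHom 0) hs
        rw [map_sum, map_one] at this
        rw [← this]
        exact Finset.sum_congr rfl fun i _ => (map_mul _ _ _).symm)
    refine ⟨j, h1.trans (h2.trans ?_)⟩
    have := VEq.map Polynomial.C hj
    convert this using 1
    ext1 l
    by_cases hl : l = j
    · subst hl; simp
    · simp [hl]

lemma UC.cancel {A : Type} [CommRing A] (h : UC A) {P : Type} [AddCommGroup P] [Module A P] (a : ℕ) :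
    ∀ b, Nonempty ((P × (Fin a → A)) ≃ₗ[A] (Fin b → A)) → Module.Free A P := by
  induction a with
  | zero =>
    rintro b ⟨e⟩
    exact Module.Free.of_equiv ((LinearEquiv.prodUnique (R := A) (M := P) (M₂ := Fin 0 → A)).symm.trans e).symm
  | succ a ih =>
    rintro b ⟨e⟩
    -- the unimodular vector
    let x : P × (Fin (a+1) → A) := (0, Pi.single 0 1)
    let φ : P × (Fin (a+1) → A) →ₗ[A] A := LinearMap.proj 0 ∘ₗ LinearMap.snd A _ _
    have hφx : φ x = 1 := by simp [φ, x]
    obtain ⟨j, hj⟩ := h b (e x) (fun i => φ (e.symm (Pi.single i 1))) (by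
      have h1 : φ (e.symm (e x)) = 1 := by simpa using hφx
      refine Eq.trans ?_ h1
      generalize e x = y
      conv_rhs => rw [pi_eq_sum_univ' y]
      rw [map_sum, map_sum]
      refine Finset.sum_congr rfl fun i _ => ?_
      rw [map_smul, map_smul, smul_eq_mul, mul_comm])
    obtain ⟨ψ, hψ⟩ := hj.linearEquiv
    obtain ⟨b, rfl⟩ : ∃ b', b = b' + 1 := ⟨b - 1, by have := j.2; omega⟩
    let E := e.trans ψ
    have hE : E x = Pi.single j 1 := hψ
    let ι : P × (Fin a → A) →ₗ[A] P × (Fin (a+1) → A) :=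
      LinearMap.prodMap LinearMap.id (LinearMap.pi (Fin.cons 0 fun i => LinearMap.proj i))
    have hι : ∀ p v, ι (p, v) = (p, Fin.cons 0 v) := by
      intro p v
      refine Prod.ext rfl ?_
      ext l
      refine Fin.cases ?_ (fun l => ?_) l <;> simp [ι]
    let f : P × (Fin a → A) →ₗ[A] (Fin b → A) :=
      LinearMap.funLeft A A j.succAbove ∘ₗ E.toLinearMap ∘ₗ ι
    apply ih b
    refine ⟨LinearEquiv.ofBijective f ⟨?_, ?_⟩⟩
    · rw [← LinearMap.ker_eq_bot, LinearMap.ker_eq_bot']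
      rintro ⟨p, v⟩ hpv
      have h1 : E (ι (p, v)) = (E (ι (p, v)) j) • Pi.single j 1 := by
        ext l
        rcases eq_or_ne l j with rfl | hl
        · simp
        · obtain ⟨l, rfl⟩ := Fin.exists_succAbove_eq hl
          have := congrFun hpv l
          simpa [f, LinearMap.funLeft] using this
      rw [← hE, ← map_smul] at h1
      have h2 := E.injective h1
      rw [hι] at h2
      have h3 := congrArg Prod.fst h2
      have h4 := congrArg Prod.snd h2
      simp only [x, Prod.smul_mk, smul_zero] at h3 h4
      refine Prod.ext h3 ?_
      ext l
      have := congrFun h4 l.succ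
      simpa using this
    · intro w
      obtain ⟨⟨p, v⟩, hy⟩ : ∃ y, E.symm (j.insertNth (0 : A) w) = y := ⟨_, rfl⟩
      refine ⟨(p, Fin.tail v), ?_⟩
      have h1 : ι (p, Fin.tail v) = (p, v) - (v 0) • x := by
        rw [hι]
        refine Prod.ext (by simp [x]) ?_
        ext l
        refine Fin.cases ?_ (fun l => ?_) l <;> simp [x, Fin.tail]
      ext l
      show E (ι (p, Fin.tail v)) (j.succAbove l) = w l
      rw [h1, map_sub, map_smul, hE, ← hy, LinearEquiv.apply_symm_apply]
      simp

lemma free_of_projective (K : Type) [Field K] (n : ℕ) (P : Type) [AddCommGroup P]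
    [Module (PolyS K n) P] [Module.Finite (PolyS K n) P] [Module.Projective (PolyS K n) P] :
    Module.Free (PolyS K n) P := by
  obtain ⟨a, b, h⟩ := FFR.stablyFree (ffr_poly K n P)
  exact UC.cancel (uc_poly K (n+1)) a b h

end uc
end QS

end PartP3c

section PartP4a

lemma lv_mv (K : Type) [Field K] {R : Type} [CommRing R] (I : Ideal R) (k : ℕ) :
    ∀ (φ : R →+* MvPolynomial (Fin k) K) [Module R (MvPolynomial (Fin k) K)]
      (_ : ∀ (r : R) (x : MvPolynomial (Fin k) K), r • x = φ r * x)
      (_ : ∀ i, ∃ r ∈ I, φ r = MvPolynomial.X i) (i : ℕ) (_ : i < k),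
      LV I i (MvPolynomial (Fin k) K) := by
  induction k with
  | zero => intro _ _ _ _ i hi; omega
  | succ k ih =>
    intro φ _ hφ hX i hi
    obtain ⟨r, hr, hrX⟩ := hX 0
    have hreg : Function.Injective (fun x : MvPolynomial (Fin (k+1)) K => r • x) := by
      intro x y hxy
      simp only [hφ, hrX] at hxy
      exact mul_left_cancel₀ (MvPolynomial.X_ne_zero 0) hxy
    rcases i with _ | i
    · exact LV.zero_of_regular hr hreg
    let θ : MvPolynomial (Fin (k+1)) K →+* MvPolynomial (Fin k) K :=
      (Polynomial.constantCoeff).comp (MvPolynomial.finSuccEquiv K k).toRingEquiv.toRingHom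
    have hθ : ∀ x, θ x = (MvPolynomial.finSuccEquiv K k x).coeff 0 := fun x => rfl
    letI : Module R (MvPolynomial (Fin k) K) := Module.compHom _ (θ.comp φ)
    have hsm : ∀ (r : R) (x : MvPolynomial (Fin k) K), r • x = (θ.comp φ) r * x := fun r x => rfl
    have key := ih (θ.comp φ) hsm (by
      intro i
      obtain ⟨r, hr, hrX⟩ := hX i.succ
      refine ⟨r, hr, ?_⟩
      rw [RingHom.comp_apply, hrX, hθ, MvPolynomial.finSuccEquiv_X_succ, Polynomial.coeff_C_zero])
      i (by omega)
    let f : MvPolynomial (Fin (k+1)) K →ₗ[R] MvPolynomial (Fin k) K :=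
      { toFun := θ
        map_add' := map_add θ
        map_smul' := fun r x => by
          rw [hφ, map_mul]; rfl }
    refine LV.of_regular hr hreg f ?_ ?_ key
    · intro y
      refine ⟨(MvPolynomial.finSuccEquiv K k).symm (Polynomial.C y), ?_⟩
      show θ _ = y
      rw [hθ]; simp
    · intro y
      show θ y = 0 ↔ _
      rw [hθ, ← Polynomial.X_dvd_iff]
      constructor
      · rintro ⟨z, hz⟩
        refine ⟨(MvPolynomial.finSuccEquiv K k).symm z, ?_⟩
        apply (MvPolynomial.finSuccEquiv K k).injective
        rw [hφ, hrX, map_mul, MvPolynomial.finSuccEquiv_X_zero, AlgEquiv.apply_symm_apply, hz]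
      · rintro ⟨z, rfl⟩
        rw [hφ, hrX, map_mul, MvPolynomial.finSuccEquiv_X_zero]
        exact Dvd.intro _ rfl

lemma lv_self (K : Type) [Field K] (n i : ℕ) (hi : i < n + 1) : LV (irrel K n) i (PolyS K n) :=
  lv_mv K (irrel K n) (n+1) (RingHom.id _) (fun _ _ => rfl)
    (fun i => ⟨_, Ideal.subset_span ⟨i, rfl⟩, rfl⟩) i hi

lemma lv_pi (K : Type) [Field K] (n i : ℕ) (hi : i < n + 1) (g : ℕ) :
    LV (irrel K n) i (Fin g → PolyS K n) := by
  induction g with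
  | zero => exact LV.of_subsingleton
  | succ g ih =>
    let e : (PolyS K n × (Fin g → PolyS K n)) ≃ₗ[PolyS K n] (Fin (g+1) → PolyS K n) :=
      Fin.consLinearEquiv (PolyS K n) (fun _ => PolyS K n)
    refine LV.of_equiv e ?_
    exact LV.mid (LinearMap.inl _ _ _) (LinearMap.snd _ _ _) Function.Exact.inl_snd
      LinearMap.inl_injective LinearMap.snd_surjective (lv_self K n i hi) ih

lemma lv_proj (K : Type) [Field K] (n i : ℕ) (hi : i < n + 1) (P : Type) [AddCommGroup P]
    [Module (PolyS K n) P] [Module.Finite (PolyS K n) P] [Module.Projective (PolyS K n) P] :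
    LV (irrel K n) i P := by
  have := QS.free_of_projective K n P
  exact LV.of_equiv (Module.finBasis (PolyS K n) P).equivFun.symm (lv_pi K n i hi _)

end PartP4a

section PartP5

/-- The properties of the polynomial ring and its irrelevant ideal that are used. -/
structure PS (R : Type) [CommRing R] (I : Ideal R) (d : ℕ) : Prop where
  max : I.IsMaximal
  ne : I ≠ ⊥
  ufm : UniqueFactorizationMonoid R
  free : ∀ (P : Type) [AddCommGroup P] [Module R P] [Module.Finite R P] [Module.Projective R P],
    Module.Free R P
  lv : ∀ (P : Type) [AddCommGroup P] [Module R P] [Module.Finite R P] [Module.Projective R P]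
    (i : ℕ), i < d → LV I i P

lemma irrel_eq (K : Type) [Field K] (n : ℕ) :
    irrel K n = RingHom.ker (MvPolynomial.constantCoeff (σ := Fin (n+1)) (R := K)) := by
  apply le_antisymm
  · rw [irrel, Ideal.span_le]
    rintro _ ⟨i, rfl⟩
    simp [RingHom.mem_ker]
  · intro x hx
    rw [RingHom.mem_ker] at hx
    have : x ∈ Ideal.span (MvPolynomial.X '' (Set.univ : Set (Fin (n+1)))) := by
      rw [MvPolynomial.mem_ideal_span_X_image]
      intro m hm
      have hm0 : m ≠ 0 := by
        rintro rfl
        exact (MvPolynomial.mem_support_iff.1 hm) hx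
      obtain ⟨i, hi⟩ := Finsupp.ne_iff.1 hm0
      exact ⟨i, trivial, hi⟩
    rwa [Set.image_univ] at this

lemma ps_poly (K : Type) [Field K] (n : ℕ) : PS (PolyS K n) (irrel K n) (n+1) where
  max := by
    rw [irrel_eq]
    apply RingHom.ker_isMaximal_of_surjective
    exact fun x => ⟨MvPolynomial.C x, by simp⟩
  ne := by
    intro h
    have : (MvPolynomial.X 0 : PolyS K n) ∈ irrel K n := Ideal.subset_span ⟨0, rfl⟩
    rw [h] at this
    exact MvPolynomial.X_ne_zero _ this
  ufm := inferInstance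
  free P _ _ _ _ := QS.free_of_projective K n P
  lv P _ _ _ _ i hi := lv_proj K n i hi P

section
variable {R : Type} [CommRing R] [IsNoetherianRing R] {I : Ideal R}
variable {M N : Type} [AddCommGroup M] [Module R M] [AddCommGroup N] [Module R N]

lemma tors_of_loc [Module.Finite R M]
    (h : ∀ p : Ideal R, p.IsPrime → p ≠ I → ∃ s, s ∉ p ∧ ∀ x : M, s • x = 0) : Tors I M := by
  have : I ≤ (Module.annihilator R M).radical := by
    rw [Ideal.radical_eq_sInf]
    refine le_sInf fun p hp => ?_
    by_contra hI
    obtain ⟨s, hs, hs'⟩ := h p hp.2 (by rintro rfl; exact hI le_rfl)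
    exact hs (hp.1 (Module.mem_annihilator.2 hs'))
  obtain ⟨c, hc⟩ := Ideal.exists_pow_le_of_le_radical_of_fg this (IsNoetherian.noetherian I)
  exact ⟨c, fun r hr x => Module.mem_annihilator.1 (hc hr) x⟩

/-- local isomorphism criterion -/
lemma LV.of_loc [Module.Finite R M] [Module.Finite R N] (f : M →ₗ[R] N)
    (h1 : ∀ p : Ideal R, p.IsPrime → p ≠ I → ∃ s, s ∉ p ∧ ∀ x : M, f x = 0 → s • x = 0)
    (h2 : ∀ p : Ideal R, p.IsPrime → p ≠ I → ∃ s, s ∉ p ∧ ∀ y : N, ∃ x, f x = s • y)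
    {i : ℕ} (h : LV I (i+1) M) : LV I (i+1) N := by
  refine LV.of_map f (tors_of_loc fun p hp hpI => ?_) (tors_of_loc fun p hp hpI => ?_) h
  · obtain ⟨s, hs, hs'⟩ := h1 p hp hpI
    exact ⟨s, hs, fun x => Subtype.ext (hs' x x.2)⟩
  · obtain ⟨s, hs, hs'⟩ := h2 p hp hpI
    refine ⟨s, hs, fun y => ?_⟩
    obtain ⟨y, rfl⟩ := Submodule.mkQ_surjective _ y
    rw [← map_smul, Submodule.mkQ_apply, Submodule.Quotient.mk_eq_zero]
    exact hs' y

lemma LV.of_loc' [Module.Finite R M] [Module.Finite R N] (f : M →ₗ[R] N)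
    (h1 : ∀ p : Ideal R, p.IsPrime → p ≠ I → ∃ s, s ∉ p ∧ ∀ x : M, f x = 0 → s • x = 0)
    (h2 : ∀ p : Ideal R, p.IsPrime → p ≠ I → ∃ s, s ∉ p ∧ ∀ y : N, ∃ x, f x = s • y)
    {i : ℕ} (h : LV I (i+2) N) : LV I (i+2) M := by
  refine LV.of_map' f (tors_of_loc fun p hp hpI => ?_) (tors_of_loc fun p hp hpI => ?_) h
  · obtain ⟨s, hs, hs'⟩ := h1 p hp hpI
    exact ⟨s, hs, fun x => Subtype.ext (hs' x x.2)⟩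
  · obtain ⟨s, hs, hs'⟩ := h2 p hp hpI
    refine ⟨s, hs, fun y => ?_⟩
    obtain ⟨y, rfl⟩ := Submodule.mkQ_surjective _ y
    rw [← map_smul, Submodule.mkQ_apply, Submodule.Quotient.mk_eq_zero]
    exact hs' y

/-- rank one modules -/
lemma lv_rank_one [IsDomain R] {d : ℕ} (H : PS R I d) [Module.Finite R M]
    (h : ∀ p : Ideal R, p.IsPrime → p ≠ I → ∃ s, s ∉ p ∧ ∃ (a : M) (b : M →ₗ[R] R),
      b a = s ∧ ∀ x, b x • a = s • x) (i : ℕ) (hi : i + 2 < d) : LV I (i+2) M := by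
  obtain ⟨s0, hs0, a0, b0, hba0, hab0⟩ := h ⊥ Ideal.isPrime_bot (Ne.symm H.ne)
  have hs0 : s0 ≠ 0 := by simpa using hs0
  have hz : ∀ x, b0 x = 0 → s0 • x = 0 := fun x hx => by rw [← hab0, hx, zero_smul]
  obtain ⟨G, hG⟩ := (Module.Finite.fg_top : (⊤ : Submodule R M).FG)
  have := H.ufm
  obtain ⟨inst⟩ : Nonempty (NormalizedGCDMonoid R) := inferInstance
  let g := G.gcd b0
  have hg : ∀ x, g ∣ b0 x := by
    intro x
    have hx : x ∈ Submodule.span R (G : Set M) := by rw [hG]; trivial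
    induction hx using Submodule.span_induction with
    | mem x hx => exact Finset.gcd_dvd hx
    | zero => simp
    | add x y _ _ hx hy => rw [map_add]; exact dvd_add hx hy
    | smul r x _ hx => rw [map_smul, smul_eq_mul]; exact hx.mul_left r
  have hg0 : g ≠ 0 := by
    intro h0
    have := hg a0
    rw [h0, zero_dvd_iff, hba0] at this
    exact hs0 this
  choose b' hb' using hg
  let β : M →ₗ[R] R :=
    { toFun := b'
      map_add' := fun x y => by
        apply mul_left_cancel₀ hg0
        rw [← hb', mul_add, ← hb', ← hb', map_add]
      map_smul' := fun r x => by
        apply mul_left_cancel₀ hg0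
        rw [← hb', map_smul, hb']
        simp only [smul_eq_mul, RingHom.id_apply]; ring }
  have hβ : ∀ x, b0 x = g * β x := hb'
  have hgcd : IsUnit (G.gcd β) := by
    have h1 : Associated g (g * G.gcd β) := by
      refine Associated.trans ?_ (Finset.gcd_mul_left' G β g)
      rw [show (fun x => g * β x) = b0 from funext fun x => (hβ x).symm]
    have h2 : Associated (g * 1) (g * G.gcd β) := by rwa [mul_one]
    exact (associated_one_iff_isUnit).1 (h2.of_mul_left Associated.rfl hg0).symm
  refine LV.of_loc' β ?_ ?_ (H.lv R (i+2) hi)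
  · intro p hp hpI
    obtain ⟨s, hs, a, b, hba, hab⟩ := h p hp hpI
    refine ⟨s, hs, fun x hx => ?_⟩
    have h1 := hz x (by rw [hβ, hx, mul_zero])
    have h2 : s0 * b x = 0 := by rw [← smul_eq_mul, ← map_smul, h1, map_zero]
    have h3 : b x = 0 := (mul_eq_zero.1 h2).resolve_left hs0
    rw [← hab, h3, zero_smul]
  · intro p hp hpI
    obtain ⟨s, hs, a, b, hba, hab⟩ := h p hp hpI
    refine ⟨s, hs, fun y => ?_⟩
    have h1 : β a ∣ G.gcd (fun x => s * β x) := by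
      apply Finset.dvd_gcd
      intro x _
      have := congrArg β (hab x)
      rw [map_smul, map_smul, smul_eq_mul, smul_eq_mul] at this
      exact ⟨b x, by rw [← this, mul_comm]⟩
    have h2 : β a ∣ s := by
      obtain ⟨w, hw⟩ := hgcd
      have h3 := h1.trans (Finset.gcd_mul_left' G β s).dvd
      rw [← hw] at h3
      exact Units.dvd_mul_right.1 h3
    obtain ⟨t, ht⟩ := h2
    refine ⟨(t * y) • a, ?_⟩
    rw [map_smul, smul_eq_mul, smul_eq_mul, ht]; ring
end

end PartP5

section PartP6

/-- A graded complex, given by a differential and projections on a total module. -/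
structure GC (R : Type) [CommRing R] (X : Type) [AddCommGroup X] [Module R X] where
  D : X →ₗ[R] X
  p : ℤ → X →ₗ[R] X
  DD : ∀ x, D (D x) = 0
  pp : ∀ i x, p i (p i x) = p i x
  pq : ∀ i j x, i ≠ j → p i (p j x) = 0
  Dp : ∀ i x, D (p i x) = p (i+1) (D x)

namespace GC
variable {R : Type} [CommRing R] {I : Ideal R} {X : Type} [AddCommGroup X] [Module R X]
variable (C : GC R X)

def Xd (j : ℤ) : Submodule R X := LinearMap.range (C.p j)

lemma mem_Xd {j : ℤ} {x : X} : x ∈ C.Xd j ↔ C.p j x = x := by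
  constructor
  · rintro ⟨y, rfl⟩; exact C.pp j y
  · intro h; exact ⟨x, h⟩

def Z (j : ℤ) : Submodule R X := C.Xd j ⊓ LinearMap.ker C.D

lemma mem_Z {j : ℤ} {x : X} : x ∈ C.Z j ↔ C.p j x = x ∧ C.D x = 0 := by
  rw [Z, Submodule.mem_inf, mem_Xd, LinearMap.mem_ker]

def B (j : ℤ) : Submodule R X := C.Xd j ⊓ LinearMap.range C.D

lemma mem_B {j : ℤ} {x : X} : x ∈ C.B j ↔ C.p j x = x ∧ ∃ y, C.D y = x := by
  rw [B, Submodule.mem_inf, mem_Xd, LinearMap.mem_range]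

lemma B_le_Z (j : ℤ) : C.B j ≤ C.Z j := by
  intro x hx
  rw [mem_B] at hx
  obtain ⟨h, y, rfl⟩ := hx
  exact (C.mem_Z).2 ⟨h, C.DD y⟩

/-- cohomology -/
abbrev H (j : ℤ) : Type := C.Z j ⧸ (C.B j).submoduleOf (C.Z j)

def HV (j : ℤ) : Prop := ∀ x, C.p j x = x → C.D x = 0 → ∃ y, C.D y = x

def HT (I : Ideal R) (j : ℤ) : Prop := ∀ q : Ideal R, q.IsPrime → q ≠ I → ∃ s, s ∉ q ∧
  ∀ x, C.p j x = x → C.D x = 0 → ∃ y, C.D y = s • x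

lemma lvB {i : ℕ} {j : ℤ} (h1 : LV I i (C.Xd j)) (h2 : LV I (i+1) (C.Z j)) :
    LV I i (C.B (j+1)) := by
  let g : C.Xd j →ₗ[R] C.B (j+1) := (C.D ∘ₗ (C.Xd j).subtype).codRestrict _ (by
    rintro ⟨x, hx⟩
    rw [mem_Xd] at hx
    rw [mem_B]
    refine ⟨?_, x, rfl⟩
    show C.p (j+1) (C.D x) = C.D x
    rw [← C.Dp, hx])
  refine LV.right (Submodule.inclusion (inf_le_left : C.Z j ≤ C.Xd j)) g ?_
    (Submodule.inclusion_injective _) ?_ h1 h2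
  · rintro ⟨x, hx⟩
    constructor
    · intro h
      have h' : C.D x = 0 := congrArg Subtype.val h
      exact ⟨⟨x, hx, h'⟩, rfl⟩
    · rintro ⟨⟨y, hy⟩, h⟩
      have h' : y = x := congrArg Subtype.val h
      subst h'
      exact Subtype.ext ((C.mem_Z).1 hy).2
  · rintro ⟨x, hx⟩
    obtain ⟨h, y, rfl⟩ := (C.mem_B).1 hx
    refine ⟨⟨C.p j y, ⟨y, rfl⟩⟩, Subtype.ext ?_⟩
    show C.D (C.p j y) = C.D y
    rw [C.Dp, h]

lemma lvZ {i : ℕ} {j : ℤ} (h1 : LV I (i+1) (C.Xd j)) (h2 : LV I i (C.B (j+1))) :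
    LV I (i+1) (C.Z j) := by
  let g : C.Xd j →ₗ[R] C.B (j+1) := (C.D ∘ₗ (C.Xd j).subtype).codRestrict _ (by
    rintro ⟨x, hx⟩
    rw [mem_Xd] at hx
    rw [mem_B]
    refine ⟨?_, x, rfl⟩
    show C.p (j+1) (C.D x) = C.D x
    rw [← C.Dp, hx])
  refine LV.left (Submodule.inclusion (inf_le_left : C.Z j ≤ C.Xd j)) g ?_
    (Submodule.inclusion_injective _) ?_ h1 h2
  · rintro ⟨x, hx⟩
    constructor
    · intro h
      have h' : C.D x = 0 := congrArg Subtype.val h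
      exact ⟨⟨x, hx, h'⟩, rfl⟩
    · rintro ⟨⟨y, hy⟩, h⟩
      have h' : y = x := congrArg Subtype.val h
      subst h'
      exact Subtype.ext ((C.mem_Z).1 hy).2
  · rintro ⟨x, hx⟩
    obtain ⟨h, y, rfl⟩ := (C.mem_B).1 hx
    refine ⟨⟨C.p j y, ⟨y, rfl⟩⟩, Subtype.ext ?_⟩
    show C.D (C.p j y) = C.D y
    rw [C.Dp, h]

lemma exH (j : ℤ) : Function.Exact (Submodule.inclusion (C.B_le_Z j))
    (((C.B j).submoduleOf (C.Z j)).mkQ) := by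
  rintro ⟨x, hx⟩
  rw [Submodule.mkQ_apply, Submodule.Quotient.mk_eq_zero]
  constructor
  · intro h
    exact ⟨⟨x, h⟩, rfl⟩
  · rintro ⟨⟨y, hy⟩, h⟩
    have h' : y = x := congrArg Subtype.val h
    subst h'
    exact hy

lemma lvH {i : ℕ} {j : ℤ} (h1 : LV I i (C.Z j)) (h2 : LV I (i+1) (C.B j)) : LV I i (C.H j) :=
  LV.right _ _ (C.exH j) (Submodule.inclusion_injective _) (Submodule.mkQ_surjective _) h1 h2

lemma lvZ' {i : ℕ} {j : ℤ} (h1 : LV I i (C.B j)) (h2 : LV I i (C.H j)) : LV I i (C.Z j) :=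
  LV.mid _ _ (C.exH j) (Submodule.inclusion_injective _) (Submodule.mkQ_surjective _) h1 h2

lemma lvB' {i : ℕ} {j : ℤ} (h1 : LV I (i+1) (C.Z j)) (h2 : LV I i (C.H j)) :
    LV I (i+1) (C.B j) :=
  LV.left _ _ (C.exH j) (Submodule.inclusion_injective _) (Submodule.mkQ_surjective _) h1 h2

section fin
variable [IsNoetherianRing R] [IsDomain R] [Module.Finite R X] [Module.Projective R X] {d : ℕ}

omit [IsDomain R] [Module.Projective R X] in
lemma HT.tors {j : ℤ} (h : C.HT I j) : Tors I (C.H j) := by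
  apply tors_of_loc
  intro q hq hqI
  obtain ⟨s, hs, h⟩ := h q hq hqI
  refine ⟨s, hs, fun x => ?_⟩
  obtain ⟨⟨x, hx⟩, rfl⟩ := Submodule.mkQ_surjective _ x
  rw [← map_smul, Submodule.mkQ_apply, Submodule.Quotient.mk_eq_zero]
  have hx' := (C.mem_Z).1 hx
  obtain ⟨y, hy⟩ := h x hx'.1 hx'.2
  exact (C.mem_B).2 ⟨by
    show C.p j (s • x) = s • x
    rw [map_smul, hx'.1], y, hy⟩

omit [IsDomain R] [Module.Projective R X] in
lemma HT.hv {j : ℤ} (h : C.HT I j) (h1 : LV I 0 (C.Z j)) (h2 : LV I 1 (C.B j)) : C.HV j := by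
  have := Tors.subsingleton (C.lvH h1 h2) h.tors
  intro x h1 h2
  have h3 : (((C.B j).submoduleOf (C.Z j)).mkQ) ⟨x, (C.mem_Z).2 ⟨h1, h2⟩⟩ = 0 :=
    Subsingleton.elim _ _
  rw [Submodule.mkQ_apply, Submodule.Quotient.mk_eq_zero] at h3
  exact ((C.mem_B).1 h3).2

lemma HV.eq {j : ℤ} (h : C.HV j) : C.B j = C.Z j := by
  refine le_antisymm (C.B_le_Z j) fun x hx => ?_
  have hx' := (C.mem_Z).1 hx
  exact (C.mem_B).2 ⟨hx'.1, h x hx'.1 hx'.2⟩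

instance projXd (j : ℤ) : Module.Projective R (C.Xd j) :=
  Module.Projective.of_split (C.Xd j).subtype (C.p j).rangeRestrict (by
    ext ⟨x, hx⟩
    exact (C.mem_Xd).1 hx)

lemma lvX (H : PS R I d) (j : ℤ) (i : ℕ) (hi : i < d) : LV I i (C.Xd j) := H.lv _ i hi

lemma lvZ0 (H : PS R I d) (hd : 0 < d) (j : ℤ) : LV I 0 (C.Z j) :=
  LV.zero_of_injective (Submodule.inclusion (inf_le_left : C.Z j ≤ C.Xd j))
    (Submodule.inclusion_injective _) (C.lvX H j 0 hd)

lemma neg (H : PS R I d) (hT : ∀ j, j ≠ 0 → C.HT I j) (lo : ℤ) (hlo : ∀ i, i < lo → C.p i = 0)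
    (k : ℕ) : lo + k ≤ 0 → ∀ i : ℕ, i + k ≤ d → LV I i (C.B (lo+k)) := by
  induction k with
  | zero =>
    intro _ i _
    have : Subsingleton (C.B (lo + (0:ℕ))) := by
      refine subsingleton_of_forall_eq 0 ?_
      rintro ⟨x, hx⟩
      obtain ⟨h, y, rfl⟩ := (C.mem_B).1 hx
      apply Subtype.ext
      show C.D y = 0
      have := C.Dp (lo - 1) y
      rw [hlo (lo-1) (by omega)] at this
      rw [← h]
      simp only [LinearMap.zero_apply, map_zero] at this
      rw [this]; congr 2; push_cast; ring
    exact LV.of_subsingleton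
  | succ k ih =>
    intro hk i hi
    push_cast at hk
    have hv : C.HV (lo+k) := (hT (lo+k) (by omega)).hv C (C.lvZ0 H (by omega) _)
      (ih (by omega) 1 (by omega))
    have h1 := ih (by omega) (i+1) (by omega)
    rw [hv.eq] at h1
    have := C.lvB (C.lvX H _ i (by omega)) h1
    rw [show lo + ((k+1 : ℕ) : ℤ) = lo + k + 1 by push_cast; ring]
    exact this

/-- Lemma C -/
lemma lemC (H : PS R I d) (hT : ∀ j, j ≠ 0 → C.HT I j) (a : ℕ)
    (hlo : ∀ i, i < -(a:ℤ) → C.p i = 0) (j : ℕ) (hj : 1 ≤ j) (hjd : j + 1 + a ≤ d)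
    (hH : LV I (j+1) (C.H 0)) : C.HV j := by
  have hB0 : ∀ i : ℕ, i + a ≤ d → LV I i (C.B 0) := by
    intro i hi
    have := C.neg H hT (-(a:ℤ)) hlo a (by simp) i hi
    rwa [neg_add_cancel] at this
  have key : ∀ k : ℕ, k < j → LV I (j - k + 1) (C.Z k) := by
    intro k
    induction k with
    | zero =>
      intro _
      exact C.lvZ' (hB0 (j+1) (by omega)) hH
    | succ k ih =>
      intro hk
      obtain ⟨t, rfl⟩ : ∃ t, j = k + 1 + t := ⟨j - (k+1), by omega⟩
      have h1 := ih (by omega)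
      rw [show k + 1 + t - k + 1 = t + 1 + 1 by omega] at h1
      have h2 := C.lvB (C.lvX H k (t+1) (by omega)) h1
      rw [show k + 1 + t - (k + 1) + 1 = t + 1 by omega]
      push_cast
      refine C.lvZ' h2 ((hT _ (by omega)).tors.lv t)
  obtain ⟨j, rfl⟩ : ∃ t, j = t + 1 := ⟨j - 1, by omega⟩
  have h1 := key j (by omega)
  rw [show j + 1 - j + 1 = 1 + 1 by omega] at h1
  have h2 := C.lvB (C.lvX H j 1 (by omega)) h1
  exact (hT _ (by omega)).hv C (C.lvZ0 H (by omega) _) (by push_cast; exact h2)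

/-- Lemma C, converse -/
lemma lemC' (H : PS R I d) (hT : ∀ j, j ≠ 0 → C.HT I j) (a b : ℕ)
    (hlo : ∀ i, i < -(a:ℤ) → C.p i = 0) (hhi : ∀ i, (b:ℤ) < i → C.p i = 0) (i : ℕ)
    (hi : b + 2 ≤ i) (hid : i + 1 + a ≤ d) : LV I i (C.H 0) := by
  have hB0 : ∀ i : ℕ, i + a ≤ d → LV I i (C.B 0) := by
    intro i hi
    have := C.neg H hT (-(a:ℤ)) hlo a (by simp) i hi
    rwa [neg_add_cancel] at this
  have key : ∀ k : ℕ, k ≤ b → ∀ i, k + 2 ≤ i → i < d → LV I i (C.Z (b - k : ℤ)) := by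
    intro k
    induction k with
    | zero =>
      intro _ i hi hid
      have : C.Z ((b:ℤ) - (0:ℕ)) = C.Xd ((b:ℤ) - (0:ℕ)) := by
        rw [Z, inf_eq_left]
        intro x hx
        rw [mem_Xd] at hx
        rw [LinearMap.mem_ker, ← hx, C.Dp, hhi _ (by push_cast; omega), LinearMap.zero_apply]
      rw [this]
      exact C.lvX H _ i hid
    | succ k ih =>
      intro hk i hi hid
      obtain ⟨t, rfl⟩ : ∃ t, i = t + 3 := ⟨i - 3, by omega⟩
      have h1 : LV I (t+2) (C.Z (b - k : ℤ)) := ih (by omega) (t+2) (by omega) (by omega)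
      have h2 : LV I (t+2) (C.B (b - k : ℤ)) := C.lvB' h1 ((hT _ (by omega)).tors.lv t)
      refine C.lvZ (i := t+2) (C.lvX H _ _ hid) ?_
      rw [show (b:ℤ) - ((k+1 : ℕ):ℤ) + 1 = b - k by push_cast; ring]
      exact h2
  have h1 := key b le_rfl i hi (by omega)
  rw [sub_self] at h1
  exact C.lvH h1 (hB0 (i+1) (by omega))

end fin
end GC

end PartP6

section PartP7

/-- A graded complex in degrees `[-2,2]` with its parity involution. -/
structure SGC (R : Type) [CommRing R] (X : Type) [AddCommGroup X] [Module R X] extends GC R X where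
  e : X →ₗ[R] X
  ee : ∀ x, e (e x) = x
  eD : ∀ x, e (D x) = - D (e x)
  ep : ∀ i x, e (p (2*i) x) = p (2*i) x
  ep' : ∀ i x, e (p (2*i+1) x) = - p (2*i+1) x
  pe : ∀ i x, p i (e x) = e (p i x)
  lo : ∀ i, i < -2 → p i = 0
  hi : ∀ i, 2 < i → p i = 0

namespace SGC
variable {R : Type} [CommRing R] {I : Ideal R} {X : Type} [AddCommGroup X] [Module R X]
variable (C : SGC R X)

lemma ep0 (x) : C.e (C.p 0 x) = C.p 0 x := C.ep 0 x
lemma ep1 (x) : C.e (C.p 1 x) = - C.p 1 x := C.ep' 0 x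
lemma ep2 (x) : C.e (C.p 2 x) = C.p 2 x := C.ep 1 x

/-- local data: the complex is, after inverting `s`, homotopic to a free module of rank two. -/
structure UD (s : R) where
  h : X →ₗ[R] X
  a1 : X
  a2 : X
  b1 : X →ₗ[R] R
  b2 : X →ₗ[R] R
  eh : ∀ x, C.e (h x) = - h (C.e x)
  pa1 : C.p 0 a1 = a1
  pa2 : C.p 0 a2 = a2
  Da1 : C.D a1 = 0
  Da2 : C.D a2 = 0
  bp1 : ∀ x, b1 (C.p 0 x) = b1 x
  bp2 : ∀ x, b2 (C.p 0 x) = b2 x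
  bD1 : ∀ x, b1 (C.D x) = 0
  bD2 : ∀ x, b2 (C.D x) = 0
  b11 : b1 a1 = s
  b12 : b1 a2 = 0
  b21 : b2 a1 = 0
  b22 : b2 a2 = s
  hom : ∀ i x, s • C.p i x = C.D (h (C.p i x)) + h (C.D (C.p i x)) + b1 (C.p i x) • a1
    + b2 (C.p i x) • a2

def UA (I : Ideal R) : Prop :=
  ∀ q : Ideal R, q.IsPrime → q ≠ I → ∃ s, s ∉ q ∧ Nonempty (C.UD s)

namespace UD
variable {C} {s : R} (u : C.UD s)

def A : X →ₗ[R] X := u.b1.smulRight u.a1 + u.b2.smulRight u.a2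

lemma A_apply (x) : u.A x = u.b1 x • u.a1 + u.b2 x • u.a2 := rfl

lemma hom' (i x) : C.D (u.h (C.p i x)) + u.h (C.D (C.p i x)) = s • C.p i x - u.A (C.p i x) := by
  rw [u.hom, A_apply]; abel

lemma DA (x) : C.D (u.A x) = 0 := by simp [A_apply, u.Da1, u.Da2]
lemma AD (x) : u.A (C.D x) = 0 := by simp [A_apply, u.bD1, u.bD2]
lemma ea1 : C.e u.a1 = u.a1 := by rw [← u.pa1, C.ep0]
lemma ea2 : C.e u.a2 = u.a2 := by rw [← u.pa2, C.ep0]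
lemma be1 (x) : u.b1 (C.e x) = u.b1 x := by rw [← u.bp1, C.pe, C.ep0, u.bp1]
lemma be2 (x) : u.b2 (C.e x) = u.b2 x := by rw [← u.bp2, C.pe, C.ep0, u.bp2]
lemma eA (x) : C.e (u.A x) = u.A x := by simp [A_apply, u.ea1, u.ea2]
lemma Ae (x) : u.A (C.e x) = u.A x := by simp [A_apply, u.be1, u.be2]
lemma bp1' (i x) (hi : i ≠ 0) : u.b1 (C.p i x) = 0 := by
  rw [← u.bp1, C.pq 0 i x hi.symm, map_zero]
lemma bp2' (i x) (hi : i ≠ 0) : u.b2 (C.p i x) = 0 := by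
  rw [← u.bp2, C.pq 0 i x hi.symm, map_zero]
lemma Ap (i x) (hi : i ≠ 0) : u.A (C.p i x) = 0 := by
  rw [A_apply, u.bp1' i x hi, u.bp2' i x hi]; simp

end UD

lemma UA.ht {C : SGC R X} (h : C.UA I) (j : ℤ) (hj : j ≠ 0) : C.HT I j := by
  intro q hq hqI
  obtain ⟨s, hs, ⟨u⟩⟩ := h q hq hqI
  refine ⟨s, hs, fun x hx hD => ⟨u.h x, ?_⟩⟩
  have := u.hom' j x
  rw [u.Ap j x hj, hx, hD, map_zero] at this
  simpa using this

/-! ### tensor square -/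

def S5 : Finset ℤ := {-2, -1, 0, 1, 2}

lemma p_out (i : ℤ) (hi : i ∉ S5) : C.p i = 0 := by
  by_cases h : i < -2
  · exact C.lo i h
  · by_cases h' : 2 < i
    · exact C.hi i h'
    · exfalso; apply hi; simp only [S5, Finset.mem_insert, Finset.mem_singleton]; omega

def DT : X ⊗[R] X →ₗ[R] X ⊗[R] X :=
  TensorProduct.map C.D LinearMap.id + TensorProduct.map C.e C.D

lemma DT_tmul (x y : X) : C.DT (x ⊗ₜ y) = C.D x ⊗ₜ y + C.e x ⊗ₜ C.D y := rfl

def pT (k : ℤ) : X ⊗[R] X →ₗ[R] X ⊗[R] X :=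
  ∑ i ∈ S5, ∑ j ∈ S5, if i + j = k then TensorProduct.map (C.p i) (C.p j) else 0

lemma p_p (i j : ℤ) (x : X) : C.p i (C.p j x) = if i = j then C.p j x else 0 := by
  split_ifs with h
  · subst h; exact C.pp i x
  · exact C.pq i j x h

lemma pT_pp (k i j : ℤ) (x y : X) : C.pT k (C.p i x ⊗ₜ C.p j y) =
    if i + j = k then C.p i x ⊗ₜ C.p j y else 0 := by
  by_cases hi : i ∈ S5
  · by_cases hj : j ∈ S5
    · rw [pT, LinearMap.sum_apply, Finset.sum_eq_single_of_mem i hi, LinearMap.sum_apply,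
        Finset.sum_eq_single_of_mem j hj]
      · split_ifs
        · rw [TensorProduct.map_tmul, C.pp, C.pp]
        · rfl
      · intro j' _ h
        split_ifs
        · rw [TensorProduct.map_tmul, C.pq _ _ _ h, tmul_zero]
        · rfl
      · intro i' _ h
        rw [LinearMap.sum_apply]
        refine Finset.sum_eq_zero fun j' _ => ?_
        split_ifs
        · rw [TensorProduct.map_tmul, C.pq _ _ _ h, zero_tmul]
        · rfl
    · rw [C.p_out j hj]; simp
  · rw [C.p_out i hi]; simp

lemma pT_comp (k l : ℤ) (z : X ⊗[R] X) : C.pT k (C.pT l z) = if k = l then C.pT l z else 0 := by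
  induction z using TensorProduct.induction_on with
  | zero => simp
  | add x y hx hy => rw [map_add, map_add, hx, hy]; split_ifs <;> simp
  | tmul x y =>
    have : C.pT l (x ⊗ₜ y) = ∑ i ∈ S5, ∑ j ∈ S5, if i + j = l then C.p i x ⊗ₜ[R] C.p j y else 0 := by
      rw [pT, LinearMap.sum_apply]
      refine Finset.sum_congr rfl fun i _ => ?_
      rw [LinearMap.sum_apply]
      refine Finset.sum_congr rfl fun j _ => ?_
      split_ifs <;> rfl
    rw [this, map_sum]
    simp_rw [map_sum]
    split_ifs with h
    · refine Finset.sum_congr rfl fun i _ => Finset.sum_congr rfl fun j _ => ?_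
      split_ifs with h1
      · rw [pT_pp, if_pos (h1.trans h.symm)]
      · simp
    · refine Finset.sum_eq_zero fun i _ => Finset.sum_eq_zero fun j _ => ?_
      split_ifs with h1
      · rw [pT_pp, if_neg (fun h2 => h (h2.symm.trans h1))]
      · simp

lemma sum_shift {M : Type} [AddCommGroup M] (f : ℤ → M) (h1 : f (-2) = 0) (h2 : f 3 = 0) :
    ∑ i ∈ S5, f (i+1) = ∑ i ∈ S5, f i := by
  simp [S5, h1, h2]

lemma pT_tmul (k : ℤ) (x y : X) : C.pT k (x ⊗ₜ y) = ∑ i ∈ S5, ∑ j ∈ S5,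
    if i + j = k then C.p i x ⊗ₜ[R] C.p j y else 0 := by
  rw [pT, LinearMap.sum_apply]
  refine Finset.sum_congr rfl fun i _ => ?_
  rw [LinearMap.sum_apply]
  refine Finset.sum_congr rfl fun j _ => ?_
  split_ifs <;> rfl

lemma pD2 (x) : C.p (-2) (C.D x) = 0 := by
  have := C.Dp (-3) x
  rw [C.lo (-3) (by norm_num)] at this
  simpa using this.symm

lemma DT_pT (k : ℤ) (z : X ⊗[R] X) : C.DT (C.pT k z) = C.pT (k+1) (C.DT z) := by
  induction z using TensorProduct.induction_on with
  | zero => simp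
  | add x y hx hy => simp only [map_add, hx, hy]
  | tmul x y =>
    rw [DT_tmul, map_add, pT_tmul, pT_tmul, pT_tmul, map_sum]
    simp_rw [map_sum]
    have e1 : ∀ i j : ℤ, C.DT (if i + j = k then C.p i x ⊗ₜ[R] C.p j y else 0) =
       (if (i + 1) + j = k + 1 then C.p (i+1) (C.D x) ⊗ₜ[R] C.p j y else 0) +
       (if i + (j + 1) = k + 1 then C.p i (C.e x) ⊗ₜ[R] C.p (j+1) (C.D y) else 0) := by
      intro i j
      by_cases h : i + j = k
      · rw [if_pos h, if_pos (by omega), if_pos (by omega), DT_tmul, C.Dp, C.Dp, C.pe]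
      · rw [if_neg h, if_neg (by omega), if_neg (by omega), map_zero, add_zero]
    simp_rw [e1, Finset.sum_add_distrib]
    congr 1
    · refine sum_shift (fun i => ∑ j ∈ S5, if i + j = k + 1 then
        C.p i (C.D x) ⊗ₜ[R] C.p j y else 0) ?_ ?_
      · simp [C.pD2]
      · simp [C.hi 3 (by norm_num)]
    · refine Finset.sum_congr rfl fun i _ => ?_
      refine sum_shift (fun j => if i + j = k + 1 then
        C.p i (C.e x) ⊗ₜ[R] C.p j (C.D y) else 0) ?_ ?_
      · simp [C.pD2]
      · simp [C.hi 3 (by norm_num)]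

lemma DT_DT (z : X ⊗[R] X) : C.DT (C.DT z) = 0 := by
  induction z using TensorProduct.induction_on with
  | zero => simp
  | add x y hx hy => simp only [map_add, hx, hy, add_zero]
  | tmul x y =>
    simp [DT_tmul, C.eD, neg_tmul, C.DD, C.ee]

lemma pT_lo (k : ℤ) (hk : k < -4) : C.pT k = 0 := by
  rw [pT]
  refine Finset.sum_eq_zero fun i hi => Finset.sum_eq_zero fun j hj => if_neg ?_
  simp only [S5, Finset.mem_insert, Finset.mem_singleton] at hi hj
  omega

/-- The tensor square. -/
def T : GC R (X ⊗[R] X) where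
  D := C.DT
  p := C.pT
  DD := C.DT_DT
  pp i x := by rw [pT_comp, if_pos rfl]
  pq i j x h := by rw [pT_comp, if_neg h]
  Dp := C.DT_pT

namespace UD
variable {C} {s : R} (u : C.UD s)

def hT : X ⊗[R] X →ₗ[R] X ⊗[R] X :=
  s • TensorProduct.map u.h LinearMap.id + TensorProduct.map u.A u.h

lemma hT_tmul (x y : X) : u.hT (x ⊗ₜ y) = s • (u.h x ⊗ₜ y) + u.A x ⊗ₜ u.h y := rfl

lemma homT_pp (i j : ℤ) (x y : X) : C.DT (u.hT (C.p i x ⊗ₜ C.p j y)) +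
    u.hT (C.DT (C.p i x ⊗ₜ C.p j y)) = (s * s) • (C.p i x ⊗ₜ[R] C.p j y) -
      u.A (C.p i x) ⊗ₜ u.A (C.p j y) := by
  have h1 := u.hom' i x
  have h2 := u.hom' j y
  generalize C.p i x = x at *
  generalize C.p j y = y at *
  rw [hT_tmul, DT_tmul, map_add, map_smul, DT_tmul, map_add, DT_tmul, hT_tmul, hT_tmul,
    u.DA, u.AD, u.eA, u.Ae, u.eh, zero_tmul, zero_add, add_zero, neg_tmul]
  have e1 : s • (C.D (u.h x) ⊗ₜ y + -(u.h (C.e x) ⊗ₜ C.D y)) + u.A x ⊗ₜ C.D (u.h y) +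
      (s • u.h (C.D x) ⊗ₜ[R] y + (s • u.h (C.e x) ⊗ₜ C.D y + u.A x ⊗ₜ u.h (C.D y))) =
      s • ((C.D (u.h x) + u.h (C.D x)) ⊗ₜ[R] y) + u.A x ⊗ₜ (C.D (u.h y) + u.h (C.D y)) := by
    rw [add_tmul, tmul_add, smul_add, smul_add, smul_neg]; abel
  rw [e1, h1, h2, sub_tmul, tmul_sub, smul_sub, tmul_smul, ← smul_tmul', smul_smul]
  abel

lemma homT (k : ℤ) (z : X ⊗[R] X) : C.DT (u.hT (C.pT k z)) +
    u.hT (C.DT (C.pT k z)) = (s * s) • (C.pT k z) - TensorProduct.map u.A u.A (C.pT k z) := by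
  induction z using TensorProduct.induction_on with
  | zero => simp
  | add x y hx hy =>
    simp only [map_add, smul_add]
    rw [add_add_add_comm, hx, hy]; abel
  | tmul x y =>
    rw [pT_tmul]
    simp only [map_sum, Finset.smul_sum, ← Finset.sum_add_distrib, ← Finset.sum_sub_distrib]
    refine Finset.sum_congr rfl fun i _ => Finset.sum_congr rfl fun j _ => ?_
    split_ifs
    · rw [u.homT_pp]; rfl
    · simp

lemma AA_pT (k : ℤ) (hk : k ≠ 0) (z : X ⊗[R] X) : TensorProduct.map u.A u.A (C.pT k z) = 0 := by
  induction z using TensorProduct.induction_on with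
  | zero => simp
  | add x y hx hy => simp only [map_add, hx, hy, add_zero]
  | tmul x y =>
    rw [pT_tmul]
    simp only [map_sum]
    refine Finset.sum_eq_zero fun i _ => Finset.sum_eq_zero fun j _ => ?_
    split_ifs with h
    · rw [TensorProduct.map_tmul]
      by_cases hi : i = 0
      · rw [u.Ap j y (by omega), tmul_zero]
      · rw [u.Ap i x hi, zero_tmul]
    · simp

end UD

lemma UA.htT {C : SGC R X} (h : C.UA I) (j : ℤ) (hj : j ≠ 0) : C.T.HT I j := by
  intro q hq hqI
  obtain ⟨s, hs, ⟨u⟩⟩ := h q hq hqI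
  refine ⟨s * s, fun h => (hq.mem_or_mem h).elim hs hs, fun x hx hD => ⟨u.hT x, ?_⟩⟩
  have := u.homT j x
  change C.pT j x = x at hx
  change C.DT x = 0 at hD
  rw [u.AA_pT j hj, hx, hD, map_zero, add_zero, sub_zero] at this
  exact this

end SGC

end PartP7

section PartP7b

section resid
variable {R : Type} [CommRing R] {I : Ideal R} {X : Type} [AddCommGroup X] [Module R X]

lemma exists_resid (hI : I.IsMaximal) (N : Submodule R X) (x : X) (hx : x ∉ N ⊔ I • (⊤ : Submodule R X)) :
    ∃ f : X →ₗ[R] R ⧸ I, (∀ y ∈ N, f y = 0) ∧ f x ≠ 0 := by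
  have ht : Module.IsTorsionBySet R (X ⧸ (N ⊔ I • (⊤ : Submodule R X))) I := by
    intro q r
    obtain ⟨y, rfl⟩ := Submodule.mkQ_surjective _ q
    change (r : R) • (N ⊔ I • (⊤ : Submodule R X)).mkQ y = 0
    rw [← map_smul, Submodule.mkQ_apply, Submodule.Quotient.mk_eq_zero]
    exact Submodule.mem_sup_right (Submodule.smul_mem_smul r.2 trivial)
  let := ht.module
  let : Field (R ⧸ I) := Ideal.Quotient.field I
  have hx' : (N ⊔ I • (⊤ : Submodule R X)).mkQ x ≠ 0 := by
    rwa [Submodule.mkQ_apply, Ne, Submodule.Quotient.mk_eq_zero]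
  obtain ⟨f, hf⟩ := not_forall.1 (mt (Module.forall_dual_apply_eq_zero_iff (R ⧸ I) _).1 hx')
  refine ⟨{ toFun := fun y => f ((N ⊔ I • (⊤ : Submodule R X)).mkQ y)
            map_add' := fun a b => by rw [map_add, map_add]
            map_smul' := fun r a => ?_ }, fun y hy => ?_, hf⟩
  · rw [map_smul]
    have : r • (N ⊔ I • (⊤ : Submodule R X)).mkQ a =
      (Ideal.Quotient.mk I r) • (N ⊔ I • (⊤ : Submodule R X)).mkQ a := rfl
    rw [this, map_smul]
    rfl
  · show f _ = 0
    have : (N ⊔ I • (⊤ : Submodule R X)).mkQ y = 0 := by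
      rw [Submodule.mkQ_apply, Submodule.Quotient.mk_eq_zero]
      exact Submodule.mem_sup_left hy
    rw [this, map_zero]

lemma nak (A N : Submodule R X) (h : A ≤ N ⊔ I • A) (c : ℕ) (hc : ∀ r ∈ I ^ c, ∀ x ∈ A, r • x ∈ N) :
    A ≤ N := by
  have key : ∀ k, A ≤ N ⊔ I ^ k • A := by
    intro k
    induction k with
    | zero => rw [pow_zero, Ideal.one_eq_top, Submodule.top_smul]; exact le_sup_right
    | succ k ih =>
      refine ih.trans (sup_le le_sup_left ?_)
      refine (Submodule.smul_mono (le_refl (I ^ k)) h).trans ?_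
      rw [Submodule.smul_sup]
      refine sup_le (le_sup_of_le_left Submodule.smul_le_right) ?_
      rw [← Submodule.mul_smul, ← pow_succ]
      exact le_sup_right
  exact (key c).trans (sup_le le_rfl (Submodule.smul_le.2 hc))

end resid

namespace GC
variable {R : Type} [CommRing R] {I : Ideal R} {X : Type} [AddCommGroup X] [Module R X]
variable (C : GC R X)

lemma top_le [IsNoetherianRing R] [Module.Finite R X] {j : ℤ} (hT : C.HT I j)
    (hD : ∀ x, C.D (C.p j x) = 0) (N : Submodule R X) (hN : LinearMap.range C.D ≤ N)
    (hpN : ∀ x ∈ N, C.p j x ∈ N) (h : C.Xd j ≤ N ⊔ I • ⊤) : C.Xd j ≤ N := by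
  obtain ⟨c, hc⟩ := hT.tors
  refine nak (I := I) _ _ ?_ c ?_
  · intro x hx
    have h1 := h hx
    obtain ⟨n, hn, y, hy, rfl⟩ := Submodule.mem_sup.1 h1
    rw [← (C.mem_Xd).1 hx, map_add]
    refine Submodule.add_mem_sup (hpN _ hn) ?_
    have := Submodule.mem_map_of_mem (f := C.p j) hy
    rw [Submodule.map_smul''] at this
    refine Submodule.smul_mono (le_refl I) ?_ this
    rintro _ ⟨z, _, rfl⟩
    exact ⟨z, rfl⟩
  · intro r hr x hx
    have hx' := (C.mem_Xd).1 hx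
    have := hc r hr (((C.B j).submoduleOf (C.Z j)).mkQ ⟨x, (C.mem_Z).2 ⟨hx', by rw [← hx', hD]⟩⟩)
    rw [← map_smul, Submodule.mkQ_apply, Submodule.Quotient.mk_eq_zero] at this
    obtain ⟨y, hy⟩ := ((C.mem_B).1 this).2
    exact hN ⟨y, hy⟩

lemma p_range {j : ℤ} (x : X) (hx : x ∈ LinearMap.range C.D) : C.p j x ∈ LinearMap.range C.D := by
  obtain ⟨y, rfl⟩ := hx
  refine ⟨C.p (j-1) y, ?_⟩
  rw [C.Dp, sub_add_cancel]

end GC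

namespace SGC
variable {R : Type} [CommRing R] {I : Ideal R} {X : Type} [AddCommGroup X] [Module R X]
variable (C : SGC R X)

/-- pairing of two residue functionals vanishing on boundaries -/
lemma pair_DT (f g : X →ₗ[R] R ⧸ I) (hf : ∀ x, f (C.D x) = 0) (hg : ∀ x, g (C.D x) = 0)
    (z : X ⊗[R] X) : LinearMap.mul' R (R ⧸ I) (TensorProduct.map f g (C.DT z)) = 0 := by
  induction z using TensorProduct.induction_on with
  | zero => simp
  | add x y hx hy => simp only [map_add, hx, hy, add_zero]
  | tmul x y => simp [DT_tmul, hf, hg]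

/-- If all squares in the top degree are boundaries, the top cohomology vanishes. -/
lemma top_sq [IsNoetherianRing R] [Module.Finite R X] (hI : I.IsMaximal) {j : ℤ} (hT : C.HT I j)
    (hD : ∀ x, C.D (C.p j x) = 0)
    (h : ∀ x, C.p j x = x → ∃ z, C.DT z = x ⊗ₜ x) : C.HV j := by
  have := C.top_le hT hD (LinearMap.range C.D) le_rfl (fun x hx => C.p_range x hx) (by
    intro x hx
    by_contra hx'
    obtain ⟨f, hf, hfx⟩ := exists_resid hI _ x hx'
    obtain ⟨z, hz⟩ := h x ((C.mem_Xd).1 hx)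
    have h1 := C.pair_DT f f (fun x => hf _ ⟨x, rfl⟩) (fun x => hf _ ⟨x, rfl⟩) z
    rw [hz] at h1
    simp only [TensorProduct.map_tmul, LinearMap.mul'_apply] at h1
    let : Field (R ⧸ I) := Ideal.Quotient.field I
    exact hfx (mul_self_eq_zero.1 h1))
  intro x hx _
  exact this ((C.mem_Xd).2 hx)

/-- Truncation. -/
lemma trunc [Module.Projective R X] (hUA : C.UA I) (hv : C.HV 2) : ∃ C' : SGC R X, C'.UA I ∧
    C'.p 2 = 0 ∧ (C'.HV 1 → C.HV 1) := by
  have hDp2 : ∀ x, C.D (C.p 2 x) = 0 := fun x => by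
    rw [C.Dp, C.hi _ (by norm_num)]; rfl
  obtain ⟨σ', hσ'⟩ := Module.projective_lifting_property C.D.rangeRestrict
    ((C.p 2).codRestrict (LinearMap.range C.D) (fun x => hv _ (C.pp 2 x) (hDp2 x)))
    C.D.surjective_rangeRestrict
  have hσ'' : ∀ x, C.D (σ' x) = C.p 2 x := fun x => congrArg Subtype.val (LinearMap.congr_fun hσ' x)
  let σ : X →ₗ[R] X := C.p 1 ∘ₗ σ' ∘ₗ C.p 2
  have hσ : ∀ x, C.D (σ x) = C.p 2 x := fun x => by
    show C.D (C.p 1 (σ' (C.p 2 x))) = _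
    rw [C.Dp, hσ'']; norm_num [C.pp]
  have hσp : ∀ i x, i ≠ 2 → σ (C.p i x) = 0 := fun i x hi => by
    show C.p 1 (σ' (C.p 2 (C.p i x))) = 0
    rw [C.pq _ _ _ hi.symm]; simp
  have hσ2 : ∀ x, σ (C.p 2 x) = σ x := fun x => by
    show C.p 1 (σ' (C.p 2 (C.p 2 x))) = _
    rw [C.pp]; rfl
  have hpσ : ∀ i x, i ≠ 1 → C.p i (σ x) = 0 := fun i x hi => C.pq _ _ _ hi
  have hp1σ : ∀ x, C.p 1 (σ x) = σ x := fun x => C.pp _ _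
  have hσe : ∀ x, σ (C.e x) = σ x := fun x => by
    rw [← hσ2, C.pe, C.ep2, hσ2]
  have heσ : ∀ x, C.e (σ x) = - σ x := fun x => C.ep1 _
  let q : X →ₗ[R] X := LinearMap.id - C.p 2 - σ ∘ₗ C.D
  have hq : ∀ x, q x = x - C.p 2 x - σ (C.D x) := fun x => rfl
  have hDq : ∀ x, C.D (q x) = q (C.D x) := fun x => by
    simp only [hq, map_sub, hDp2, hσ, C.DD, map_zero]
    abel
  have heq : ∀ x, C.e (q x) = q (C.e x) := fun x => by
    have h1 : σ (C.D (C.e x)) = - σ (C.D x) := by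
      rw [← hσe (C.D x), C.eD, map_neg, neg_neg]
    simp only [hq, map_sub, heσ, h1, C.ep2, C.pe]
  have hpq : ∀ i x, C.p i (q x) = q (C.p i x) := fun i x => by
    simp only [hq, map_sub, C.Dp]
    congr 1
    · congr 1
      by_cases h : i = 2
      · subst h; rfl
      · rw [C.pq _ _ _ h, C.pq _ _ _ (Ne.symm h)]
    · by_cases h : i = 1
      · subst h
        rw [hp1σ]
        exact (hσ2 _).symm
      · rw [hpσ _ _ h, hσp _ _ (by omega)]
  have hqq : ∀ x, q (q x) = q x := fun x => by
    have h1 : C.p 2 (q x) = 0 := by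
      rw [hpq, hq, C.pp, hDp2, map_zero]; simp
    have h2 : σ (C.D (q x)) = 0 := by
      rw [hDq, hq, C.DD, map_zero, sub_zero, map_sub, hσ2, sub_self]
    rw [hq (q x), h1, h2, sub_zero, sub_zero]
  refine ⟨{ D := C.D
            p := fun i => q ∘ₗ C.p i
            e := C.e
            DD := C.DD
            pp := fun i x => ?_
            pq := fun i j x h => ?_
            Dp := fun i x => ?_
            ee := C.ee
            eD := C.eD
            ep := fun i x => ?_
            ep' := fun i x => ?_
            pe := fun i x => ?_
            lo := fun i hi => ?_
            hi := fun i hi => ?_ }, ?_, ?_, ?_⟩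
  · show q (C.p i (q (C.p i x))) = q (C.p i x)
    rw [hpq, hqq, C.pp]
  · show q (C.p i (q (C.p j x))) = 0
    rw [hpq, hqq, C.pq _ _ _ h, map_zero]
  · show C.D (q (C.p i x)) = q (C.p (i+1) (C.D x))
    rw [hDq, C.Dp]
  · show C.e (q (C.p _ x)) = q (C.p _ x)
    rw [heq, C.ep]
  · show C.e (q (C.p _ x)) = - q (C.p _ x)
    rw [heq, C.ep', map_neg]
  · show q (C.p i (C.e x)) = C.e (q (C.p i x))
    rw [heq, C.pe]
  · rw [C.lo i hi, LinearMap.comp_zero]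
  · rw [C.hi i hi, LinearMap.comp_zero]
  · intro r hr hrI
    obtain ⟨s, hs, ⟨u⟩⟩ := hUA r hr hrI
    have hqa : ∀ a, C.p 0 a = a → C.D a = 0 → q a = a := fun a h1 h2 => by
      rw [hq, h2, ← h1, C.pq _ _ _ (by norm_num), map_zero, sub_zero, sub_zero]
    have hbq1 : ∀ x, u.b1 (q x) = u.b1 x := fun x => by
      rw [hq, map_sub, map_sub, u.bp1' _ _ (by norm_num), ← hp1σ, u.bp1' _ _ (by norm_num),
        sub_zero, sub_zero]
    have hbq2 : ∀ x, u.b2 (q x) = u.b2 x := fun x => by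
      rw [hq, map_sub, map_sub, u.bp2' _ _ (by norm_num), ← hp1σ, u.bp2' _ _ (by norm_num),
        sub_zero, sub_zero]
    refine ⟨s, hs, ⟨{ u with
      h := q ∘ₗ u.h ∘ₗ q
      eh := fun x => ?_
      pa1 := ?_
      pa2 := ?_
      bp1 := fun x => ?_
      bp2 := fun x => ?_
      hom := fun i x => ?_ }⟩⟩
    · show C.e (q (u.h (q x))) = - q (u.h (q (C.e x)))
      rw [heq, u.eh, heq, map_neg]
    · show q (C.p 0 u.a1) = u.a1
      rw [u.pa1, hqa _ u.pa1 u.Da1]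
    · show q (C.p 0 u.a2) = u.a2
      rw [u.pa2, hqa _ u.pa2 u.Da2]
    · show u.b1 (q (C.p 0 x)) = _
      rw [hbq1, u.bp1]
    · show u.b2 (q (C.p 0 x)) = _
      rw [hbq2, u.bp2]
    · show s • q (C.p i x) = C.D (q (u.h (q (q (C.p i x))))) + q (u.h (q (C.D (q (C.p i x))))) +
        u.b1 (q (C.p i x)) • u.a1 + u.b2 (q (C.p i x)) • u.a2
      have := congrArg q (u.hom i (q x))
      rw [hpq] at this
      have h3 : q (C.D (q (C.p i x))) = C.D (q (C.p i x)) := by rw [← hDq, hqq]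
      rw [map_smul, hqq] at this
      rw [this, hqq, h3, hDq (u.h _)]
      simp only [map_add, map_smul, hqa _ u.pa1 u.Da1, hqa _ u.pa2 u.Da2]
  · ext x
    show q (C.p 2 x) = 0
    rw [hq, C.pp, hDp2, map_zero]; simp
  · intro h x h1 h2
    refine h x ?_ h2
    show q (C.p 1 x) = x
    rw [h1, hq, h2, ← h1, C.pq _ _ _ (by norm_num), map_zero, sub_zero, sub_zero]

end SGC

end PartP7b

section PartP7c

lemma GC.rank1 {R : Type} [CommRing R] {X : Type} [AddCommGroup X] [Module R X] (C : GC R X)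
    (v : X) (hv : C.p 0 v = v) (hv' : C.D v = 0) (b : X →ₗ[R] R) (hb : ∀ x, b (C.D x) = 0) (s : R)
    (hbv : b v = s) (h : ∀ z, C.p 0 z = z → C.D z = 0 → ∃ y, C.D y = b z • v - s • z) :
    ∃ (a : C.H 0) (b : C.H 0 →ₗ[R] R), b a = s ∧ ∀ x, b x • a = s • x := by
  refine ⟨Submodule.Quotient.mk ⟨v, (C.mem_Z).2 ⟨hv, hv'⟩⟩,
    Submodule.liftQ _ (b ∘ₗ (C.Z 0).subtype) ?_, hbv, ?_⟩
  · rintro ⟨x, hx⟩ hx'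
    obtain ⟨_, y, rfl⟩ := (C.mem_B).1 hx'
    exact hb y
  · intro x
    obtain ⟨⟨z, hz⟩, rfl⟩ := Submodule.mkQ_surjective _ x
    obtain ⟨hz1, hz2⟩ := (C.mem_Z).1 hz
    show b z • _ = _
    rw [Submodule.mkQ_apply, ← Submodule.Quotient.mk_smul, ← Submodule.Quotient.mk_smul,
      Submodule.Quotient.eq]
    refine (C.mem_B).2 ⟨?_, h z hz1 hz2⟩
    show C.p 0 (b z • v - s • z) = b z • v - s • z
    rw [map_sub, map_smul, map_smul, hv, hz1]

namespace SGC
variable {R : Type} [CommRing R] {I : Ideal R} {X : Type} [AddCommGroup X] [Module R X]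
variable (C : SGC R X)

def tau (c : R) : X ⊗[R] X →ₗ[R] X ⊗[R] X :=
  c • ((TensorProduct.comm R X X).toLinearMap ∘ₗ (LinearMap.id + TensorProduct.map C.e LinearMap.id +
    TensorProduct.map LinearMap.id C.e - TensorProduct.map C.e C.e))

lemma tau_tmul (c : R) (x y : X) : C.tau c (x ⊗ₜ y) =
    c • (y ⊗ₜ[R] x + y ⊗ₜ[R] C.e x + C.e y ⊗ₜ[R] x - C.e y ⊗ₜ[R] C.e x) := by
  simp [tau]

lemma tau_apply (c : R) (z : X ⊗[R] X) : C.tau c z = c • (TensorProduct.comm R X X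
    (z + TensorProduct.map C.e LinearMap.id z + TensorProduct.map LinearMap.id C.e z -
      TensorProduct.map C.e C.e z)) := rfl

lemma tau_tau {c : R} (hc : c * 2 = 1) (z : X ⊗[R] X) : C.tau c (C.tau c z) = z := by
  induction z using TensorProduct.induction_on with
  | zero => simp
  | add x y hx hy => simp only [map_add, hx, hy]
  | tmul x y =>
    simp only [tau_tmul, map_add, map_sub, map_smul, C.ee]
    trans ((c * 2) * (c * 2)) • (x ⊗ₜ[R] y)
    · module
    · rw [hc, one_mul, one_smul]

lemma DT_tau (c : R) (z : X ⊗[R] X) : C.DT (C.tau c z) = C.tau c (C.DT z) := by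
  induction z using TensorProduct.induction_on with
  | zero => simp
  | add x y hx hy => simp only [map_add, hx, hy]
  | tmul x y =>
    simp only [tau_tmul, DT_tmul, map_add, map_sub, map_smul, C.ee, C.eD, neg_tmul, tmul_neg]
    module

lemma pT_map (k : ℤ) (f g : X →ₗ[R] X) (hf : ∀ i x, C.p i (f x) = f (C.p i x))
    (hg : ∀ i x, C.p i (g x) = g (C.p i x)) (z : X ⊗[R] X) :
    C.pT k (TensorProduct.map f g z) = TensorProduct.map f g (C.pT k z) := by
  induction z using TensorProduct.induction_on with
  | zero => simp
  | add x y hx hy => simp only [map_add, hx, hy]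
  | tmul x y =>
    rw [TensorProduct.map_tmul, pT_tmul, pT_tmul, map_sum]
    simp_rw [map_sum]
    refine Finset.sum_congr rfl fun i _ => Finset.sum_congr rfl fun j _ => ?_
    split_ifs
    · rw [TensorProduct.map_tmul, hf, hg]
    · simp

lemma pT_comm (k : ℤ) (z : X ⊗[R] X) :
    C.pT k (TensorProduct.comm R X X z) = TensorProduct.comm R X X (C.pT k z) := by
  induction z using TensorProduct.induction_on with
  | zero => simp
  | add x y hx hy => simp only [map_add, hx, hy]
  | tmul x y =>
    rw [TensorProduct.comm_tmul, pT_tmul, pT_tmul, map_sum]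
    simp_rw [map_sum]
    rw [Finset.sum_comm]
    refine Finset.sum_congr rfl fun i _ => Finset.sum_congr rfl fun j _ => ?_
    rw [add_comm]
    split_ifs
    · simp
    · simp

lemma pT_tau (c : R) (k : ℤ) (z : X ⊗[R] X) : C.pT k (C.tau c z) = C.tau c (C.pT k z) := by
  rw [tau_apply, map_smul, pT_comm, map_sub, map_add, map_add, pT_map _ _ _ _ C.pe (fun _ _ => rfl),
    pT_map _ _ _ _ (fun _ _ => rfl) C.pe, pT_map _ _ _ _ C.pe C.pe, tau_apply]

def PM (c : R) : X ⊗[R] X →ₗ[R] X ⊗[R] X := c • (LinearMap.id - C.tau c)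

lemma PM_apply (c : R) (z : X ⊗[R] X) : C.PM c z = c • (z - C.tau c z) := rfl

lemma PM_pT (c : R) (k : ℤ) (z : X ⊗[R] X) : C.pT k (C.PM c z) = C.PM c (C.pT k z) := by
  rw [PM_apply, PM_apply, map_smul, map_sub, pT_tau]

lemma PM_eq {c : R} (hc : c * 2 = 1) {z : X ⊗[R] X} (h : C.tau c z = - z) : C.PM c z = z := by
  rw [PM_apply, h, sub_neg_eq_add, ← two_smul R z, smul_smul, hc, one_smul]

lemma tau_PM {c : R} (hc : c * 2 = 1) (z : X ⊗[R] X) : C.tau c (C.PM c z) = - C.PM c z := by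
  rw [PM_apply, map_smul, map_sub, C.tau_tau hc]; module

lemma PM_PM {c : R} (hc : c * 2 = 1) (z : X ⊗[R] X) : C.PM c (C.PM c z) = C.PM c z :=
  C.PM_eq hc (C.tau_PM hc z)

/-- the anti-invariant part of the tensor square -/
def TM {c : R} (hc : c * 2 = 1) : GC R (X ⊗[R] X) where
  D := C.DT
  p := fun k => C.PM c ∘ₗ C.pT k
  DD := C.DT_DT
  pp i x := by
    show C.PM c (C.pT i (C.PM c (C.pT i x))) = C.PM c (C.pT i x)
    rw [PM_pT, C.PM_PM hc, pT_comp, if_pos rfl]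
  pq i j x h := by
    show C.PM c (C.pT i (C.PM c (C.pT j x))) = 0
    rw [PM_pT, C.PM_PM hc, pT_comp, if_neg h, map_zero]
  Dp i x := by
    show C.DT (C.PM c (C.pT i x)) = C.PM c (C.pT (i+1) (C.DT x))
    rw [PM_apply, map_smul, map_sub, DT_tau, DT_pT, PM_apply]

section
variable {C} {c : R} {hc : c * 2 = 1}

lemma TM_pT {k : ℤ} {z : X ⊗[R] X} (h : (C.TM hc).p k z = z) : C.pT k z = z := by
  rw [← h]
  show C.pT k (C.PM c (C.pT k z)) = C.PM c (C.pT k z)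
  rw [PM_pT, pT_comp, if_pos rfl]

lemma TM_tau {k : ℤ} {z : X ⊗[R] X} (h : (C.TM hc).p k z = z) : C.tau c z = - z := by
  rw [← h]
  exact C.tau_PM hc _

lemma TM_mk {k : ℤ} {z : X ⊗[R] X} (h : C.pT k z = z) (h' : C.tau c z = - z) :
    (C.TM hc).p k z = z := by
  show C.PM c (C.pT k z) = z
  rw [h, C.PM_eq hc h']

lemma UA.htTM (h : C.UA I) (j : ℤ) (hj : j ≠ 0) : (C.TM hc).HT I j := by
  intro q hq hqI
  obtain ⟨s, hs, h⟩ := h.htT j hj q hq hqI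
  exact ⟨s, hs, fun x hx hD => h x (TM_pT hx) hD⟩

lemma tau_ee (hc : c * 2 = 1) {x y : X} (hx : C.e x = x) (hy : C.e y = y) :
    C.tau c (x ⊗ₜ y) = y ⊗ₜ[R] x := by
  rw [tau_tmul, hx, hy]
  trans (c * 2) • (y ⊗ₜ[R] x)
  · module
  · rw [hc, one_smul]

lemma tau_eo (hc : c * 2 = 1) {x y : X} (hx : C.e x = x) (hy : C.e y = - y) :
    C.tau c (x ⊗ₜ y) = y ⊗ₜ[R] x := by
  rw [tau_tmul, hx, hy]
  simp only [neg_tmul, tmul_neg]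
  trans (c * 2) • (y ⊗ₜ[R] x)
  · module
  · rw [hc, one_smul]

lemma tau_oe (hc : c * 2 = 1) {x y : X} (hx : C.e x = -x) (hy : C.e y = y) :
    C.tau c (x ⊗ₜ y) = y ⊗ₜ[R] x := by
  rw [tau_tmul, hx, hy]
  simp only [neg_tmul, tmul_neg]
  trans (c * 2) • (y ⊗ₜ[R] x)
  · module
  · rw [hc, one_smul]

lemma tau_oo (hc : c * 2 = 1) {x y : X} (hx : C.e x = -x) (hy : C.e y = -y) :
    C.tau c (x ⊗ₜ y) = - y ⊗ₜ[R] x := by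
  rw [tau_tmul, hx, hy]
  simp only [neg_tmul, tmul_neg]
  trans (c * 2) • (- y ⊗ₜ[R] x)
  · module
  · rw [hc, one_smul]

end

/-- bilinear evaluation -/
def bb (f g : X →ₗ[R] R) : X ⊗[R] X →ₗ[R] R := LinearMap.mul' R R ∘ₗ TensorProduct.map f g

omit C in
lemma bb_tmul (f g : X →ₗ[R] R) (x y : X) : bb f g (x ⊗ₜ y) = f x * g y := by simp [bb]

lemma bb_tau {c : R} (hc : c * 2 = 1) (f g : X →ₗ[R] R) (hf : ∀ x, f (C.e x) = f x)
    (hg : ∀ x, g (C.e x) = g x) (z) : bb f g (C.tau c z) = bb g f z := by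
  induction z using TensorProduct.induction_on with
  | zero => simp
  | add x y hx hy => simp only [map_add, hx, hy]
  | tmul x y =>
    simp only [tau_tmul, map_add, map_sub, map_smul, bb_tmul, hf, hg, smul_eq_mul]
    linear_combination (f y * g x) * hc

lemma bb_DT (f g : X →ₗ[R] R) (hf : ∀ x, f (C.D x) = 0)
    (hg : ∀ x, g (C.D x) = 0) (z) : bb f g (C.DT z) = 0 := by
  induction z using TensorProduct.induction_on with
  | zero => simp
  | add x y hx hy => simp only [map_add, hx, hy, add_zero]
  | tmul x y => simp [DT_tmul, bb_tmul, hf, hg]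

lemma UD.AA {C : SGC R X} {s : R} (u : C.UD s) (z : X ⊗[R] X) : TensorProduct.map u.A u.A z =
    bb u.b1 u.b1 z • (u.a1 ⊗ₜ[R] u.a1) + bb u.b1 u.b2 z • (u.a1 ⊗ₜ[R] u.a2) +
    bb u.b2 u.b1 z • (u.a2 ⊗ₜ[R] u.a1) + bb u.b2 u.b2 z • (u.a2 ⊗ₜ[R] u.a2) := by
  induction z using TensorProduct.induction_on with
  | zero => simp
  | add x y hx hy => simp only [map_add, hx, hy]; module
  | tmul x y =>
    simp only [TensorProduct.map_tmul, UD.A_apply, bb_tmul, add_tmul, tmul_add, smul_tmul_smul]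
    module

lemma pT_mk {i j k : ℤ} {x y : X} (hx : C.p i x = x) (hy : C.p j y = y) (h : i + j = k) :
    C.pT k (x ⊗ₜ y) = x ⊗ₜ[R] y := by
  rw [← hx, ← hy, pT_pp, if_pos h]

section
variable {C} [IsNoetherianRing R] [IsDomain R] [Module.Finite R X] {d : ℕ}

lemma UA.lvTM (H : PS R I d) (h : C.UA I) {c : R} (hc : c * 2 = 1) (i : ℕ) (hi : i + 2 < d) :
    LV I (i+2) ((C.TM hc).H 0) := by
  refine lv_rank_one H (fun q hq hqI => ?_) i hi
  obtain ⟨s, hs, ⟨u⟩⟩ := h q hq hqI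
  have hv1 : C.pT 0 (u.a1 ⊗ₜ u.a2 - u.a2 ⊗ₜ u.a1) = u.a1 ⊗ₜ[R] u.a2 - u.a2 ⊗ₜ u.a1 := by
    rw [map_sub, C.pT_mk u.pa1 u.pa2 (by norm_num), C.pT_mk u.pa2 u.pa1 (by norm_num)]
  have hv2 : C.tau c (u.a1 ⊗ₜ u.a2 - u.a2 ⊗ₜ u.a1) = - (u.a1 ⊗ₜ[R] u.a2 - u.a2 ⊗ₜ u.a1) := by
    rw [map_sub, tau_ee hc u.ea1 u.ea2, tau_ee hc u.ea2 u.ea1, neg_sub]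
  have hv3 : (C.TM hc).p 0 (u.a1 ⊗ₜ u.a2 - u.a2 ⊗ₜ u.a1) = u.a1 ⊗ₜ[R] u.a2 - u.a2 ⊗ₜ u.a1 :=
    TM_mk hv1 hv2
  have hv4 : (C.TM hc).D (u.a1 ⊗ₜ u.a2 - u.a2 ⊗ₜ u.a1) = 0 := by
    show C.DT _ = 0
    simp [DT_tmul, u.Da1, u.Da2]
  refine ⟨s * s, fun h => (hq.mem_or_mem h).elim hs hs, (C.TM hc).rank1 _ hv3 hv4 (bb u.b1 u.b2)
    (C.bb_DT _ _ u.bD1 u.bD2) (s * s) ?_ fun z hz1 hz2 => ⟨- u.hT z, ?_⟩⟩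
  · simp [bb_tmul, u.b11, u.b22, u.b12]
  · skip
    have h1 := u.homT 0 z
    have ht := TM_tau hz1
    have h11 := C.bb_tau hc u.b1 u.b1 u.be1 u.be1 z
    have h12 := C.bb_tau hc u.b1 u.b2 u.be1 u.be2 z
    have h22 := C.bb_tau hc u.b2 u.b2 u.be2 u.be2 z
    rw [ht, map_neg] at h11 h12 h22
    have h11' : bb u.b1 u.b1 z = 0 := by linear_combination -c * h11 - (bb u.b1 u.b1 z) * hc
    have h22' : bb u.b2 u.b2 z = 0 := by linear_combination -c * h22 - (bb u.b2 u.b2 z) * hc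
    rw [TM_pT hz1, show C.DT z = 0 from hz2, u.AA, h11', h22', ← h12] at h1
    show C.DT (- u.hT z) = bb u.b1 u.b2 z • (u.a1 ⊗ₜ u.a2 - u.a2 ⊗ₜ u.a1) - (s * s) • z
    rw [map_zero, add_zero] at h1
    rw [map_neg, h1]
    module

variable [Module.Projective R X]

lemma UA.hvTM (H : PS R I d) (hd : 9 ≤ d) (h : C.UA I) {c : R} (hc : c * 2 = 1) (j : ℕ)
    (h1 : 1 ≤ j) (h4 : j ≤ 4) : (C.TM hc).HV j := by
  refine (C.TM hc).lemC H (fun j hj => h.htTM j hj) 4 (fun i hi => ?_) j h1 (by omega) ?_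
  · show C.PM c ∘ₗ C.pT i = 0
    rw [C.pT_lo i (by simpa using hi), LinearMap.comp_zero]
  · obtain ⟨j, rfl⟩ : ∃ t, j = t + 1 := ⟨j - 1, by omega⟩
    exact h.lvTM H hc j (by omega)

/-- first step: vanishing of `H²`. -/
lemma UA.hv2 (H : PS R I d) (hd : 9 ≤ d) (h : C.UA I) {c : R} (hc : c * 2 = 1) : C.HV 2 := by
  have hDp2 : ∀ x, C.D (C.p 2 x) = 0 := fun x => by
    rw [C.Dp, C.hi _ (by norm_num)]; rfl
  have hI := H.max
  let _ : Field (R ⧸ I) := Ideal.Quotient.field I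
  suffices hle : C.Xd 2 ≤ LinearMap.range C.D from fun x hx _ => hle ((C.mem_Xd).2 hx)
  by_contra hne
  have h1 : ¬ C.Xd 2 ≤ LinearMap.range C.D ⊔ I • ⊤ := fun h2 => hne
    (C.top_le (h.ht 2 (by norm_num)) hDp2 _ le_rfl (fun x hx => C.p_range x hx) h2)
  obtain ⟨e0, he0, he0'⟩ := Set.not_subset.1 h1
  have he0 := (C.mem_Xd).1 he0
  obtain ⟨f, hf, hfe⟩ := exists_resid hI _ e0 he0'
  -- every element is a multiple of `e0` modulo boundaries
  have hgen : C.Xd 2 ≤ Submodule.span R {e0} ⊔ LinearMap.range C.D := by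
    refine C.top_le (h.ht 2 (by norm_num)) hDp2 _ le_sup_right (fun x hx => ?_) ?_
    · obtain ⟨a, ha, b, hb, rfl⟩ := Submodule.mem_sup.1 hx
      obtain ⟨r, rfl⟩ := Submodule.mem_span_singleton.1 ha
      rw [map_add, map_smul, he0]
      exact Submodule.add_mem_sup ha (C.p_range b hb)
    · intro b hb
      have hb := (C.mem_Xd).1 hb
      obtain ⟨v, hv⟩ := Ideal.Quotient.mk_surjective (f b * (f e0)⁻¹)
      by_contra hcon
      have hcon' : b - v • e0 ∉ LinearMap.range C.D ⊔ I • (⊤ : Submodule R X) := fun h3 => hcon (by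
        have : b = v • e0 + (b - v • e0) := by abel
        rw [this, sup_assoc]
        exact Submodule.add_mem_sup (Submodule.smul_mem _ _ (Submodule.mem_span_singleton_self e0)) h3)
      obtain ⟨g, hg, hgb⟩ := exists_resid hI _ _ hcon'
      have h2 := h.hvTM H hd hc 4 (by norm_num) le_rfl (e0 ⊗ₜ b - b ⊗ₜ e0) (TM_mk (by
          rw [map_sub, C.pT_mk he0 hb (by norm_num), C.pT_mk hb he0 (by norm_num)]) (by
          have e1 : C.e e0 = e0 := by rw [← he0, C.ep2]
          have e2 : C.e b = b := by rw [← hb, C.ep2]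
          rw [map_sub, tau_ee hc e1 e2, tau_ee hc e2 e1, neg_sub])) (by
          show C.DT _ = 0
          have e1 : C.D e0 = 0 := by rw [← he0, hDp2]
          have e2 : C.D b = 0 := by rw [← hb, hDp2]
          simp [DT_tmul, e1, e2])
      obtain ⟨z, hz⟩ := h2
      have h3 := C.pair_DT g f (fun x => hg _ ⟨x, rfl⟩) (fun x => hf _ ⟨x, rfl⟩) z
      change C.DT z = _ at hz
      rw [hz] at h3
      simp only [map_sub, TensorProduct.map_tmul, LinearMap.mul'_apply] at h3
      apply hgb
      rw [map_sub, map_smul]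
      have h4 : v • g e0 = Ideal.Quotient.mk I v * g e0 := rfl
      rw [h4, hv]
      field_simp
      linear_combination -h3
  -- the ideal
  let N := LinearMap.range C.D
  let J : Ideal R := Submodule.comap (LinearMap.toSpanSingleton R X e0) N
  have hJ : ∀ r, r ∈ J ↔ r • e0 ∈ N := fun r => Iff.rfl
  obtain ⟨l, hl⟩ : ∃ l : X →ₗ[R] R, ∀ x, l x • e0 - C.p 2 x ∈ N := by
    let f' : R →ₗ[R] X ⧸ N := N.mkQ ∘ₗ LinearMap.toSpanSingleton R X e0
    let g' : X →ₗ[R] X ⧸ N := N.mkQ ∘ₗ C.p 2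
    have hfg : ∀ x, g' x ∈ LinearMap.range f' := by
      intro x
      obtain ⟨a, ha, b, hb, hab⟩ := Submodule.mem_sup.1 (hgen ⟨x, rfl⟩)
      obtain ⟨r, rfl⟩ := Submodule.mem_span_singleton.1 ha
      refine ⟨r, ?_⟩
      show N.mkQ (r • e0) = N.mkQ (C.p 2 x)
      rw [← hab, map_add, (Submodule.Quotient.mk_eq_zero N).2 hb |> fun h => (h : N.mkQ b = 0), add_zero]
    obtain ⟨l, hl⟩ := Module.projective_lifting_property f'.rangeRestrict
      (g'.codRestrict _ hfg) f'.surjective_rangeRestrict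
    refine ⟨l, fun x => ?_⟩
    have := congrArg Subtype.val (LinearMap.congr_fun hl x)
    change N.mkQ (l x • e0) = N.mkQ (C.p 2 x) at this
    rw [← sub_eq_zero, ← map_sub] at this
    exact (Submodule.Quotient.mk_eq_zero N).1 this
  have hlN : ∀ x, l (C.D x) ∈ J := fun x => by
    rw [hJ]
    have h5 := N.add_mem (hl (C.D x)) (C.p_range (j := 2) _ ⟨x, rfl⟩)
    rwa [sub_add_cancel] at h5
  have hl1 : l e0 - 1 ∈ J := by
    rw [hJ, sub_smul, one_smul]
    have := hl e0
    rwa [he0] at this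
  have hJJ : J ≤ J * J := by
    intro r hr
    obtain ⟨y, hy⟩ := (hJ r).1 hr
    obtain ⟨x, hx, hxr⟩ : ∃ x, C.p 1 x = x ∧ C.D x = r • e0 := ⟨C.p 1 y, C.pp 1 y, by
      rw [C.Dp, hy, map_smul]; exact congrArg _ he0⟩
    have hlx : l x ∈ J := by
      have := hl x
      rwa [← hx, C.pq _ _ _ (by norm_num), sub_zero, hx] at this
    have hDe0 : C.D e0 = 0 := by rw [← he0, hDp2]
    have e1 : C.e e0 = e0 := by rw [← he0, C.ep2]
    have e2 : C.e x = - x := by rw [← hx, C.ep1]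
    obtain ⟨w, hw⟩ := h.hvTM H hd hc 3 (by norm_num) (by norm_num) (x ⊗ₜ e0 - e0 ⊗ₜ x) (TM_mk (by
          rw [map_sub, C.pT_mk he0 hx (by norm_num), C.pT_mk hx he0 (by norm_num)]) (by
          rw [map_sub, tau_oe hc e2 e1, tau_eo hc e1 e2, neg_sub])) (by
          show C.DT _ = 0
          simp [DT_tmul, hDe0, e1, hxr, smul_tmul])
    change C.DT w = _ at hw
    let L : X ⊗[R] X →ₗ[R] X := (TensorProduct.rid R X).toLinearMap ∘ₗ TensorProduct.map LinearMap.id l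
    have hL : ∀ a b, L (a ⊗ₜ b) = l b • a := fun a b => by simp [L]
    have hLD : ∀ w, L (C.DT w) - C.D (L w) ∈ J • (⊤ : Submodule R X) := by
      intro w
      induction w using TensorProduct.induction_on with
      | zero => simp
      | add a b ha hb =>
        simp only [map_add, add_sub_add_comm]
        exact add_mem ha hb
      | tmul a b =>
        rw [DT_tmul, map_add, hL, hL, hL, map_smul, add_sub_cancel_left]
        exact Submodule.smul_mem_smul (hlN b) trivial
    have h6 := hLD w
    rw [hw, map_sub, hL, hL] at h6
    have h7 : l e0 • x - C.D (L w) ∈ J • (⊤ : Submodule R X) := by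
      have := add_mem h6 (Submodule.smul_mem_smul hlx (Submodule.mem_top (x := e0)))
      convert this using 1; abel
    have h8 : ∀ z ∈ J • (⊤ : Submodule R X), l (C.D z) ∈ J * J := by
      intro z hz
      refine Submodule.smul_induction_on hz (fun a ha m _ => ?_) (fun a b ha hb => ?_)
      · rw [map_smul, map_smul, smul_eq_mul]
        exact Ideal.mul_mem_mul ha (hlN m)
      · rw [map_add, map_add]; exact add_mem ha hb
    have h9 := h8 _ h7
    rw [map_sub, C.DD, sub_zero, map_smul, hxr, map_smul, map_smul, smul_eq_mul, smul_eq_mul] at h9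
    have h10 : r = l e0 * (r * l e0) - (l e0 - 1) * (r * (l e0 + 1)) := by ring
    rw [h10]
    exact sub_mem h9 (Ideal.mul_mem_mul hl1 (J.mul_mem_right _ hr))
  have hid : IsIdempotentElem J := le_antisymm Ideal.mul_le_left hJJ
  rcases (Ideal.isIdempotentElem_iff_eq_bot_or_top J (IsNoetherian.noetherian J)).1 hid with h0 | h0
  · obtain ⟨s, hs, h11⟩ := h.ht 2 (by norm_num) ⊥ Ideal.isPrime_bot (Ne.symm H.ne)
    obtain ⟨y, hy⟩ := h11 e0 he0 (by rw [← he0, hDp2])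
    apply hs
    rw [← h0, hJ]
    exact ⟨y, hy⟩
  · have : (1:R) ∈ J := h0 ▸ trivial
    rw [hJ, one_smul] at this
    exact he0' (Submodule.mem_sup_left this)

theorem UA.thmA (H : PS R I d) (hd : 9 ≤ d) (h : C.UA I) {c : R} (hc : c * 2 = 1) :
    C.HV 2 ∧ C.HV 1 := by
  have h2 := h.hv2 H hd hc
  refine ⟨h2, ?_⟩
  obtain ⟨C', h', hp, himp⟩ := C.trunc h h2
  apply himp
  have hD : ∀ x, C'.D (C'.p 1 x) = 0 := fun x => by
    have := C'.Dp 1 x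
    rw [this, show (1:ℤ) + 1 = 2 by norm_num, hp, LinearMap.zero_apply]
  refine C'.top_sq H.max (h'.ht 1 (by norm_num)) hD fun x hx => ?_
  have e1 : C'.e x = - x := by rw [← hx, C'.ep1]
  have e2 : C'.D x = 0 := by rw [← hx, hD]
  exact h'.hvTM H hd hc 2 (by norm_num) (by norm_num) (x ⊗ₜ x)
    (TM_mk (C'.pT_mk hx hx (by norm_num)) (tau_oo hc e1 e1)) (by
      show C'.DT _ = 0
      simp [DT_tmul, e2])

end

end SGC

end PartP7c

section PartP8

section sq
variable {R : Type} [CommRing R] {I : Ideal R} [IsNoetherianRing R] [IsDomain R] {d : ℕ}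
  {W F Z : Type} [AddCommGroup W] [Module R W] [AddCommGroup F] [Module R F] [AddCommGroup Z]
  [Module R Z] [Module.Finite R W] [Module.Finite R F]

lemma sqLV (H : PS R I d) (h2 : (2:R) = 0) (m : Z → Z → W) (φ : Z → F)
    (hloc : ∀ q : Ideal R, q.IsPrime → q ≠ I → ∃ s, s ∉ q ∧ ∃ (a1 a2 : Z) (b1 b2 : Z → R)
      (c11 c12 c21 c22 : W →ₗ[R] R) (f1 f2 : F →ₗ[R] R),
      b1 a1 = s ∧ b1 a2 = 0 ∧ b2 a1 = 0 ∧ b2 a2 = s ∧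
      (∀ x y, c11 (m x y) = b1 x * b1 y) ∧ (∀ x y, c12 (m x y) = b1 x * b2 y) ∧
      (∀ x y, c21 (m x y) = b2 x * b1 y) ∧ (∀ x y, c22 (m x y) = b2 x * b2 y) ∧
      (∀ w, (s * s) • w = c11 w • m a1 a1 + c12 w • m a1 a2 + c21 w • m a2 a1 + c22 w • m a2 a2) ∧
      (∀ x, f1 (φ x) = b1 x * b1 x) ∧ (∀ x, f2 (φ x) = b2 x * b2 x) ∧
      (∀ v, (s * s) • v = f1 v • φ a1 + f2 v • φ a2))
    (i : ℕ) (hi : i + 2 < d) (hF : LV I (i+2) F) : LV I (i+2) W := by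
  let A : Submodule R W := Submodule.span R (Set.range fun z : Z × Z => m z.1 z.2 + m z.2 z.1)
  have hA : ∀ x y, m x y + m y x ∈ A := fun x y => Submodule.subset_span ⟨(x, y), rfl⟩
  have hAi : ∀ (f g : W →ₗ[R] R), (∀ x y, f (m x y + m y x) = g (m x y + m y x)) →
      ∀ w ∈ A, f w = g w := by
    intro f g h w hw
    have : A ≤ LinearMap.eqLocus f g := by
      rw [Submodule.span_le]
      rintro _ ⟨⟨x, y⟩, rfl⟩
      exact h x y
    exact this hw
  have ss : ∀ {q : Ideal R} (_ : q.IsPrime) {s : R}, s ∉ q → s * s ∉ q := fun hq s hs h =>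
    (hq.mem_or_mem h).elim hs hs
  have lvA : LV I (i+2) A := by
    refine lv_rank_one H (fun q hq hqI => ?_) i hi
    obtain ⟨s, hs, a1, a2, b1, b2, c11, c12, c21, c22, f1, f2, b11, b12, b21, b22, e11, e12, e21, e22,
      hw, -, -, -⟩ := hloc q hq hqI
    refine ⟨s * s, ss hq hs, ⟨_, hA a1 a2⟩, c12 ∘ₗ A.subtype, ?_, ?_⟩
    · simp [e12, b11, b12, b21, b22]
    · rintro ⟨w, hwA⟩
      apply Subtype.ext
      show c12 w • (m a1 a2 + m a2 a1) = (s * s) • w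
      rw [hw]
      have h1 : c11 w = 0 := hAi c11 0 (fun x y => by
        rw [map_add, e11, e11, LinearMap.zero_apply]; linear_combination (b1 x * b1 y) * h2) w hwA
      have h3 : c22 w = 0 := hAi c22 0 (fun x y => by
        rw [map_add, e22, e22, LinearMap.zero_apply]; linear_combination (b2 x * b2 y) * h2) w hwA
      have h4 : c21 w = c12 w := hAi c21 c12 (fun x y => by
        rw [map_add, map_add, e12, e21, e12, e21]; ring) w hwA
      rw [h1, h3, h4]
      module
  let V := W ⧸ A
  let π : W →ₗ[R] V := A.mkQ
  have hπ : ∀ x y, π (m x y) = - π (m y x) := fun x y => by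
    rw [← sub_eq_zero, sub_neg_eq_add, ← map_add]
    exact (Submodule.Quotient.mk_eq_zero A).2 (hA x y)
  let Γ : Submodule R (V × F) := Submodule.span R (Set.range fun x : Z => (π (m x x), φ x))
  have hΓ : ∀ x, (π (m x x), φ x) ∈ Γ := fun x => Submodule.subset_span ⟨x, rfl⟩
  have hΓi : ∀ {N : Type} [AddCommGroup N] [Module R N] (f g : V × F →ₗ[R] N),
      (∀ x, f (π (m x x), φ x) = g (π (m x x), φ x)) → ∀ w ∈ Γ, f w = g w := by
    intro N _ _ f g h w hw
    have : Γ ≤ LinearMap.eqLocus f g := by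
      rw [Submodule.span_le]
      rintro _ ⟨x, rfl⟩
      exact h x
    exact this hw
  have desc : ∀ (f : W →ₗ[R] R), (∀ x y, f (m x y + m y x) = 0) → ∃ f' : V →ₗ[R] R,
      ∀ w, f' (π w) = f w := fun f hf =>
    ⟨A.liftQ f (fun w hw => hAi f 0 hf w hw), fun w => rfl⟩
  -- the projections of `Γ`
  have key : ∀ q : Ideal R, q.IsPrime → q ≠ I → ∃ s, s ∉ q ∧ ∃ (a1 a2 : Z) (c1 c2 : V →ₗ[R] R)
      (f1 f2 : F →ₗ[R] R), (∀ γ ∈ Γ, s • γ = f1 γ.2 • (π (m a1 a1), φ a1) +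
        f2 γ.2 • (π (m a2 a2), φ a2)) ∧ (∀ γ ∈ Γ, c1 γ.1 = f1 γ.2) ∧ (∀ γ ∈ Γ, c2 γ.1 = f2 γ.2) ∧
      (∀ v, s • v = f1 v • φ a1 + f2 v • φ a2) := by
    intro q hq hqI
    obtain ⟨s, hs, a1, a2, b1, b2, c11, c12, c21, c22, f1, f2, b11, b12, b21, b22, e11, e12, e21, e22,
      hw, hf1, hf2, hv⟩ := hloc q hq hqI
    obtain ⟨c1, hc1⟩ := desc c11 (fun x y => by
        rw [map_add, e11, e11]; linear_combination (b1 x * b1 y) * h2)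
    obtain ⟨c2, hc2⟩ := desc c22 (fun x y => by
        rw [map_add, e22, e22]; linear_combination (b2 x * b2 y) * h2)
    refine ⟨s * s, ss hq hs, a1, a2, c1, c2, f1, f2, ?_, ?_, ?_, hv⟩
    · refine hΓi ((s * s) • LinearMap.id) ((f1 ∘ₗ LinearMap.snd R V F).smulRight (π (m a1 a1), φ a1) +
        (f2 ∘ₗ LinearMap.snd R V F).smulRight (π (m a2 a2), φ a2)) (fun x => ?_)
      refine Prod.ext ?_ ?_
      · show (s * s) • π (m x x) = f1 (φ x) • π (m a1 a1) + f2 (φ x) • π (m a2 a2)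
        rw [← map_smul, hw, hf1, hf2, e11, e12, e21, e22]
        simp only [map_add, map_smul]
        rw [hπ a2 a1, mul_comm (b2 x) (b1 x)]
        module
      · show (s * s) • φ x = f1 (φ x) • φ a1 + f2 (φ x) • φ a2
        exact hv _
    · exact hΓi (c1 ∘ₗ LinearMap.fst R V F) (f1 ∘ₗ LinearMap.snd R V F) (fun x => by
        show c1 (π (m x x)) = f1 (φ x)
        rw [hc1, hf1, e11])
    · exact hΓi (c2 ∘ₗ LinearMap.fst R V F) (f2 ∘ₗ LinearMap.snd R V F) (fun x => by
        show c2 (π (m x x)) = f2 (φ x)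
        rw [hc2, hf2, e22])
  have lvΓ : LV I (i+2) Γ := by
    refine LV.of_loc' (LinearMap.snd R V F ∘ₗ Γ.subtype) (fun q hq hqI => ?_) (fun q hq hqI => ?_) hF
    · obtain ⟨s, hs, a1, a2, c1, c2, f1, f2, k1, k2, k3, k4⟩ := key q hq hqI
      refine ⟨s, hs, ?_⟩
      rintro ⟨γ, hγ⟩ h0
      change γ.2 = 0 at h0
      apply Subtype.ext
      show s • γ = 0
      rw [k1 γ hγ, h0, map_zero, map_zero, zero_smul, zero_smul, add_zero]
    · obtain ⟨s, hs, a1, a2, c1, c2, f1, f2, k1, k2, k3, k4⟩ := key q hq hqI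
      refine ⟨s, hs, fun v => ⟨f1 v • ⟨_, hΓ a1⟩ + f2 v • ⟨_, hΓ a2⟩, ?_⟩⟩
      rw [k4]; rfl
  let G : Submodule R V := LinearMap.range (LinearMap.fst R V F ∘ₗ Γ.subtype)
  have lvG : LV I (i+2) G := by
    refine LV.of_loc (i := i+1) (LinearMap.fst R V F ∘ₗ Γ.subtype).rangeRestrict (fun q hq hqI => ?_)
      (fun q hq hqI => ⟨1, fun h => hq.ne_top ((Ideal.eq_top_iff_one q).2 h), fun y => ?_⟩) lvΓ
    · obtain ⟨s, hs, a1, a2, c1, c2, f1, f2, k1, k2, k3, k4⟩ := key q hq hqI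
      refine ⟨s, hs, ?_⟩
      rintro ⟨γ, hγ⟩ h0
      replace h0 : γ.1 = 0 := congrArg Subtype.val h0
      apply Subtype.ext
      show s • γ = 0
      rw [k1 γ hγ, ← k2 γ hγ, ← k3 γ hγ, h0, map_zero, map_zero, zero_smul, zero_smul, add_zero]
    · rw [one_smul]
      exact LinearMap.surjective_rangeRestrict _ y
  have hG : ∀ x, π (m x x) ∈ G := fun x => ⟨⟨_, hΓ x⟩, rfl⟩
  have lvQ : LV I (i+2) (V ⧸ G) := by
    refine lv_rank_one H (fun q hq hqI => ?_) i hi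
    obtain ⟨s, hs, a1, a2, b1, b2, c11, c12, c21, c22, f1, f2, b11, b12, b21, b22, e11, e12, e21, e22,
      hw, -, -, -⟩ := hloc q hq hqI
    obtain ⟨c, hc⟩ := desc (c12 - c21) (fun x y => by
        simp only [LinearMap.sub_apply, map_add, e12, e21]; ring)
    refine ⟨s * s, ss hq hs, G.mkQ (π (m a1 a2)), G.liftQ c ?_, ?_, ?_⟩
    · rintro _ ⟨⟨γ, hγ⟩, rfl⟩
      exact hΓi (c ∘ₗ LinearMap.fst R V F) 0 (fun x => by
        show c (π (m x x)) = 0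
        rw [hc, LinearMap.sub_apply, e12, e21]; ring) γ hγ
    · show c (π (m a1 a2)) = s * s
      rw [hc, LinearMap.sub_apply, e12, e21, b11, b12, b22]; ring
    · intro x
      obtain ⟨v, rfl⟩ := G.mkQ_surjective x
      obtain ⟨w, rfl⟩ := A.mkQ_surjective v
      show c (π w) • G.mkQ (π (m a1 a2)) = (s * s) • G.mkQ (π w)
      have g1 : ∀ x, G.mkQ (π (m x x)) = 0 := fun x => (Submodule.Quotient.mk_eq_zero G).2 (hG x)
      rw [← map_smul G.mkQ (s * s), ← map_smul π (s * s), hw, hc]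
      simp only [map_add, map_smul, g1, hπ a2 a1, map_neg, LinearMap.sub_apply]
      module
  have lvV : LV I (i+2) V := LV.mid G.subtype G.mkQ (LinearMap.exact_subtype_mkQ G)
    G.subtype_injective G.mkQ_surjective lvG lvQ
  exact LV.mid A.subtype A.mkQ (LinearMap.exact_subtype_mkQ A)
    A.subtype_injective A.mkQ_surjective lvA lvV

end sq

namespace GC
variable {R : Type} [CommRing R] {X : Type} [AddCommGroup X] [Module R X] (C : GC R X)

def Hmk (j : ℤ) : C.Z j →ₗ[R] C.H j := Submodule.mkQ _

lemma Hmk_surj (j : ℤ) : Function.Surjective (C.Hmk j) := Submodule.mkQ_surjective _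

lemma Hmk_eq {j : ℤ} (x y : C.Z j) (h : ∃ z, C.D z = x - y) : C.Hmk j x = C.Hmk j y := by
  rw [← sub_eq_zero, ← map_sub]
  refine (Submodule.Quotient.mk_eq_zero _).2 ?_
  exact (C.mem_B).2 ⟨((C.mem_Z).1 (x - y).2).1, h⟩

def Hdesc (j : ℤ) (b : X →ₗ[R] R) (hb : ∀ x, b (C.D x) = 0) : C.H j →ₗ[R] R :=
  Submodule.liftQ _ (b ∘ₗ (C.Z j).subtype) (by
    rintro ⟨x, hx⟩ hx'
    obtain ⟨_, y, rfl⟩ := (C.mem_B).1 hx'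
    exact hb y)

lemma Hdesc_mk (j : ℤ) (b : X →ₗ[R] R) (hb : ∀ x, b (C.D x) = 0) (x : C.Z j) :
    C.Hdesc j b hb (C.Hmk j x) = b x := rfl

end GC

end PartP8

section PartP8b

namespace Frob
variable {R : Type} [CommRing R] {X : Type} [AddCommGroup X] [Module R X] {ι : Type} [Fintype ι]
  (B : Module.Basis ι R X)

def phi (x : X) : X := ∑ k, (B.repr x k * B.repr x k) • B k

def Phi (f : X →ₗ[R] X) : X →ₗ[R] X := B.constr R fun k => phi B (f (B k))

def psi (b : X →ₗ[R] R) : X →ₗ[R] R := B.constr R fun k => b (B k) * b (B k)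

lemma phi_smul (r : R) (x : X) : phi B (r • x) = (r * r) • phi B x := by
  simp only [phi, map_smul, Finsupp.smul_apply, smul_eq_mul, Finset.smul_sum, smul_smul]
  exact Finset.sum_congr rfl fun k _ => by congr 1; ring

lemma phi_zero : phi B 0 = 0 := by simp [phi]

lemma phi_basis (k : ι) : phi B (B k) = B k := by
  classical
  simp [phi, Module.Basis.repr_self, Finsupp.single_apply]

lemma ext {M : Type} [AddCommGroup M] [Module R M] {f g : X →ₗ[R] M} (h : ∀ x, f (phi B x) = g (phi B x))
    (x : X) : f x = g x := by
  have : f = g := B.ext fun k => by rw [← phi_basis B k]; exact h _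
  rw [this]

variable (h2 : (2:R) = 0)
include h2

lemma neg_eq {M : Type} [AddCommGroup M] [Module R M] (x : M) : - x = x := by
  rw [neg_eq_iff_add_eq_zero, ← two_smul R x, h2, zero_smul]

lemma phi_add (x y : X) : phi B (x + y) = phi B x + phi B y := by
  simp only [phi, map_add, Finsupp.add_apply, ← Finset.sum_add_distrib, ← add_smul]
  refine Finset.sum_congr rfl fun k _ => ?_
  congr 1
  linear_combination (B.repr x k * B.repr y k) * h2

lemma phi_sum {κ : Type} (s : Finset κ) (f : κ → X) : phi B (∑ k ∈ s, f k) = ∑ k ∈ s, phi B (f k) := by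
  classical
  induction s using Finset.induction_on with
  | empty => simp [phi_zero]
  | insert a s ha ih => rw [Finset.sum_insert ha, Finset.sum_insert ha, phi_add B h2, ih]

lemma phi_neg (x : X) : phi B (-x) = - phi B x := by
  rw [neg_eq h2 x, neg_eq h2 (phi B x)]

lemma Phi_phi (f : X →ₗ[R] X) (x : X) : Phi B f (phi B x) = phi B (f x) := by
  conv_rhs => rw [← B.sum_repr x, map_sum, phi_sum B h2]
  rw [phi, map_sum]
  refine Finset.sum_congr rfl fun k _ => ?_
  rw [map_smul, map_smul, phi_smul, Phi, B.constr_basis]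

lemma psi_phi (b : X →ₗ[R] R) (x : X) : psi B b (phi B x) = b x * b x := by
  have : ∀ (s : Finset ι), b (∑ k ∈ s, B.repr x k • B k) * b (∑ k ∈ s, B.repr x k • B k) =
      ∑ k ∈ s, (B.repr x k * B.repr x k) * (b (B k) * b (B k)) := by
    classical
    intro s
    induction s using Finset.induction_on with
    | empty => simp
    | insert a s ha ih =>
      rw [Finset.sum_insert ha, Finset.sum_insert ha, map_add, ← ih, map_smul, smul_eq_mul]
      linear_combination (B.repr x a * b (B a) * b (∑ k ∈ s, B.repr x k • B k)) * h2
  conv_rhs => rw [← B.sum_repr x]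
  rw [this, phi, map_sum]
  refine Finset.sum_congr rfl fun k _ => ?_
  rw [map_smul, psi, B.constr_basis, smul_eq_mul]

lemma Phi_comp (f g : X →ₗ[R] X) (x : X) : Phi B f (Phi B g x) = Phi B (f ∘ₗ g) x := by
  have h : ∀ y, (Phi B f ∘ₗ Phi B g) y = Phi B (f ∘ₗ g) y := ext B fun y => by
    rw [LinearMap.comp_apply, Phi_phi B h2, Phi_phi B h2, Phi_phi B h2, LinearMap.comp_apply]
  exact h x

lemma Phi_congr {f g : X →ₗ[R] X} (h : ∀ x, f x = g x) (x : X) : Phi B f x = Phi B g x := by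
  rw [LinearMap.ext h]

lemma Phi_zero (x : X) : Phi B 0 x = 0 := by
  have h : ∀ y, Phi B 0 y = (0 : X →ₗ[R] X) y := ext B fun y => by
    rw [Phi_phi B h2, LinearMap.zero_apply, LinearMap.zero_apply, phi_zero]
  rw [h x, LinearMap.zero_apply]

lemma Phi_id (x : X) : Phi B LinearMap.id x = x := by
  have h : ∀ y, Phi B LinearMap.id y = (LinearMap.id : X →ₗ[R] X) y := ext B fun y => by
    rw [Phi_phi B h2, LinearMap.id_apply, LinearMap.id_apply]
  rw [h x, LinearMap.id_apply]

lemma Phi_negf (f : X →ₗ[R] X) (x : X) : Phi B (-f) x = - Phi B f x := by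
  have : - f = f := LinearMap.ext fun y => by rw [LinearMap.neg_apply, neg_eq h2]
  rw [this, neg_eq h2 (Phi B f x)]

/-- Frobenius twist of a complex -/
def FC (C : SGC R X) : SGC R X where
  D := Phi B C.D
  p i := Phi B (C.p i)
  e := Phi B C.e
  DD x := by
    rw [Phi_comp B h2, Phi_congr B h2 (g := 0) (fun y => C.DD y), Phi_zero B h2]
  pp i x := by
    rw [Phi_comp B h2, Phi_congr B h2 (g := C.p i) (fun y => C.pp i y)]
  pq i j x h := by
    rw [Phi_comp B h2, Phi_congr B h2 (g := 0) (fun y => C.pq i j y h), Phi_zero B h2]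
  Dp i x := by
    rw [Phi_comp B h2, Phi_comp B h2]
    exact Phi_congr B h2 (fun y => C.Dp i y) x
  ee x := by
    rw [Phi_comp B h2, Phi_congr B h2 (g := LinearMap.id) (fun y => C.ee y), Phi_id B h2]
  eD x := by
    rw [Phi_comp B h2, Phi_comp B h2, ← Phi_negf B h2]
    exact Phi_congr B h2 (fun y => C.eD y) x
  ep i x := by
    rw [Phi_comp B h2]
    exact Phi_congr B h2 (fun y => C.ep i y) x
  ep' i x := by
    rw [Phi_comp B h2, ← Phi_negf B h2]
    exact Phi_congr B h2 (fun y => C.ep' i y) x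
  pe i x := by
    rw [Phi_comp B h2, Phi_comp B h2]
    exact Phi_congr B h2 (fun y => C.pe i y) x
  lo i h := by
    rw [C.lo i h]; exact LinearMap.ext fun x => Phi_zero B h2 x
  hi i h := by
    rw [C.hi i h]; exact LinearMap.ext fun x => Phi_zero B h2 x

lemma FC_p (C : SGC R X) (i : ℤ) (x : X) : (FC B h2 C).p i (phi B x) = phi B (C.p i x) :=
  Phi_phi B h2 _ x
lemma FC_D (C : SGC R X) (x : X) : (FC B h2 C).D (phi B x) = phi B (C.D x) :=
  Phi_phi B h2 _ x
lemma FC_e (C : SGC R X) (x : X) : (FC B h2 C).e (phi B x) = phi B (C.e x) :=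
  Phi_phi B h2 _ x

def FU {C : SGC R X} {s : R} (u : C.UD s) : (FC B h2 C).UD (s * s) where
  h := Phi B u.h
  a1 := phi B u.a1
  a2 := phi B u.a2
  b1 := psi B u.b1
  b2 := psi B u.b2
  eh := ext B (f := (FC B h2 C).e ∘ₗ Phi B u.h) (g := - Phi B u.h ∘ₗ (FC B h2 C).e) fun x => by
    simp [Phi_phi B h2, FC_e B h2, u.eh, phi_neg B h2]
  pa1 := by rw [FC_p, u.pa1]
  pa2 := by rw [FC_p, u.pa2]
  Da1 := by rw [FC_D, u.Da1, phi_zero]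
  Da2 := by rw [FC_D, u.Da2, phi_zero]
  bp1 := ext B (f := psi B u.b1 ∘ₗ (FC B h2 C).p 0) (g := psi B u.b1) fun x => by
    simp [FC_p B h2, psi_phi B h2, u.bp1]
  bp2 := ext B (f := psi B u.b2 ∘ₗ (FC B h2 C).p 0) (g := psi B u.b2) fun x => by
    simp [FC_p B h2, psi_phi B h2, u.bp2]
  bD1 := ext B (f := psi B u.b1 ∘ₗ (FC B h2 C).D) (g := 0) fun x => by
    simp [FC_D B h2, psi_phi B h2, u.bD1]
  bD2 := ext B (f := psi B u.b2 ∘ₗ (FC B h2 C).D) (g := 0) fun x => by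
    simp [FC_D B h2, psi_phi B h2, u.bD2]
  b11 := by rw [psi_phi B h2, u.b11]
  b12 := by rw [psi_phi B h2, u.b12, mul_zero]
  b21 := by rw [psi_phi B h2, u.b21, mul_zero]
  b22 := by rw [psi_phi B h2, u.b22]
  hom i := ext B (f := (s * s) • (FC B h2 C).p i)
    (g := (FC B h2 C).D ∘ₗ Phi B u.h ∘ₗ (FC B h2 C).p i + Phi B u.h ∘ₗ (FC B h2 C).D ∘ₗ (FC B h2 C).p i +
      (psi B u.b1 ∘ₗ (FC B h2 C).p i).smulRight (phi B u.a1) +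
      (psi B u.b2 ∘ₗ (FC B h2 C).p i).smulRight (phi B u.a2)) fun x => by
    simp only [LinearMap.smul_apply, LinearMap.add_apply, LinearMap.comp_apply,
      LinearMap.smulRight_apply, FC_p B h2, FC_D B h2, Phi_phi B h2, psi_phi B h2]
    rw [← phi_smul, u.hom]
    simp only [phi_add B h2, phi_smul]

end Frob

namespace SGC
variable {R : Type} [CommRing R] {I : Ideal R} {X : Type} [AddCommGroup X] [Module R X]
variable {C : SGC R X}
variable [IsNoetherianRing R] [IsDomain R] [Module.Finite R X] [Module.Projective R X] {d : ℕ}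

lemma UA.lvT2 (H : PS R I d) (h2 : (2:R) = 0) (h : C.UA I) (b : ℕ)
    (hb : ∀ i, (b:ℤ) < i → C.p i = 0) (i : ℕ) (hi : b ≤ i) (hid : i + 5 ≤ d) :
    LV I (i+2) (C.T.H 0) := by
  have := H.free X
  let B := Module.Free.chooseBasis R X
  let C' := Frob.FC B h2 C
  have hZ : ∀ x : C.Z 0, Frob.phi B x ∈ C'.Z 0 := fun x => by
    have hx := (C.mem_Z).1 x.2
    exact (C'.mem_Z).2 ⟨by rw [Frob.FC_p, hx.1], by rw [Frob.FC_D, hx.2, Frob.phi_zero]⟩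
  have hm : ∀ x y : C.Z 0, (x : X) ⊗ₜ[R] (y : X) ∈ C.T.Z 0 := fun x y => by
    have hx := (C.mem_Z).1 x.2
    have hy := (C.mem_Z).1 y.2
    refine (C.T.mem_Z).2 ⟨C.pT_mk hx.1 hy.1 (by norm_num), ?_⟩
    show C.DT _ = 0
    rw [DT_tmul, hx.2, hy.2, zero_tmul, tmul_zero, add_zero]
  have hF : LV I (i+2) (C'.H 0) := by
    refine C'.lemC' H (fun j hj => UA.ht (C := C') ?_ j hj) 2 b (fun i hi => C'.lo i (by simpa using hi))
      (fun i hi => ?_) (i+2) (by omega) (by omega)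
    · intro q hq hqI
      obtain ⟨s, hs, ⟨u⟩⟩ := h q hq hqI
      exact ⟨s * s, fun h => (hq.mem_or_mem h).elim hs hs, ⟨Frob.FU B h2 u⟩⟩
    · exact LinearMap.ext (Frob.ext B fun x => by
        rw [Frob.FC_p, hb i hi]; simp [Frob.phi_zero])
  refine sqLV H h2 (Z := C.Z 0) (fun x y => C.T.Hmk 0 ⟨_, hm x y⟩) (fun x => C'.Hmk 0 ⟨_, hZ x⟩)
    (fun q hq hqI => ?_) i (by omega) hF
  obtain ⟨s, hs, ⟨u⟩⟩ := h q hq hqI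
  let v : C'.UD (s * s) := Frob.FU B h2 u
  have hbb : ∀ b b' : X →ₗ[R] R, (∀ x, b (C.D x) = 0) → (∀ x, b' (C.D x) = 0) →
      ∀ z, bb b b' (C.T.D z) = 0 := fun b b' h h' z => C.bb_DT b b' h h' z
  have za1 : u.a1 ∈ C.Z 0 := (C.mem_Z).2 ⟨u.pa1, u.Da1⟩
  have za2 : u.a2 ∈ C.Z 0 := (C.mem_Z).2 ⟨u.pa2, u.Da2⟩
  refine ⟨s, hs, ⟨u.a1, za1⟩, ⟨u.a2, za2⟩, fun x => u.b1 x, fun x => u.b2 x,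
    C.T.Hdesc 0 (bb u.b1 u.b1) (hbb _ _ u.bD1 u.bD1),
    C.T.Hdesc 0 (bb u.b1 u.b2) (hbb _ _ u.bD1 u.bD2),
    C.T.Hdesc 0 (bb u.b2 u.b1) (hbb _ _ u.bD2 u.bD1),
    C.T.Hdesc 0 (bb u.b2 u.b2) (hbb _ _ u.bD2 u.bD2),
    C'.Hdesc 0 v.b1 v.bD1, C'.Hdesc 0 v.b2 v.bD2, u.b11, u.b12, u.b21, u.b22, ?_, ?_, ?_, ?_, ?_,
    ?_, ?_, ?_⟩
  · intro x y; exact (C.T.Hdesc_mk 0 _ _ _).trans (bb_tmul _ _ _ _)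
  · intro x y; exact (C.T.Hdesc_mk 0 _ _ _).trans (bb_tmul _ _ _ _)
  · intro x y; exact (C.T.Hdesc_mk 0 _ _ _).trans (bb_tmul _ _ _ _)
  · intro x y; exact (C.T.Hdesc_mk 0 _ _ _).trans (bb_tmul _ _ _ _)
  · intro w
    obtain ⟨⟨z, hz⟩, rfl⟩ := C.T.Hmk_surj 0 w
    have hz' := (C.T.mem_Z).1 hz
    simp only [GC.Hdesc_mk, ← map_smul, ← map_add]
    refine GC.Hmk_eq _ _ _ ⟨u.hT z, ?_⟩
    have h1 := u.homT 0 z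
    rw [show C.pT 0 z = z from hz'.1, show C.DT z = 0 from hz'.2, map_zero, add_zero, u.AA] at h1
    exact h1
  · intro x; rw [GC.Hdesc_mk]; exact Frob.psi_phi B h2 _ _
  · intro x; rw [GC.Hdesc_mk]; exact Frob.psi_phi B h2 _ _
  · intro w
    obtain ⟨⟨z, hz⟩, rfl⟩ := C'.Hmk_surj 0 w
    have hz' := (C'.mem_Z).1 hz
    simp only [GC.Hdesc_mk, ← map_smul, ← map_add]
    refine GC.Hmk_eq _ _ _ ⟨v.h z, ?_⟩
    have h1 := v.hom' 0 z
    rw [hz'.1, hz'.2, map_zero, add_zero, v.A_apply] at h1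
    exact h1

lemma UA.hvT2 (H : PS R I d) (hd : 9 ≤ d) (h2 : (2:R) = 0) (h : C.UA I) (j : ℕ) (h4 : j ≤ 4) (hj : 2 ≤ j)
    (hb : ∀ i, ((j - 1 : ℕ) : ℤ) < i → C.p i = 0) : C.T.HV j := by
  refine C.T.lemC H (fun j hj => h.htT j hj) 4 (fun i hi => C.pT_lo i (by simpa using hi)) j
    (by omega) (by omega) ?_
  obtain ⟨j, rfl⟩ : ∃ t, j = t + 1 := ⟨j - 1, by omega⟩
  exact h.lvT2 H h2 j hb j le_rfl (by omega)

theorem UA.thmA2 (H : PS R I d) (hd : 9 ≤ d) (h2 : (2:R) = 0) (h : C.UA I) :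
    C.HV 2 ∧ C.HV 1 := by
  have hv2 : C.HV 2 := by
    have hD : ∀ x, C.D (C.p 2 x) = 0 := fun x => by
      rw [C.Dp, C.hi _ (by norm_num)]; rfl
    refine C.top_sq H.max (h.ht 2 (by norm_num)) hD fun x hx => ?_
    have e2 : C.D x = 0 := by rw [← hx, hD]
    exact h.hvT2 H hd h2 4 (by norm_num) (by norm_num) (fun i hi => C.hi i (by norm_num at hi; omega)) (x ⊗ₜ x)
      (C.pT_mk hx hx (by norm_num)) (by
        show C.DT _ = 0
        simp [DT_tmul, e2])
  refine ⟨hv2, ?_⟩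
  obtain ⟨C', h', hp, himp⟩ := C.trunc h hv2
  apply himp
  have hD : ∀ x, C'.D (C'.p 1 x) = 0 := fun x => by
    have := C'.Dp 1 x
    rw [this, show (1:ℤ) + 1 = 2 by norm_num, hp, LinearMap.zero_apply]
  refine C'.top_sq H.max (h'.ht 1 (by norm_num)) hD fun x hx => ?_
  have e2 : C'.D x = 0 := by rw [← hx, hD]
  exact h'.hvT2 H hd h2 2 (by norm_num) (by norm_num) (fun i hi => by
      by_cases h3 : i = 2
      · rw [h3, hp]
      · exact C'.hi i (by norm_num at hi; omega)) (x ⊗ₜ x)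
    (C'.pT_mk hx hx (by norm_num)) (by
      show C'.DT _ = 0
      simp [DT_tmul, e2])

end SGC

end PartP8b

section PartP9a

/-- five-term complexes -/
structure C5 (R : Type) [CommRing R] (A0 A1 A2 A3 A4 : Type) [AddCommGroup A0] [Module R A0]
    [AddCommGroup A1] [Module R A1] [AddCommGroup A2] [Module R A2] [AddCommGroup A3] [Module R A3]
    [AddCommGroup A4] [Module R A4] where
  d0 : A0 →ₗ[R] A1
  d1 : A1 →ₗ[R] A2
  d2 : A2 →ₗ[R] A3
  d3 : A3 →ₗ[R] A4
  d10 : ∀ x, d1 (d0 x) = 0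
  d21 : ∀ x, d2 (d1 x) = 0
  d32 : ∀ x, d3 (d2 x) = 0

namespace C5
variable {R : Type} [CommRing R] {A0 A1 A2 A3 A4 : Type} [AddCommGroup A0] [Module R A0]
    [AddCommGroup A1] [Module R A1] [AddCommGroup A2] [Module R A2] [AddCommGroup A3] [Module R A3]
    [AddCommGroup A4] [Module R A4] (C : C5 R A0 A1 A2 A3 A4)

/-- explicit local contraction data -/
structure U (s : R) where
  h1 : A1 →ₗ[R] A0
  h2 : A2 →ₗ[R] A1
  h3 : A3 →ₗ[R] A2
  h4 : A4 →ₗ[R] A3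
  a1 : A2
  a2 : A2
  b1 : A2 →ₗ[R] R
  b2 : A2 →ₗ[R] R
  da1 : C.d2 a1 = 0
  da2 : C.d2 a2 = 0
  bd1 : ∀ x, b1 (C.d1 x) = 0
  bd2 : ∀ x, b2 (C.d1 x) = 0
  b11 : b1 a1 = s
  b12 : b1 a2 = 0
  b21 : b2 a1 = 0
  b22 : b2 a2 = s
  e0 : ∀ x, s • x = h1 (C.d0 x)
  e1 : ∀ x, s • x = C.d0 (h1 x) + h2 (C.d1 x)
  e2 : ∀ x, s • x = C.d1 (h2 x) + h3 (C.d2 x) + b1 x • a1 + b2 x • a2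
  e3 : ∀ x, s • x = C.d2 (h3 x) + h4 (C.d3 x)
  e4 : ∀ x, s • x = C.d3 (h4 x)

abbrev Tot (A0 A1 A2 A3 A4 : Type) : Type := A0 × A1 × A2 × A3 × A4

def pr {A : Type} [AddCommGroup A] [Module R A] (i j : ℤ) : A →ₗ[R] A :=
  if i = j then LinearMap.id else 0

lemma pr_apply {A : Type} [AddCommGroup A] [Module R A] (i j : ℤ) (x : A) :
    pr (R := R) i j x = if i = j then x else 0 := by
  unfold pr; split_ifs <;> rfl

def pX (i : ℤ) : Tot A0 A1 A2 A3 A4 →ₗ[R] Tot A0 A1 A2 A3 A4 :=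
  (pr i (-2)).prodMap ((pr i (-1)).prodMap ((pr i 0).prodMap ((pr i 1).prodMap (pr i 2))))

lemma pX_apply (i : ℤ) (x0 : A0) (x1 : A1) (x2 : A2) (x3 : A3) (x4 : A4) :
    pX (R := R) i (x0, x1, x2, x3, x4) = (if i = -2 then x0 else 0, if i = -1 then x1 else 0,
      if i = 0 then x2 else 0, if i = 1 then x3 else 0, if i = 2 then x4 else 0) := by
  simp only [pX, LinearMap.prodMap_apply, pr_apply]

def DX : Tot A0 A1 A2 A3 A4 →ₗ[R] Tot A0 A1 A2 A3 A4 :=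
  LinearMap.prod 0 (((C.d0).prodMap ((C.d1).prodMap ((C.d2).prodMap
    (C.d3 ∘ₗ LinearMap.fst R A3 A4)))))

lemma DX_apply (x0 : A0) (x1 : A1) (x2 : A2) (x3 : A3) (x4 : A4) :
    C.DX (x0, x1, x2, x3, x4) = (0, C.d0 x0, C.d1 x1, C.d2 x2, C.d3 x3) := rfl

def eX : Tot A0 A1 A2 A3 A4 →ₗ[R] Tot A0 A1 A2 A3 A4 :=
  (LinearMap.id).prodMap ((-LinearMap.id).prodMap ((LinearMap.id).prodMap
    ((-LinearMap.id).prodMap LinearMap.id)))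

lemma eX_apply (x0 : A0) (x1 : A1) (x2 : A2) (x3 : A3) (x4 : A4) :
    eX (R := R) (x0, x1, x2, x3, x4) = (x0, -x1, x2, -x3, x4) := by
  simp [eX]

def X : SGC R (Tot A0 A1 A2 A3 A4) where
  D := C.DX
  p := pX
  e := eX
  DD := by
    rintro ⟨x0, x1, x2, x3, x4⟩
    simp [DX_apply, C.d10, C.d21, C.d32]
  pp := by
    rintro i ⟨x0, x1, x2, x3, x4⟩
    simp only [pX_apply, Prod.mk.injEq]
    refine ⟨?_, ?_, ?_, ?_, ?_⟩ <;> split_ifs <;> rfl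
  pq := by
    rintro i j ⟨x0, x1, x2, x3, x4⟩ h
    simp only [pX_apply]
    simp only [Prod.mk_eq_zero]
    refine ⟨?_, ?_, ?_, ?_, ?_⟩ <;> (try split_ifs) <;> first | trivial | rfl | omega | simp
  Dp := by
    rintro i ⟨x0, x1, x2, x3, x4⟩
    simp only [pX_apply, DX_apply, Prod.mk.injEq]
    refine ⟨?_, ?_, ?_, ?_, ?_⟩ <;> (try split_ifs) <;> first | trivial | rfl | omega | simp
  ee := by
    rintro ⟨x0, x1, x2, x3, x4⟩
    simp [eX_apply]
  eD := by
    rintro ⟨x0, x1, x2, x3, x4⟩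
    simp [eX_apply, DX_apply]
  ep := by
    rintro i ⟨x0, x1, x2, x3, x4⟩
    simp only [pX_apply, eX_apply, Prod.mk.injEq]
    refine ⟨?_, ?_, ?_, ?_, ?_⟩ <;> (try split_ifs) <;> first | trivial | rfl | omega | simp
  ep' := by
    rintro i ⟨x0, x1, x2, x3, x4⟩
    simp only [pX_apply, eX_apply, Prod.neg_mk, Prod.mk.injEq]
    refine ⟨?_, ?_, ?_, ?_, ?_⟩ <;> (try split_ifs) <;> first | trivial | rfl | omega | simp
  pe := by
    rintro i ⟨x0, x1, x2, x3, x4⟩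
    simp only [pX_apply, eX_apply, Prod.mk.injEq]
    refine ⟨?_, ?_, ?_, ?_, ?_⟩ <;> (try split_ifs) <;> first | trivial | rfl | omega | simp
  lo := by
    intro i hi
    refine LinearMap.ext ?_
    rintro ⟨x0, x1, x2, x3, x4⟩
    simp only [pX_apply, LinearMap.zero_apply, Prod.mk_eq_zero]
    refine ⟨?_, ?_, ?_, ?_, ?_⟩ <;> (try split_ifs) <;> first | trivial | rfl | omega | simp
  hi := by
    intro i hi
    refine LinearMap.ext ?_
    rintro ⟨x0, x1, x2, x3, x4⟩
    simp only [pX_apply, LinearMap.zero_apply, Prod.mk_eq_zero]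
    refine ⟨?_, ?_, ?_, ?_, ?_⟩ <;> (try split_ifs) <;> first | trivial | rfl | omega | simp

lemma X_D (x) : C.X.D x = C.DX x := rfl
lemma X_p (i x) : C.X.p i x = pX (R := R) i x := rfl
lemma X_e (x) : C.X.e x = eX (R := R) x := rfl

def hX {s : R} (u : C.U s) : Tot A0 A1 A2 A3 A4 →ₗ[R] Tot A0 A1 A2 A3 A4 :=
  LinearMap.prod (u.h1 ∘ₗ LinearMap.fst R A1 _ ∘ₗ LinearMap.snd R A0 _)
    ((LinearMap.prod (u.h2 ∘ₗ LinearMap.fst R A2 _ ∘ₗ LinearMap.snd R A1 _)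
      ((LinearMap.prod (u.h3 ∘ₗ LinearMap.fst R A3 _ ∘ₗ LinearMap.snd R A2 _)
        ((LinearMap.prod (u.h4 ∘ₗ LinearMap.snd R A3 _) 0) ∘ₗ LinearMap.snd R A2 _))
          ∘ₗ LinearMap.snd R A1 _)) ∘ₗ LinearMap.snd R A0 _)

lemma hX_apply {s : R} (u : C.U s) (x0 : A0) (x1 : A1) (x2 : A2) (x3 : A3) (x4 : A4) :
    C.hX u (x0, x1, x2, x3, x4) = (u.h1 x1, u.h2 x2, u.h3 x3, u.h4 x4, 0) := rfl

def p2 : Tot A0 A1 A2 A3 A4 →ₗ[R] A2 :=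
  LinearMap.fst R A2 _ ∘ₗ LinearMap.snd R A1 _ ∘ₗ LinearMap.snd R A0 _

lemma p2_apply (x0 : A0) (x1 : A1) (x2 : A2) (x3 : A3) (x4 : A4) :
    p2 (R := R) (x0, x1, x2, x3, x4) = x2 := rfl

def UX {s : R} (u : C.U s) : C.X.UD s where
  h := C.hX u
  a1 := (0, 0, u.a1, 0, 0)
  a2 := (0, 0, u.a2, 0, 0)
  b1 := u.b1 ∘ₗ p2
  b2 := u.b2 ∘ₗ p2
  eh := by
    rintro ⟨x0, x1, x2, x3, x4⟩
    rw [X_e, X_e]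
    simp [eX_apply, hX_apply]
  pa1 := by rw [X_p]; simp [pX_apply]
  pa2 := by rw [X_p]; simp [pX_apply]
  Da1 := by rw [X_D]; simp [DX_apply, u.da1]
  Da2 := by rw [X_D]; simp [DX_apply, u.da2]
  bp1 := by
    rintro ⟨x0, x1, x2, x3, x4⟩
    rw [X_p]
    simp [pX_apply, p2_apply]
  bp2 := by
    rintro ⟨x0, x1, x2, x3, x4⟩
    rw [X_p]
    simp [pX_apply, p2_apply]
  bD1 := by
    rintro ⟨x0, x1, x2, x3, x4⟩
    rw [X_D, LinearMap.comp_apply, DX_apply, p2_apply, u.bd1]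
  bD2 := by
    rintro ⟨x0, x1, x2, x3, x4⟩
    rw [X_D, LinearMap.comp_apply, DX_apply, p2_apply, u.bd2]
  b11 := u.b11
  b12 := u.b12
  b21 := u.b21
  b22 := u.b22
  hom := by
    rintro i ⟨x0, x1, x2, x3, x4⟩
    simp only [X_p, X_D, LinearMap.comp_apply, pX_apply, hX_apply, DX_apply, p2_apply, Prod.smul_mk, Prod.mk_add_mk, Prod.mk.injEq, smul_zero,
      add_zero, zero_add]
    exact ⟨u.e0 _, u.e1 _, u.e2 _, u.e3 _, u.e4 _⟩

/-- the complex is locally (off `I`) homotopic to `R²` -/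
def LU (I : Ideal R) : Prop := ∀ q : Ideal R, q.IsPrime → q ≠ I → ∃ s, s ∉ q ∧ Nonempty (C.U s)

lemma LU.ua {I : Ideal R} (h : C.LU I) : C.X.UA I := fun q hq hI => by
  obtain ⟨s, hs, ⟨u⟩⟩ := h q hq hI
  exact ⟨s, hs, ⟨C.UX u⟩⟩

def dual : C5 R (Module.Dual R A4) (Module.Dual R A3) (Module.Dual R A2) (Module.Dual R A1)
    (Module.Dual R A0) where
  d0 := C.d3.dualMap
  d1 := C.d2.dualMap
  d2 := C.d1.dualMap
  d3 := C.d0.dualMap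
  d10 f := LinearMap.ext fun x => by
    simp only [LinearMap.dualMap_apply, C.d32, map_zero, LinearMap.zero_apply]
  d21 f := LinearMap.ext fun x => by
    simp only [LinearMap.dualMap_apply, C.d21, map_zero, LinearMap.zero_apply]
  d32 f := LinearMap.ext fun x => by
    simp only [LinearMap.dualMap_apply, C.d10, map_zero, LinearMap.zero_apply]

def U.dual {C : C5 R A0 A1 A2 A3 A4} {s : R} (u : C.U s) : C.dual.U s where
  h1 := u.h4.dualMap
  h2 := u.h3.dualMap
  h3 := u.h2.dualMap
  h4 := u.h1.dualMap
  a1 := u.b1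
  a2 := u.b2
  b1 := Module.Dual.eval R A2 u.a1
  b2 := Module.Dual.eval R A2 u.a2
  da1 := LinearMap.ext u.bd1
  da2 := LinearMap.ext u.bd2
  bd1 f := by
    show f (C.d2 u.a1) = 0
    rw [u.da1, map_zero]
  bd2 f := by
    show f (C.d2 u.a2) = 0
    rw [u.da2, map_zero]
  b11 := u.b11
  b12 := u.b21
  b21 := u.b12
  b22 := u.b22
  e0 f := LinearMap.ext fun x => by
    show s • f x = f (C.d3 (u.h4 x))
    rw [← u.e4, map_smul]
  e1 f := LinearMap.ext fun x => by
    show s • f x = f (u.h4 (C.d3 x)) + f (C.d2 (u.h3 x))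
    rw [← map_smul, u.e3, map_add, add_comm]
  e2 f := LinearMap.ext fun x => by
    show s • f x = f (u.h3 (C.d2 x)) + f (C.d1 (u.h2 x)) + f u.a1 • u.b1 x + f u.a2 • u.b2 x
    rw [← map_smul, u.e2, map_add, map_add, map_add, map_smul, map_smul]
    simp only [smul_eq_mul]
    ring
  e3 f := LinearMap.ext fun x => by
    show s • f x = f (u.h2 (C.d1 x)) + f (C.d0 (u.h1 x))
    rw [← map_smul, u.e1, map_add, add_comm]
  e4 f := LinearMap.ext fun x => by
    show s • f x = f (u.h1 (C.d0 x))
    rw [← map_smul, u.e0]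

lemma LU.dual {I : Ideal R} (h : C.LU I) : C.dual.LU I := fun q hq hI => by
  obtain ⟨s, hs, ⟨u⟩⟩ := h q hq hI
  exact ⟨s, hs, ⟨u.dual⟩⟩

/-- lifting along a linear map -/
lemma lift_exists {P N N' : Type} [AddCommGroup P] [Module R P] [AddCommGroup N] [Module R N]
    [AddCommGroup N'] [Module R N'] [Module.Projective R P] (d : N →ₗ[R] N') (u : P →ₗ[R] N')
    (h : ∀ x, ∃ y, d y = u x) : ∃ g : P →ₗ[R] N, ∀ x, d (g x) = u x := by
  obtain ⟨g, hg⟩ := Module.projective_lifting_property d.rangeRestrict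
    (u.codRestrict (LinearMap.range d) fun x => LinearMap.mem_range.2 (h x)) d.surjective_rangeRestrict
  exact ⟨g, fun x => congrArg Subtype.val (LinearMap.congr_fun hg x)⟩

/-- extension along a linear map, into a free module, from extension of functionals -/
lemma extend_exists {P N N' : Type} [AddCommGroup P] [Module R P] [AddCommGroup N] [Module R N]
    [AddCommGroup N'] [Module R N'] [Module.Free R P] [Module.Finite R P] (d : N →ₗ[R] N') (u : N →ₗ[R] P)
    (h : ∀ b : P →ₗ[R] R, ∃ y : N' →ₗ[R] R, y ∘ₗ d = b ∘ₗ u) : ∃ g : N' →ₗ[R] P, ∀ x, g (d x) = u x := by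
  let B := Module.Free.chooseBasis R P
  choose y hy using fun k => h (B.coord k)
  refine ⟨∑ k, (y k).smulRight (B k), fun x => ?_⟩
  conv_rhs => rw [← B.sum_repr (u x)]
  rw [LinearMap.sum_apply]
  refine Finset.sum_congr rfl fun k _ => ?_
  rw [LinearMap.smulRight_apply]
  congr 1
  exact LinearMap.congr_fun (hy k) x

section
variable [IsNoetherianRing R] [IsDomain R] 
  [Module.Finite R A0] [Module.Finite R A1] [Module.Finite R A2] [Module.Finite R A3] [Module.Finite R A4]
  [Module.Projective R A0] [Module.Projective R A1] [Module.Projective R A2] [Module.Projective R A3]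
  [Module.Projective R A4]

/-- Theorem A for five-term complexes. -/
theorem LU.exact {I : Ideal R} {d : ℕ} (H : PS R I d) (hd : 9 ≤ d)
    (hc : (2:R) = 0 ∨ ∃ c : R, c * 2 = 1) (h : C.LU I) :
    (∀ y, ∃ x, C.d3 x = y) ∧ ∀ y, C.d3 y = 0 → ∃ x, C.d2 x = y := by
  have key : C.X.HV 2 ∧ C.X.HV 1 := by
    rcases hc with h2 | ⟨c, hc⟩
    · exact (LU.ua C h).thmA2 H hd h2
    · exact (LU.ua C h).thmA H hd hc
  constructor
  · intro y
    obtain ⟨⟨x0, x1, x2, x3, x4⟩, hx⟩ := key.1 (0, 0, 0, 0, y) (by rw [X_p]; simp [pX_apply])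
      (by rw [X_D]; simp [DX_apply])
    rw [X_D, DX_apply] at hx
    exact ⟨x3, by simp at hx; tauto⟩
  · intro y hy
    obtain ⟨⟨x0, x1, x2, x3, x4⟩, hx⟩ := key.2 (0, 0, 0, y, 0) (by rw [X_p]; simp [pX_apply])
      (by rw [X_D]; simp [DX_apply, hy])
    rw [X_D, DX_apply] at hx
    exact ⟨x2, by simp at hx; tauto⟩

/-- the middle cohomology is projective -/
theorem LU.proj {I : Ideal R} {d : ℕ} (H : PS R I d) (hd : 9 ≤ d)
    (hc : (2:R) = 0 ∨ ∃ c : R, c * 2 = 1) (h : C.LU I) {E : Type} [AddCommGroup E] [Module R E]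
    (ε : LinearMap.ker C.d2 →ₗ[R] E) (hε : Function.Surjective ε)
    (hk : ∀ x, ε x = 0 → ∃ y, C.d1 y = x) (hk' : ∀ y (h : C.d1 y ∈ LinearMap.ker C.d2), ε ⟨C.d1 y, h⟩ = 0) :
    Module.Projective R E := by
  have f0 := H.free A0
  have f1 := H.free A1
  obtain ⟨ex4, ex3⟩ := LU.exact C H hd hc h
  obtain ⟨dx4, dx3⟩ := LU.exact C.dual H hd hc (LU.dual C h)
  obtain ⟨ρ, hρ⟩ := extend_exists C.d0 LinearMap.id (fun b => dx4 b)
  obtain ⟨ρ', hρ'⟩ := extend_exists C.d1 (LinearMap.id - C.d0 ∘ₗ ρ) (fun b => by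
    obtain ⟨y, hy⟩ := dx3 (b ∘ₗ (LinearMap.id - C.d0 ∘ₗ ρ)) (LinearMap.ext fun x => by
      show b (C.d0 x - C.d0 (ρ (C.d0 x))) = 0
      rw [hρ]; simp)
    exact ⟨y, hy⟩)
  obtain ⟨σ, hσ⟩ := lift_exists C.d3 LinearMap.id ex4
  obtain ⟨τ, hτ⟩ := lift_exists C.d2 (LinearMap.id - σ ∘ₗ C.d3) (fun x => ex3 _ (by
    simp [hσ]))
  have hz : ∀ x, ((LinearMap.id : A2 →ₗ[R] A2) - τ ∘ₗ C.d2) x ∈ LinearMap.ker C.d2 := fun x => by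
    simp [hτ, C.d32]
  let z : A2 →ₗ[R] LinearMap.ker C.d2 := LinearMap.codRestrict _ _ hz
  -- section of ε
  let w : LinearMap.ker C.d2 →ₗ[R] A2 := ((LinearMap.id : A2 →ₗ[R] A2) - C.d1 ∘ₗ ρ') ∘ₗ (LinearMap.ker C.d2).subtype
  have hw1 : LinearMap.ker ε ≤ LinearMap.ker w := fun x hx => by
    obtain ⟨y, hy⟩ := hk x hx
    show (x : A2) - C.d1 (ρ' x) = 0
    rw [← hy, hρ']
    simp [C.d10]
  let q := ε.quotKerEquivOfSurjective hε
  let j : E →ₗ[R] A2 := (LinearMap.ker ε).liftQ w hw1 ∘ₗ q.symm.toLinearMap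
  have hj : ∀ x, j (ε x) = w x := fun x => by
    show (LinearMap.ker ε).liftQ w hw1 (q.symm (ε x)) = _
    have : q.symm (ε x) = (LinearMap.ker ε).mkQ x := by
      rw [LinearEquiv.symm_apply_eq]; rfl
    rw [this]; rfl
  refine Module.Projective.of_split j (ε ∘ₗ z) (LinearMap.ext fun t => ?_)
  obtain ⟨x, rfl⟩ := hε t
  show ε (z (j (ε x))) = ε x
  rw [hj]
  have hx : C.d2 x = 0 := x.2
  have e1 : z (w x) = x - ⟨C.d1 (ρ' x), LinearMap.mem_ker.2 (C.d21 _)⟩ := Subtype.ext (by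
    show ((x : A2) - C.d1 (ρ' x)) - τ (C.d2 ((x : A2) - C.d1 (ρ' x))) = (x : A2) - C.d1 (ρ' x)
    rw [map_sub, hx, C.d21]; simp)
  rw [e1, map_sub, hk', sub_zero]

end

/-- the local contraction data exist -/
theorem U_exists [Module.Projective R A1] [Module.Projective R A2] [Module.Projective R A3]
    [Module.Projective R A4] {E : Type} [AddCommGroup E] [Module R E]
    (ε : LinearMap.ker C.d2 →ₗ[R] E) (hε : Function.Surjective ε)
    (hk : ∀ x, ε x = 0 → ∃ y, C.d1 y = x) (hk' : ∀ y (h : C.d1 y ∈ LinearMap.ker C.d2), ε ⟨C.d1 y, h⟩ = 0)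
    (i0 : ∀ x, C.d0 x = 0 → x = 0) (i1 : ∀ x, C.d1 x = 0 → ∃ y, C.d0 y = x)
    (s1 s2 s : R) (i4 : ∀ x, ∃ y, C.d3 y = s1 • x) (i3 : ∀ x, C.d3 x = 0 → ∃ y, C.d2 y = s2 • x)
    (a1 a2 : E) (b1 b2 : E →ₗ[R] R) (b11 : b1 a1 = s) (b12 : b1 a2 = 0) (b21 : b2 a1 = 0) (b22 : b2 a2 = s)
    (hs : ∀ x, s • x = b1 x • a1 + b2 x • a2) : Nonempty (C.U (s2 * s1 * s)) := by
  obtain ⟨h4, e4⟩ := lift_exists C.d3 (s1 • LinearMap.id) i4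
  simp only [LinearMap.smul_apply, LinearMap.id_apply] at e4
  obtain ⟨h3, e3⟩ := lift_exists C.d2 (s2 • (s1 • LinearMap.id - h4 ∘ₗ C.d3)) (fun x => i3 _ (by
    simp [e4]))
  simp only [LinearMap.smul_apply, LinearMap.id_apply, LinearMap.sub_apply, LinearMap.comp_apply] at e3
  let u : A2 →ₗ[R] LinearMap.ker C.d2 := LinearMap.codRestrict _ ((s2 * s1) • LinearMap.id - h3 ∘ₗ C.d2)
    (fun x => by simp [e3, C.d32, mul_smul])
  have hu : ∀ x, (u x : A2) = (s2 * s1) • x - h3 (C.d2 x) := fun x => rfl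
  obtain ⟨c1, hc1⟩ := hε a1
  obtain ⟨c2, hc2⟩ := hε a2
  have uk : ∀ x : LinearMap.ker C.d2, u x = (s2 * s1) • x := fun x => Subtype.ext (by
    rw [hu, show C.d2 x = 0 from x.2]; simp)
  have ud : ∀ x, ε (u (C.d1 x)) = 0 := fun x => by
    have := uk ⟨C.d1 x, LinearMap.mem_ker.2 (C.d21 x)⟩
    simp only at this
    rw [this, map_smul, hk', smul_zero]
  let β1 : A2 →ₗ[R] R := b1 ∘ₗ ε ∘ₗ u
  let β2 : A2 →ₗ[R] R := b2 ∘ₗ ε ∘ₗ u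
  have hβ1 : ∀ x, β1 x = b1 (ε (u x)) := fun x => rfl
  have hβ2 : ∀ x, β2 x = b2 (ε (u x)) := fun x => rfl
  obtain ⟨h2, e2⟩ := lift_exists C.d1 ((LinearMap.ker C.d2).subtype ∘ₗ
    (s • u - β1.smulRight c1 - β2.smulRight c2)) (fun x => hk
      ((s • u - β1.smulRight c1 - β2.smulRight c2) x) (by
      simp only [LinearMap.sub_apply, LinearMap.smul_apply, LinearMap.smulRight_apply, map_sub, map_smul,
        hc1, hc2, hs (ε (u x)), hβ1, hβ2]
      abel))
  have e2 : ∀ x, C.d1 (h2 x) = s • ((s2 * s1) • x - h3 (C.d2 x)) - β1 x • (c1 : A2) - β2 x • (c2 : A2) :=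
    fun x => by rw [e2]; rfl
  have β1d : ∀ x, β1 (C.d1 x) = 0 := fun x => by rw [hβ1, ud, map_zero]
  have β2d : ∀ x, β2 (C.d1 x) = 0 := fun x => by rw [hβ2, ud, map_zero]
  obtain ⟨h1, e1⟩ := lift_exists C.d0 ((s2 * s1 * s) • LinearMap.id - h2 ∘ₗ C.d1) (fun x => i1 _ (by
    simp only [LinearMap.sub_apply, LinearMap.smul_apply, LinearMap.comp_apply, LinearMap.id_apply,
      map_sub, map_smul, e2, β1d, β2d, C.d21, map_zero, smul_sub, zero_smul, smul_zero, sub_zero]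
    rw [smul_smul, mul_comm s, sub_self]))
  simp only [LinearMap.smul_apply, LinearMap.id_apply, LinearMap.sub_apply, LinearMap.comp_apply] at e1
  refine ⟨⟨h1, h2, s • h3, (s2 * s) • h4, c1, c2, β1, β2, c1.2, c2.2, β1d, β2d, ?_, ?_, ?_, ?_, ?_, ?_,
    ?_, ?_, ?_⟩⟩
  · rw [hβ1, uk, map_smul, map_smul, hc1, b11]; rfl
  · rw [hβ1, uk, map_smul, map_smul, hc2, b12, smul_zero]
  · rw [hβ2, uk, map_smul, map_smul, hc1, b21, smul_zero]
  · rw [hβ2, uk, map_smul, map_smul, hc2, b22]; rfl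
  · intro x
    rw [← sub_eq_zero]
    apply i0
    rw [map_sub, e1, C.d10, map_smul]; simp
  · intro x; rw [e1]; abel
  · intro x; rw [e2, LinearMap.smul_apply, smul_sub, smul_smul, mul_comm s]; abel
  · intro x
    rw [LinearMap.smul_apply, map_smul, e3, LinearMap.smul_apply]
    module
  · intro x; rw [LinearMap.smul_apply, map_smul, e4, smul_smul, mul_right_comm]

end C5

end PartP9a

section PartP9b

section pd
variable (R : Type) [CommRing R]

/-- projective dimension at most `k` -/
def PD (k : ℕ) (M : Type) [AddCommGroup M] [Module R M] : Prop :=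
  HasProjectiveDimensionLT (ModuleCat.of R M) (k+1)

variable {R} {M' M M'' : Type} [AddCommGroup M'] [Module R M'] [AddCommGroup M] [Module R M]
  [AddCommGroup M''] [Module R M'']

lemma PD.zero_iff : PD R 0 M ↔ Module.Projective R M := by
  rw [IsProjective.iff_projective, projective_iff_hasProjectiveDimensionLT_one]; rfl

lemma PD.left {k : ℕ} (f : M' →ₗ[R] M) (g : M →ₗ[R] M'') (h : Function.Exact f g)
    (hf : Function.Injective f) (hg : Function.Surjective g) [hM : Module.Projective R M]
    (h3 : PD R (k+1) M'') : PD R k M' := by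
  have hS := scOf_shortExact f g h hf hg
  exact (hS.hasProjectiveDimensionLT_X₃_iff k ((IsProjective.iff_projective M).1 hM)).1 h3

lemma PD.right {k : ℕ} (f : M' →ₗ[R] M) (g : M →ₗ[R] M'') (h : Function.Exact f g)
    (hf : Function.Injective f) (hg : Function.Surjective g) [hM : Module.Projective R M]
    (h1 : PD R k M') : PD R (k+1) M'' := by
  have hS := scOf_shortExact f g h hf hg
  exact (hS.hasProjectiveDimensionLT_X₃_iff k ((IsProjective.iff_projective M).1 hM)).2 h1

lemma ker_exact (g : M →ₗ[R] M'') : Function.Exact (LinearMap.ker g).subtype g := fun x => by simp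

lemma FFR.pd {k : ℕ} : ∀ {M : Type} [AddCommGroup M] [Module R M], FFR R k M → PD R k M := by
  induction k with
  | zero =>
    intro M _ _ h
    have := (FFR.zero_iff.1 h).2
    exact PD.zero_iff.2 inferInstance
  | succ k ih =>
    intro M _ _ h
    obtain ⟨g, f, hf, h⟩ := h
    exact PD.right (LinearMap.ker f).subtype f (ker_exact f) (Submodule.injective_subtype _) hf (ih h)

/-- one step of a resolution -/
lemma PD.step [IsNoetherianRing R] {k : ℕ} [Module.Finite R M] (h : PD R (k+1) M) :
    ∃ (m : ℕ) (N : Type) (_ : AddCommGroup N) (_ : Module R N) (i : N →ₗ[R] (Fin m → R))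
      (π : (Fin m → R) →ₗ[R] M), Function.Injective i ∧ Function.Surjective π ∧ Function.Exact i π ∧
      Module.Finite R N ∧ PD R k N := by
  obtain ⟨m, π, hπ⟩ := Module.Finite.exists_fin' R M
  exact ⟨m, LinearMap.ker π, inferInstance, inferInstance, (LinearMap.ker π).subtype, π,
    Submodule.injective_subtype _, hπ, ker_exact π, inferInstance,
    PD.left (LinearMap.ker π).subtype π (ker_exact π) (Submodule.injective_subtype _) hπ h⟩

end pd

section lp
variable {R : Type} [CommRing R] (I : Ideal R) 

/-- locally (off `I`) projective -/
def LP (B : Type) [AddCommGroup B] [Module R B] : Prop :=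
  ∀ p : Ideal R, p.IsPrime → p ≠ I → ∃ s, s ∉ p ∧ ∃ (r : ℕ) (α : (Fin r → R) →ₗ[R] B)
    (β : B →ₗ[R] (Fin r → R)), ∀ x, α (β x) = s • x

variable {I} [IsNoetherianRing R] {B : Type} [AddCommGroup B] [Module R B]

lemma finite_dual [Module.Finite R B] : Module.Finite R (B →ₗ[R] R) := by
  obtain ⟨m, π, hπ⟩ := Module.Finite.exists_fin' R B
  exact Module.Finite.of_injective (LinearMap.lcomp R R π) fun f g h => by
    refine LinearMap.ext fun x => ?_
    obtain ⟨y, rfl⟩ := hπ x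
    exact LinearMap.congr_fun h y

lemma LP.step [Module.Finite R B] (h : LP I B) : ∃ (g : ℕ) (C : Type) (_ : AddCommGroup C) (_ : Module R C)
    (f : B →ₗ[R] (Fin g → R)) (π : (Fin g → R) →ₗ[R] C), Function.Surjective π ∧ Function.Exact f π ∧
    (∀ p : Ideal R, p.IsPrime → p ≠ I → ∃ s, s ∉ p ∧ ∀ x, f x = 0 → s • x = 0) ∧ LP I C := by
  have := finite_dual (R := R) (B := B)
  obtain ⟨g, F, hF⟩ := Module.Finite.exists_fin (R := R) (M := B →ₗ[R] R)
  let f : B →ₗ[R] (Fin g → R) := LinearMap.pi F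
  have hf : ∀ b : B →ₗ[R] R, ∃ c : (Fin g → R) →ₗ[R] R, ∀ x, b x = c (f x) := fun b => by
    have hb : b ∈ Submodule.span R (Set.range F) := by rw [hF]; trivial
    obtain ⟨c, hc⟩ := (Submodule.mem_span_range_iff_exists_fun R).1 hb
    refine ⟨∑ i, c i • LinearMap.proj i, fun x => ?_⟩
    rw [← hc, LinearMap.sum_apply, LinearMap.sum_apply]
    rfl
  have hloc : ∀ p : Ideal R, p.IsPrime → p ≠ I → ∃ s, s ∉ p ∧ ∃ θ : (Fin g → R) →ₗ[R] B,
      ∀ x, θ (f x) = s • x := fun p hp hpI => by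
    obtain ⟨s, hs, r, α, β, hαβ⟩ := h p hp hpI
    choose c hc using fun k : Fin r => hf (LinearMap.proj k ∘ₗ β)
    refine ⟨s, hs, α ∘ₗ LinearMap.pi c, fun x => ?_⟩
    rw [← hαβ, LinearMap.comp_apply]
    congr 1
    ext k
    exact (hc k x).symm
  refine ⟨g, _, inferInstance, inferInstance, f, (LinearMap.range f).mkQ, Submodule.mkQ_surjective _,
    LinearMap.exact_map_mkQ_range f, fun p hp hpI => ?_, fun p hp hpI => ?_⟩
  · obtain ⟨s, hs, θ, hθ⟩ := hloc p hp hpI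
    exact ⟨s, hs, fun x hx => by rw [← hθ, hx, map_zero]⟩
  · obtain ⟨s, hs, θ, hθ⟩ := hloc p hp hpI
    refine ⟨s, hs, g, (LinearMap.range f).mkQ,
      (LinearMap.range f).liftQ (s • LinearMap.id - f ∘ₗ θ) ?_, fun x => ?_⟩
    · rintro _ ⟨x, rfl⟩
      rw [LinearMap.mem_ker]
      simp [hθ]
    · obtain ⟨y, rfl⟩ := Submodule.mkQ_surjective _ x
      have h0 : (LinearMap.range f).mkQ (f (θ y)) = 0 :=
        (Submodule.Quotient.mk_eq_zero _).2 ⟨_, rfl⟩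
      have h1 : (LinearMap.range f).mkQ (s • y - f (θ y)) = s • (LinearMap.range f).mkQ y := by
        rw [map_sub, h0, sub_zero, map_smul]
      exact h1

lemma range_exact {C : Type} [AddCommGroup C] [Module R C] {g : ℕ} (f : B →ₗ[R] (Fin g → R))
    (π : (Fin g → R) →ₗ[R] C) (hex : Function.Exact f π) :
    Function.Exact (LinearMap.range f).subtype π := fun x => by
  rw [hex x]; simp

lemma LP.step_lv [Module.Finite R B] {d : ℕ} (H : PS R I d) {g : ℕ} {C : Type} [AddCommGroup C] [Module R C]
    (f : B →ₗ[R] (Fin g → R)) (π : (Fin g → R) →ₗ[R] C) (hπ : Function.Surjective π)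
    (hex : Function.Exact f π)
    (hk : ∀ p : Ideal R, p.IsPrime → p ≠ I → ∃ s, s ∉ p ∧ ∀ x, f x = 0 → s • x = 0) (i : ℕ) (hi : i < d)
    (h : LV I (i+1) B) : LV I i C := by
  have h1 : LV I (i+1) (LinearMap.range f) := by
    refine LV.of_loc f.rangeRestrict (fun p hp hpI => ?_) (fun p hp hpI => ?_) h
    · obtain ⟨s, hs, h⟩ := hk p hp hpI
      exact ⟨s, hs, fun x hx => h x (congrArg Subtype.val hx)⟩
    · exact ⟨1, fun h => hp.ne_top ((Ideal.eq_top_iff_one p).2 h), fun y => by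
        obtain ⟨x, hx⟩ := f.surjective_rangeRestrict y
        exact ⟨x, by rw [hx, one_smul]⟩⟩
  exact LV.right (LinearMap.range f).subtype π (range_exact f π hex) (Submodule.injective_subtype _) hπ
    (H.lv _ i hi) h1

lemma LP.inj [Module.Finite R B] {g : ℕ} (f : B →ₗ[R] (Fin g → R))
    (hk : ∀ p : Ideal R, p.IsPrime → p ≠ I → ∃ s, s ∉ p ∧ ∀ x, f x = 0 → s • x = 0)
    (h : LV I 0 B) : Function.Injective f := by
  have h0 : LV I 0 (LinearMap.ker f) :=
    LV.zero_of_injective (LinearMap.ker f).subtype (Submodule.injective_subtype _) h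
  have ht : Tors I (LinearMap.ker f) := tors_of_loc fun p hp hpI => by
    obtain ⟨s, hs, h⟩ := hk p hp hpI
    exact ⟨s, hs, fun x => Subtype.ext (h x x.2)⟩
  have := Tors.subsingleton h0 ht
  exact LinearMap.ker_eq_bot.1 ((Submodule.subsingleton_iff_eq_bot).1 this)

lemma LP.pd {d : ℕ} (H : PS R I d)
    (hF : ∀ (M : Type) [AddCommGroup M] [Module R M] [Module.Finite R M], FFR R d M) (k : ℕ) :
    ∀ (B : Type) [AddCommGroup B] [Module R B] [Module.Finite R B], LP I B → k ≤ d →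
      (∀ i < k, LV I i B) → PD R (d - k) B := by
  induction k with
  | zero => intro B _ _ _ _ _ _; exact (hF B).pd
  | succ k ih =>
    intro B _ _ _ h hk hv
    obtain ⟨g, C, _, _, f, π, hπ, hex, hloc, hC⟩ := h.step
    have : Module.Finite R C := Module.Finite.of_surjective π hπ
    have h1 := ih C hC (by omega) fun i hi =>
      LP.step_lv H f π hπ hex hloc i (by omega) (hv (i+1) (by omega))
    rw [show d - k = (d - (k+1)) + 1 by omega] at h1
    exact PD.left f π hex (LP.inj f hloc (hv 0 (by omega))) hπ h1

end lp

end PartP9b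

section PartP9c

theorem main_abs {R : Type} [CommRing R] [IsNoetherianRing R] [IsDomain R] {I : Ideal R} {d : ℕ}
    (H : PS R I d) (hd : 9 ≤ d) (hc : (2:R) = 0 ∨ ∃ c : R, c * 2 = 1)
    (hF : ∀ (M : Type) [AddCommGroup M] [Module R M] [Module.Finite R M], FFR R d M)
    (E : Type) [AddCommGroup E] [Module R E] [Module.Finite R E]
    (hE : ∀ p : Ideal R, p.IsPrime → p ≠ I → ∃ s, s ∉ p ∧ ∃ (a1 a2 : E) (b1 b2 : E →ₗ[R] R),
      b1 a1 = s ∧ b1 a2 = 0 ∧ b2 a1 = 0 ∧ b2 a2 = s ∧ ∀ x, s • x = b1 x • a1 + b2 x • a2)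
    (h0 : LV I 0 E) (h1 : LV I 1 E) (hv : ∀ j, 4 ≤ j → j + 3 ≤ d → LV I j E) : Module.Projective R E := by
  have lE : LP I E := fun p hp hpI => by
    obtain ⟨s, hs, a1, a2, b1, b2, -, -, -, -, h⟩ := hE p hp hpI
    refine ⟨s, hs, 2, (LinearMap.proj 0).smulRight a1 + (LinearMap.proj 1).smulRight a2,
      LinearMap.pi ![b1, b2], fun x => ?_⟩
    simp [h]
  -- the coresolution
  obtain ⟨g0, B1, _, _, f0, π0, sπ0, ex0, k0, l1⟩ := lE.step
  have fin1 : Module.Finite R B1 := Module.Finite.of_surjective π0 sπ0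
  obtain ⟨g1, B2, _, _, f1, π1, sπ1, ex1, k1, l2⟩ := l1.step
  have fin2 : Module.Finite R B2 := Module.Finite.of_surjective π1 sπ1
  obtain ⟨g2, B3, _, _, f2, π2, sπ2, ex2, k2, l3⟩ := l2.step
  have fin3 : Module.Finite R B3 := Module.Finite.of_surjective π2 sπ2
  obtain ⟨g3, B4, _, _, f3, π3, sπ3, ex3, k3, l4⟩ := l3.step
  have fin4 : Module.Finite R B4 := Module.Finite.of_surjective π3 sπ3
  have i0 : Function.Injective f0 := LP.inj f0 k0 h0
  have i1 : Function.Injective f1 := LP.inj f1 k1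
    (LP.step_lv H f0 π0 sπ0 ex0 k0 0 (by omega) h1)
  have v4 : ∀ i < d - 6, LV I i B4 := fun i hi =>
    LP.step_lv H f3 π3 sπ3 ex3 k3 i (by omega) <|
    LP.step_lv H f2 π2 sπ2 ex2 k2 (i+1) (by omega) <|
    LP.step_lv H f1 π1 sπ1 ex1 k1 (i+1+1) (by omega) <|
    LP.step_lv H f0 π0 sπ0 ex0 k0 (i+1+1+1) (by omega) <| hv (i+1+1+1+1) (by omega) (by omega)
  have pd4 : PD R 6 B4 := by
    have := LP.pd H hF (d - 6) B4 l4 (by omega) v4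
    rwa [show d - (d - 6) = 6 by omega] at this
  have pd3 : PD R 5 (LinearMap.range f3) :=
    PD.left (LinearMap.range f3).subtype π3 (range_exact f3 π3 ex3) (Submodule.injective_subtype _) sπ3 pd4
  let γ : (Fin g2 → R) →ₗ[R] LinearMap.range f3 := f3.rangeRestrict ∘ₗ π2
  have hγ : Function.Surjective γ := f3.surjective_rangeRestrict.comp sπ2
  have hγ0 : ∀ x, γ x = 0 ↔ f3 (π2 x) = 0 := fun x =>
    ⟨fun h => congrArg Subtype.val h, fun h => Subtype.ext h⟩
  have pdY : PD R 4 (LinearMap.ker γ) :=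
    PD.left (LinearMap.ker γ).subtype γ (ker_exact γ) (Submodule.injective_subtype _) hγ pd3
  -- resolution of Y
  obtain ⟨m1, N1, _, _, j1, ρ1, ij1, sρ1, xρ1, fn1, pn1⟩ := pdY.step
  obtain ⟨m2, N2, _, _, j2, ρ2, ij2, sρ2, xρ2, fn2, pn2⟩ := pn1.step
  obtain ⟨m3, N3, _, _, j3, ρ3, ij3, sρ3, xρ3, fn3, pn3⟩ := pn2.step
  obtain ⟨m4, N4, _, _, j4, ρ4, ij4, sρ4, xρ4, fn4, pn4⟩ := pn3.step
  have prj : Module.Projective R N4 := PD.zero_iff.1 pn4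
  -- exactness
  let q2 := j1 ∘ₗ ρ2
  let q3 := j2 ∘ₗ ρ3
  let q4 := j3 ∘ₗ ρ4
  have x1 : ∀ x, ρ1 x = 0 ↔ ∃ y, q2 y = x := fun x => by
    rw [xρ1 x]
    constructor
    · rintro ⟨y, rfl⟩
      obtain ⟨z, rfl⟩ := sρ2 y
      exact ⟨z, rfl⟩
    · rintro ⟨y, rfl⟩; exact ⟨_, rfl⟩
  have x2 : ∀ x, q2 x = 0 ↔ ∃ y, q3 y = x := fun x => by
    rw [show q2 x = 0 ↔ ρ2 x = 0 from map_eq_zero_iff j1 ij1, xρ2 x]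
    constructor
    · rintro ⟨y, rfl⟩
      obtain ⟨z, rfl⟩ := sρ3 y
      exact ⟨z, rfl⟩
    · rintro ⟨y, rfl⟩; exact ⟨_, rfl⟩
  have x3 : ∀ x, q3 x = 0 ↔ ∃ y, q4 y = x := fun x => by
    rw [show q3 x = 0 ↔ ρ3 x = 0 from map_eq_zero_iff j2 ij2, xρ3 x]
    constructor
    · rintro ⟨y, rfl⟩
      obtain ⟨z, rfl⟩ := sρ4 y
      exact ⟨z, rfl⟩
    · rintro ⟨y, rfl⟩; exact ⟨_, rfl⟩
  have x4 : ∀ x, q4 x = 0 ↔ ∃ y, j4 y = x := fun x => by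
    rw [show q4 x = 0 ↔ ρ4 x = 0 from map_eq_zero_iff j3 ij3, xρ4 x]; rfl
  -- the maps
  let δ0 := f1 ∘ₗ π0
  let δ1 := f2 ∘ₗ π1
  have y0 : ∀ x, δ0 x = 0 ↔ ∃ y, f0 y = x := fun x => by
    rw [show δ0 x = 0 ↔ π0 x = 0 from map_eq_zero_iff f1 i1, ex0 x]; rfl
  have δ10 : ∀ x, δ1 (δ0 x) = 0 := fun x => by
    show f2 (π1 (f1 (π0 x))) = 0
    rw [(ex1 _).2 ⟨_, rfl⟩, map_zero]
  have hδ1 : ∀ x, γ (δ1 x) = 0 := fun x => by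
    rw [hγ0, show π2 (δ1 x) = 0 from (ex2 _).2 ⟨_, rfl⟩, map_zero]
  let δ1' : (Fin g1 → R) →ₗ[R] LinearMap.ker γ := LinearMap.codRestrict _ δ1 hδ1
  have hδ1' : ∀ x, (δ1' x : Fin g2 → R) = δ1 x := fun x => rfl
  obtain ⟨a1, ha1⟩ := Module.projective_lifting_property ρ1 δ1' sρ1
  have ha1 : ∀ x, ρ1 (a1 x) = δ1' x := fun x => LinearMap.congr_fun ha1 x
  obtain ⟨a0, ha0⟩ := C5.lift_exists q2 (-(a1 ∘ₗ δ0)) (fun x => (x1 _).1 (by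
    rw [LinearMap.neg_apply, map_neg, LinearMap.comp_apply, ha1, neg_eq_zero]
    exact Subtype.ext (δ10 x)))
  have ha0 : ∀ x, q2 (a0 x) = - a1 (δ0 x) := ha0
  clear_value q2 q3 q4 δ1'
  let C : C5 R N4 (Fin m4 → R) ((Fin m3 → R) × (Fin g0 → R)) ((Fin m2 → R) × (Fin g1 → R)) (Fin m1 → R) :=
    { d0 := j4
      d1 := LinearMap.inl R _ _ ∘ₗ q4
      d2 := LinearMap.coprod (LinearMap.inl R _ _ ∘ₗ q3) (a0.prod δ0)
      d3 := q2.coprod a1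
      d10 := fun x => by
        have : q4 (j4 x) = 0 := (x4 _).2 ⟨x, rfl⟩
        simp [this]
      d21 := fun x => by
        have : q3 (q4 x) = 0 := (x3 _).2 ⟨x, rfl⟩
        simp [this]
      d32 := fun x => by
        have : q2 (q3 x.1) = 0 := (x2 _).2 ⟨_, rfl⟩
        simp [this, ha0] }
  have Cd2 : ∀ x y, C.d2 (x, y) = (q3 x + a0 y, δ0 y) := fun x y => by simp [C]
  have Cd3 : ∀ x y, C.d3 (x, y) = q2 x + a1 y := fun x y => by simp [C]
  have Cd1 : ∀ x, C.d1 x = (q4 x, 0) := fun x => rfl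
  have Cd0 : ∀ x, C.d0 x = j4 x := fun x => rfl
  clear_value C
  have hker : ∀ x : LinearMap.ker C.d2, x.1.2 ∈ LinearMap.range f0 := by
    rintro ⟨⟨x, y⟩, h⟩
    rw [LinearMap.mem_ker, Cd2] at h
    exact (y0 _).1 (Prod.ext_iff.1 h).2
  let ε : LinearMap.ker C.d2 →ₗ[R] E := (LinearEquiv.ofInjective f0 i0).symm.toLinearMap ∘ₗ
    LinearMap.codRestrict _ (LinearMap.snd R _ _ ∘ₗ (LinearMap.ker C.d2).subtype) hker
  have hε : ∀ x, f0 (ε x) = x.1.2 := fun x => by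
    have := (LinearEquiv.ofInjective f0 i0).apply_symm_apply ⟨x.1.2, hker x⟩
    exact congrArg Subtype.val this
  clear_value ε
  have sε : Function.Surjective ε := fun e => by
    obtain ⟨z, hz⟩ := (x2 (a0 (f0 e))).1 (by rw [ha0, (y0 _).2 ⟨e, rfl⟩, map_zero, neg_zero])
    refine ⟨⟨(-z, f0 e), ?_⟩, i0 (hε _)⟩
    rw [LinearMap.mem_ker, Cd2, map_neg, hz, (y0 _).2 ⟨e, rfl⟩, neg_add_cancel]; rfl
  have kε : ∀ x, ε x = 0 → ∃ y, C.d1 y = x := by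
    rintro ⟨⟨x, y⟩, h⟩ hx
    have hy := hε ⟨⟨x, y⟩, h⟩
    rw [hx, map_zero] at hy
    have hy : (0 : Fin g0 → R) = y := hy
    subst hy
    rw [LinearMap.mem_ker, Cd2, map_zero, add_zero] at h
    obtain ⟨w, hw⟩ := (x3 x).1 (Prod.ext_iff.1 h).1
    exact ⟨w, by rw [Cd1, hw]⟩
  have kε' : ∀ y (h : C.d1 y ∈ LinearMap.ker C.d2), ε ⟨C.d1 y, h⟩ = 0 := fun y h => i0 (by
    rw [hε, map_zero]; exact congrArg Prod.snd (Cd1 y))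
  refine C5.LU.proj C H hd hc (fun p hp hpI => ?_) ε sε kε kε'
  obtain ⟨s, hs, c1, c2, b1, b2, b11, b12, b21, b22, hb⟩ := hE p hp hpI
  obtain ⟨s2, hs2, hk2⟩ := k2 p hp hpI
  obtain ⟨s3, hs3, hk3⟩ := k3 p hp hpI
  refine ⟨s2 * s3 * s, ?_, C5.U_exists C ε sε kε kε' (fun x hx => ij4 (by rw [← Cd0, hx, map_zero]))
    (fun x hx => ?_) s3 s2 s (fun x => ?_) ?_ c1 c2 b1 b2 b11 b12 b21 b22 hb⟩
  · exact fun h => (hp.mem_or_mem h).elim (fun h => (hp.mem_or_mem h).elim hs2 hs3) hs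
  · rw [Cd1] at hx
    obtain ⟨w, hw⟩ := (x4 x).1 (Prod.ext_iff.1 hx).1
    exact ⟨w, by rw [Cd0, hw]⟩
  · have h1 : f3 (π2 (ρ1 x)) = 0 := (hγ0 _).1 (ρ1 x).2
    have h2 := hk3 _ h1
    rw [← map_smul] at h2
    obtain ⟨t, ht⟩ := (ex2 _).1 h2
    obtain ⟨t, rfl⟩ := sπ1 t
    obtain ⟨w, hw⟩ := (x1 (s3 • x - a1 t)).1 (by
      rw [map_sub, ha1, map_smul, sub_eq_zero]
      exact Subtype.ext (ht.symm.trans (hδ1' t).symm))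
    exact ⟨(w, t), by rw [Cd3, hw, sub_add_cancel]⟩
  · rintro ⟨x, y⟩ hxy
    rw [Cd3] at hxy
    have h1 : δ1 y = 0 := by
      rw [← hδ1', ← ha1, eq_neg_of_add_eq_zero_right hxy, map_neg, (x1 _).2 ⟨x, rfl⟩, neg_zero]; rfl
    have h2 := hk2 _ h1
    rw [← map_smul] at h2
    obtain ⟨t, ht⟩ := (ex1 _).1 h2
    obtain ⟨t, rfl⟩ := sπ0 t
    have ht : δ0 t = s2 • y := ht
    obtain ⟨w, hw⟩ := (x2 (s2 • x - a0 t)).1 (by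
      rw [map_sub, ha0, ht, map_smul, map_smul, sub_neg_eq_add, ← smul_add, hxy, smul_zero])
    exact ⟨(w, t), by rw [Cd2, hw, sub_add_cancel, ht]; rfl⟩

end PartP9c

theorem local_data {R : Type} [CommRing R] [IsNoetherianRing R] [IsDomain R] (E : Type)
    [AddCommGroup E] [Module R E] [Module.Finite R E] (p : Ideal R) [hp : p.IsPrime]
    (hf : Module.Free (Localization.AtPrime p) (LocalizedModule p.primeCompl E))
    (hr : Module.rank (Localization.AtPrime p) (LocalizedModule p.primeCompl E) = 2) :
    ∃ s, s ∉ p ∧ ∃ (a1 a2 : E) (b1 b2 : E →ₗ[R] R), b1 a1 = s ∧ b1 a2 = 0 ∧ b2 a1 = 0 ∧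
      b2 a2 = s ∧ ∀ x, s • x = b1 x • a1 + b2 x • a2 := by
  set A := Localization.AtPrime p with hA
  set L := LocalizedModule p.primeCompl E with hL
  haveI : Module.Finite A L := Module.finite_of_rank_eq_nat (n := 2) (by simpa using hr)
  have hfr : Module.finrank A L = 2 := Module.finrank_eq_of_rank_eq hr
  let e : Module.Basis (Fin 2) A L := Module.finBasisOfFinrankEq A L hfr
  let m : E →ₗ[R] L := LocalizedModule.mkLinearMap p.primeCompl E
  haveI : Module.FinitePresentation R E := Module.finitePresentation_of_finite R E
  let g : Fin 2 → E →ₗ[R] A := fun i => (e.coord i).restrictScalars R ∘ₗ m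
  have hb : ∀ i, ∃ (h : E →ₗ[R] R) (s : p.primeCompl), Algebra.linearMap R A ∘ₗ h = s • g i :=
    fun i => Module.FinitePresentation.exists_lift_of_isLocalizedModule p.primeCompl
      (Algebra.linearMap R A) (g i)
  choose c σ hc using hb
  have hc' : ∀ i x, algebraMap R A (c i x) = algebraMap R A (σ i) * e.coord i (m x) := fun i x => by
    have := LinearMap.congr_fun (hc i) x
    rw [LinearMap.smul_apply, Submonoid.smul_def, Algebra.smul_def] at this
    exact this
  have ha : ∀ i, ∃ (t : p.primeCompl) (a : E), m a = (t : R) • e i := fun i => by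
    obtain ⟨⟨a, t⟩, h⟩ := IsLocalizedModule.surj p.primeCompl m (e i)
    exact ⟨t, a, h.symm⟩
  choose τ a ha using ha
  have inj : Function.Injective (algebraMap R A) :=
    IsLocalization.injective A p.primeCompl_le_nonZeroDivisors
  have hca : ∀ i j, c i (a j) = if i = j then (σ i * τ j : R) else 0 := fun i j => inj (by
    rw [hc', ha, ← algebraMap_smul A, map_smul, Module.Basis.coord_apply, e.repr_self,
      Finsupp.single_apply]
    by_cases h : i = j
    · subst h; simp
    · rw [if_neg (Ne.symm h), if_neg h]; simp)
  -- scaled data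
  let s' : R := σ 0 * σ 1 * (τ 0 * τ 1)
  let b1 : E →ₗ[R] R := (σ 1 : R) • c 0
  let b2 : E →ₗ[R] R := (σ 0 : R) • c 1
  let a1 : E := (τ 1 : R) • a 0
  let a2 : E := (τ 0 : R) • a 1
  have key : m ∘ₗ (b1.smulRight a1 + b2.smulRight a2) = m ∘ₗ (s' • LinearMap.id) := by
    ext x
    have h2 : m x = e.coord 0 (m x) • e 0 + e.coord 1 (m x) • e 1 := by
      conv_lhs => rw [← e.sum_repr (m x)]
      rw [Fin.sum_univ_two]; rfl
    simp only [LinearMap.comp_apply, LinearMap.add_apply, LinearMap.smulRight_apply, map_add,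
      map_smul, LinearMap.smul_apply, LinearMap.id_apply, b1, b2, a1, a2, s', ha, smul_eq_mul]
    conv_rhs => rw [h2]
    have sm : ∀ (r : R) (y : L), r • y = algebraMap R A r • y := fun r y =>
      (algebraMap_smul A r y).symm
    simp only [sm, map_mul, hc', smul_add, smul_smul]
    congr 2 <;> ring
  obtain ⟨u, hu⟩ := Module.Finite.exists_smul_of_comp_eq_of_isLocalizedModule p.primeCompl m _ _ key
  have hu' : ∀ x, (u : R) • (b1 x • a1 + b2 x • a2) = (u : R) • s' • x := fun x =>
    LinearMap.congr_fun hu x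
  refine ⟨u * s', ?_, (u : R) • a1, (u : R) • a2, b1, b2, ?_, ?_, ?_, ?_, fun x => ?_⟩
  · exact (u * (σ 0 * σ 1 * (τ 0 * τ 1)) : p.primeCompl).2
  · simp only [b1, a1, s', map_smul, LinearMap.smul_apply, hca, smul_eq_mul, if_true]; ring
  · simp [b1, a2, map_smul, LinearMap.smul_apply, hca]
  · simp [b2, a1, map_smul, LinearMap.smul_apply, hca]
  · simp only [b2, a2, s', map_smul, LinearMap.smul_apply, hca, smul_eq_mul, if_true]; ring
  · rw [mul_smul, ← hu', smul_add, smul_comm, smul_comm (u : R) (b2 x)]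

theorem two_cases (K : Type) [Field K] (n : ℕ) :
    (2 : PolyS K n) = 0 ∨ ∃ c : PolyS K n, c * 2 = 1 := by
  have e : (2 : PolyS K n) = MvPolynomial.C 2 := (map_ofNat _ 2).symm
  by_cases h : (2 : K) = 0
  · left; rw [e, h, map_zero]
  · right
    exact ⟨MvPolynomial.C 2⁻¹, by rw [e, ← map_mul, inv_mul_cancel₀ h, map_one]⟩

/-- Let `n ≥ 8` and let `E` be a rank two vector bundle on `ℙⁿ`
with `H^i_*(E) = 0` for all `i = 3, …, n-3`.  Then `E` splits as a direct sum of two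
line bundles. -/
theorem splitting_on_Pn_middle_vanishing
    (K : Type) [Field K] (n : ℕ) (hn : 8 ≤ n)
    (E : Type) [AddCommGroup E] [Module (PolyS K n) E]
    (hE : IsRankTwoBundleModule K n E)
    (hvan : ∀ i : ℕ, 3 ≤ i → i ≤ n - 3 → Subsingleton (Hstar K n i E)) :
    Module.Free (PolyS K n) E ∧ Module.rank (PolyS K n) E = 2 := by
  haveI := hE.finite
  have hP : Module.Projective (PolyS K n) E := by
    refine main_abs (ps_poly K n) (by omega) (two_cases K n)
      (fun M _ _ _ => ffr_poly K n M) E (fun p hp hpI => ?_)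
      (lv_of_localCohomology 0 hE.h0) (lv_of_localCohomology 1 hE.h1) (fun j h4 hj => ?_)
    · exact local_data E p (hE.locFree ⟨p, hp⟩ hpI) (hE.rank2 ⟨p, hp⟩ hpI)
    · obtain ⟨i, rfl⟩ : ∃ i, j = i + 1 := ⟨j - 1, by omega⟩
      exact lv_of_localCohomology (i + 1) (hvan i (by omega) (by omega))
  have hF : Module.Free (PolyS K n) E := QS.free_of_projective K n E
  refine ⟨hF, ?_⟩
  have hb : (⊥ : Ideal (PolyS K n)) ≠ irrel K n := fun h => (ps_poly K n).ne h.symm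
  have h2 := hE.rank2 ⟨⊥, Ideal.isPrime_bot⟩ hb
  have := Module.lift_rank_of_isLocalizedModule_of_free
    (Localization.AtPrime (⊥ : Ideal (PolyS K n))) (⊥ : Ideal (PolyS K n)).primeCompl
    (LocalizedModule.mkLinearMap (⊥ : Ideal (PolyS K n)).primeCompl E)
  rw [Cardinal.lift_id, Cardinal.lift_id] at this
  exact this.symm.trans h2
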